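/- Let Ω ⊂ ℝ³ be a bounded open set with Lipschitz boundary, let 1 < p < ∞ and −1 < α < p − 1. Then there exists a constant C = C(Ω, α, p) such that ∫_Ω d(x)^α |∇v(x)|^p dx ≤ C ∫_Ω d(x)^α |curl v(x)|^p dx for every smooth, compactly supported, divergence-free vector field v ∈ C^∞_{0,σ}(Ω). -/

import Mathlib

noncomputable section

open MeasureTheory Real Filter Topology Bornology ENNReal NNReal

/-- Euclidean 3-space. -/
abbrev E3 : Type := EuclideanSpace ℝ (Fin 3)

/-- Euclidean 2-space. -/
abbrev E2 : Type := EuclideanSpace ℝ (Fin 2)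

/-- The `i`-th standard basis vector of `E3`. -/
def ee (i : Fin 3) : E3 := EuclideanSpace.single i 1

/-- Partial derivative `∂ᵢ f` of a scalar function. -/
def pds (f : E3 → ℝ) (i : Fin 3) (x : E3) : ℝ := fderiv ℝ f x (ee i)

/-- Partial derivative `∂ᵢ vⱼ` of a vector field. -/
def pd (v : E3 → E3) (i j : Fin 3) (x : E3) : ℝ := fderiv ℝ v x (ee i) j

/-- Build a vector of `E3` from coordinates. -/
def mk3 (a b c : ℝ) : E3 := (WithLp.equiv 2 (Fin 3 → ℝ)).symm ![a, b, c]

/-- Build a vector of `E2` from coordinates. -/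
def mk2 (a b : ℝ) : E2 := (WithLp.equiv 2 (Fin 2 → ℝ)).symm ![a, b]

/-- First two coordinates `x'` of a point of `E3`. -/
def proj12 (y : E3) : E2 := mk2 (y 0) (y 1)

/-- Gradient of a scalar function, as a vector field. -/
def grad3 (f : E3 → ℝ) (x : E3) : E3 := mk3 (pds f 0 x) (pds f 1 x) (pds f 2 x)

/-- Gradient matrix `(∇v)ᵢⱼ = ∂ᵢ vⱼ` of a vector field. -/
def gradv (v : E3 → E3) (x : E3) (i j : Fin 3) : ℝ := pd v i j x

/-- Divergence of a vector field. -/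
def vdiv (v : E3 → E3) (x : E3) : ℝ := ∑ i, pd v i i x

/-- Curl `∇ × v` of a vector field. -/
def vcurl (v : E3 → E3) (x : E3) : E3 :=
  mk3 (pd v 1 2 x - pd v 2 1 x) (pd v 2 0 x - pd v 0 2 x) (pd v 0 1 x - pd v 1 0 x)

/-- Curl computed from a (weak) gradient matrix `G`, `(curl v)₁ = G₂₃ - G₃₂` etc. -/
def curlOf (G : E3 → Fin 3 → Fin 3 → ℝ) (x : E3) : E3 :=
  mk3 (G x 1 2 - G x 2 1) (G x 2 0 - G x 0 2) (G x 0 1 - G x 1 0)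

/-- Divergence computed from a (weak) gradient matrix. -/
def divOf (G : E3 → Fin 3 → Fin 3 → ℝ) (x : E3) : ℝ := ∑ i, G x i i

/-- Cross product on `E3`. -/
def cross3 (a b : E3) : E3 :=
  mk3 (a 1 * b 2 - a 2 * b 1) (a 2 * b 0 - a 0 * b 2) (a 0 * b 1 - a 1 * b 0)

/-- Euclidean dot product on `E3`. -/
def dot3 (a b : E3) : ℝ := ∑ i, a i * b i

/-- Frobenius (double-dot) product of two 3×3 matrices. -/
def mdot (A B : Fin 3 → Fin 3 → ℝ) : ℝ := ∑ i, ∑ j, A i j * B i j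

/-- Frobenius (Euclidean) norm of a 3×3 matrix. -/
def frob (M : Fin 3 → Fin 3 → ℝ) : ℝ := Real.sqrt (∑ i, ∑ j, (M i j) ^ 2)

/-- Symmetric part of a 3×3 matrix. -/
def symm3 (M : Fin 3 → Fin 3 → ℝ) (i j : Fin 3) : ℝ := (M i j + M j i) / 2

/-- Distance to the boundary of `Ω`. -/
def dB (Ω : Set E3) (x : E3) : ℝ := Metric.infDist x (frontier Ω)

/-- Scalar test functions: smooth compactly supported inside `Ω`. -/
structure IsTestS (Ω : Set E3) (ψ : E3 → ℝ) : Prop where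
  smooth : ContDiff ℝ (⊤ : ℕ∞) ψ
  compsupp : HasCompactSupport ψ
  suppin : tsupport ψ ⊆ Ω

/-- Vector test functions: smooth compactly supported inside `Ω`. -/
structure IsTest (Ω : Set E3) (φ : E3 → E3) : Prop where
  smooth : ContDiff ℝ (⊤ : ℕ∞) φ
  compsupp : HasCompactSupport φ
  suppin : tsupport φ ⊆ Ω

/-- Solenoidal (divergence-free) vector test functions `C^∞_{0,σ}(Ω)`. -/
structure IsTestSol (Ω : Set E3) (φ : E3 → E3) extends IsTest Ω φ : Prop where
  sol : ∀ x, vdiv φ x = 0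

/-- `G` is the distributional gradient of the vector field `v` on `Ω`. -/
def HasWeakGrad (Ω : Set E3) (v : E3 → E3) (G : E3 → Fin 3 → Fin 3 → ℝ) : Prop :=
  ∀ ψ : E3 → ℝ, IsTestS Ω ψ → ∀ i j,
    ∫ x in Ω, v x j * pds ψ i x = - ∫ x in Ω, G x i j * ψ x

/-- `G` is the distributional gradient of the scalar function `u` on `Ω`. -/
def HasWeakGradS (Ω : Set E3) (u : E3 → ℝ) (G : E3 → E3) : Prop :=
  ∀ ψ : E3 → ℝ, IsTestS Ω ψ → ∀ i,
    ∫ x in Ω, u x * pds ψ i x = - ∫ x in Ω, G x i * ψ x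

/-- Membership `v ∈ W^{1,p}_{0,σ}(Ω, d^α)` (with distributional gradient `G`):
`v` is measurable, `G` is its distributional gradient, the weighted norm is finite and
`v` is approximated by smooth compactly supported *solenoidal* fields in the weighted norm.
The unweighted space corresponds to `α = 0`. -/
structure MemW1pSigma (Ω : Set E3) (p α : ℝ) (v : E3 → E3)
    (G : E3 → Fin 3 → Fin 3 → ℝ) : Prop where
  meas : AEStronglyMeasurable v (volume.restrict Ω)
  weak_grad : HasWeakGrad Ω v G
  finite : IntegrableOn (fun x => dB Ω x ^ α * (‖v x‖ ^ p + frob (G x) ^ p)) Ω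
  approx : ∃ φ : ℕ → E3 → E3, (∀ n, IsTestSol Ω (φ n)) ∧
    Tendsto (fun n => ∫ x in Ω, dB Ω x ^ α *
        (‖v x - φ n x‖ ^ p + frob (fun i j => G x i j - gradv (φ n) x i j) ^ p))
      atTop (nhds 0)

/-- Membership `v ∈ W^{1,p}_0(Ω, d^α)` (with distributional gradient `G`):
as `MemW1pSigma` but approximating fields need not be divergence free. -/
structure MemW1p0 (Ω : Set E3) (p α : ℝ) (v : E3 → E3)
    (G : E3 → Fin 3 → Fin 3 → ℝ) : Prop where
  meas : AEStronglyMeasurable v (volume.restrict Ω)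
  weak_grad : HasWeakGrad Ω v G
  finite : IntegrableOn (fun x => dB Ω x ^ α * (‖v x‖ ^ p + frob (G x) ^ p)) Ω
  approx : ∃ φ : ℕ → E3 → E3, (∀ n, IsTest Ω (φ n)) ∧
    Tendsto (fun n => ∫ x in Ω, dB Ω x ^ α *
        (‖v x - φ n x‖ ^ p + frob (fun i j => G x i j - gradv (φ n) x i j) ^ p))
      atTop (nhds 0)

/-- A bounded open set of `ℝ³` with Lipschitz (`C^{0,1}`) boundary: near every boundary
point, after a rigid change of coordinates, the boundary is the graph of a Lipschitz
function `a` (with Lipschitz constant `r < 1`) and `Ω` lies locally above the graph. -/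
structure IsLipschitzDomain (Ω : Set E3) : Prop where
  nonempty : Ω.Nonempty
  isOpen : IsOpen Ω
  isBounded : IsBounded Ω
  charts : ∀ P ∈ frontier Ω, ∃ (f : E3 ≃ᵢ E3) (R R' r : ℝ) (a : E2 → ℝ),
    f P = 0 ∧ 0 < R ∧ 0 < R' ∧ 0 < r ∧ r < 1 ∧
    LipschitzWith (Real.toNNReal r) a ∧
    (∀ x' : E2, ‖x'‖ < R → |a x'| < R') ∧
    (∀ y : E3, ‖proj12 y‖ < R → |y 2| < R' →
      (f.symm y ∈ frontier Ω ↔ y 2 = a (proj12 y))) ∧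
    (∀ y : E3, ‖proj12 y‖ < R →
      a (proj12 y) < y 2 → y 2 < a (proj12 y) + R' → f.symm y ∈ Ω)

/-- A bounded open set of `ℝ³` with smooth (`C^∞`) boundary. -/
structure IsSmoothDomain (Ω : Set E3) : Prop where
  nonempty : Ω.Nonempty
  isOpen : IsOpen Ω
  isBounded : IsBounded Ω
  charts : ∀ P ∈ frontier Ω, ∃ (f : E3 ≃ᵢ E3) (R R' : ℝ) (a : E2 → ℝ),
    f P = 0 ∧ 0 < R ∧ 0 < R' ∧ ContDiff ℝ (⊤ : ℕ∞) a ∧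
    (∀ x' : E2, ‖x'‖ < R → |a x'| < R') ∧
    (∀ y : E3, ‖proj12 y‖ < R → |y 2| < R' →
      (f.symm y ∈ frontier Ω ↔ y 2 = a (proj12 y))) ∧
    (∀ y : E3, ‖proj12 y‖ < R →
      a (proj12 y) < y 2 → y 2 < a (proj12 y) + R' → f.symm y ∈ Ω)

/-- The axis-parallel closed cube with center `c` and half side-length `h`. -/
def cube (c : E3) (h : ℝ) : Set E3 := {x | ∀ i, |x i - c i| ≤ h}

/-- Average of (the nonnegative part of) `f` over a set, valued in `ℝ≥0∞`. -/
def lavg (s : Set E3) (f : E3 → ℝ) : ℝ≥0∞ :=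
  (∫⁻ x in s, ENNReal.ofReal (f x)) / volume s

/-- The Muckenhoupt `A_p` condition for a weight `w` on `ℝ³`:
`(⨍_Q w)(⨍_Q w^{-1/(p-1)})^{p-1} ≤ C` uniformly over all cubes `Q`. -/
def IsMuckenhouptAp (w : E3 → ℝ) (p : ℝ) : Prop :=
  ∃ C : ℝ, ∀ (c : E3) (h : ℝ), 0 < h →
    lavg (cube c h) w * (lavg (cube c h) (fun x => w x ^ (-1 / (p - 1)))) ^ (p - 1)
      ≤ ENNReal.ofReal C

/-! ### The heat kernel -/

def gc0 : ℝ := (∫ z : E3, Real.exp (-(1/4) * ‖z‖^2))⁻¹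

def hk (s : ℝ) (z : E3) : ℝ := gc0 / s^3 * Real.exp (-‖z‖^2/(4*s^2))

def hk1 (i : Fin 3) (s : ℝ) (z : E3) : ℝ := -(z i)/(2*s^2) * hk s z

def hk2 (i m : Fin 3) (s : ℝ) (z : E3) : ℝ :=
  ((z i)*(z m)/(4*s^4) - (if i = m then 1 else 0)/(2*s^2)) * hk s z

def cv (k f : E3 → ℝ) (x : E3) : ℝ := ∫ y, k (x-y) * f y

structure Nice (f : E3 → ℝ) : Prop where
  meas : Measurable f
  bdd : ∃ R : ℝ, 0 < R ∧ (∀ x, |f x| ≤ R) ∧ ∀ x, R < ‖x‖ → f x = 0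

lemma gauss_integrable {b : ℝ} (hb : 0 < b) :
    Integrable (fun z : E3 => Real.exp (-b * ‖z‖^2)) := by
  have h := GaussianFourier.integrable_cexp_neg_mul_sq_norm_add (V := E3) (b := (b:ℂ))
    (by simpa using hb) 0 0
  have h2 := h.norm
  refine h2.congr (Eventually.of_forall fun z => ?_)
  simp only [Complex.norm_exp]
  congr 1
  simp [← Complex.ofReal_pow]

lemma gc0_pos : 0 < gc0 := by
  unfold gc0
  apply inv_pos.mpr
  rw [integral_pos_iff_support_of_nonneg (fun z => (Real.exp_pos _).le)
    (gauss_integrable (by norm_num))]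
  have : Function.support (fun z : E3 => Real.exp (-(1/4) * ‖z‖^2)) = Set.univ := by
    ext z; simp [Real.exp_ne_zero]
  rw [this]; simp

lemma hk_pos {s : ℝ} (hs : 0 < s) (z : E3) : 0 < hk s z := by
  unfold hk; have := gc0_pos; positivity

lemma gauss_scale {b s : ℝ} (hs : 0 < s) :
    ∫ z : E3, Real.exp (-b * ‖z‖^2 / s^2) = s^3 * ∫ z : E3, Real.exp (-b * ‖z‖^2) := by
  have h := Measure.integral_comp_inv_smul (volume : Measure E3)
    (fun z : E3 => Real.exp (-b * ‖z‖^2)) s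
  simp only [finrank_euclideanSpace, Fintype.card_fin, smul_eq_mul, abs_of_pos (pow_pos hs 3)] at h
  rw [← h]
  congr 1; ext z
  rw [norm_smul]
  congr 1
  rw [Real.norm_of_nonneg (by positivity)]
  field_simp

lemma hk_integral {s : ℝ} (hs : 0 < s) : ∫ z, hk s z = 1 := by
  unfold hk
  rw [integral_const_mul]
  have h := gauss_scale (b := 1/4) hs
  have : (fun z : E3 => Real.exp (-‖z‖^2/(4*s^2))) = fun z : E3 => Real.exp (-(1/4) * ‖z‖^2 / s^2) := by
    ext z; congr 1; field_simp
  rw [this, h]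
  have h3 : gc0 * (∫ z : E3, Real.exp (-(1/4) * ‖z‖^2)) = 1 := by
    have := gc0_pos
    unfold gc0 at this ⊢
    exact inv_mul_cancel₀ (inv_pos.mp this).ne'
  generalize (∫ z : E3, Real.exp (-(1/4) * ‖z‖^2)) = I at h3 ⊢
  field_simp
  linarith

lemma hk_cont (s : ℝ) : Continuous (hk s) := by
  unfold hk; fun_prop

lemma hk1_cont (i : Fin 3) (s : ℝ) : Continuous (hk1 i s) := by
  unfold hk1; have := hk_cont s; fun_prop

lemma hk2_cont (i m : Fin 3) (s : ℝ) : Continuous (hk2 i m s) := by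
  unfold hk2; have := hk_cont s; fun_prop

lemma hk_neg (s : ℝ) (z : E3) : hk s (-z) = hk s z := by simp [hk]

lemma hk_integrable {s : ℝ} (hs : 0 < s) : Integrable (hk s) := by
  by_contra h
  have := hk_integral hs
  rw [integral_undef h] at this
  norm_num at this

lemma abs_coord_le (z : E3) (i : Fin 3) : |z i| ≤ ‖z‖ := by
  have := EuclideanSpace.norm_eq z
  simpa using PiLp.norm_apply_le z i

lemma normsq3 (z : E3) : ‖z‖^2 = z 0 ^2 + z 1 ^2 + z 2^2 := by
  rw [EuclideanSpace.norm_sq_eq]; simp [Fin.sum_univ_three]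

lemma line_coord (z : E3) (i m : Fin 3) :
    HasDerivAt (fun t : ℝ => (z + t • ee i) m) (if i = m then 1 else 0) 0 := by
  have : (fun t : ℝ => (z + t • ee i) m) = fun t : ℝ => z m + t * (if i = m then 1 else 0) := by
    ext t; simp only [ee, PiLp.add_apply, PiLp.smul_apply, smul_eq_mul]
    congr 2
    rw [PiLp.single_apply]
    simp [eq_comm]
  rw [this]
  simpa using ((hasDerivAt_id (0:ℝ)).mul_const (if i = m then (1:ℝ) else 0)).const_add (z m)

lemma line_normsq (z : E3) (i : Fin 3) :
    HasDerivAt (fun t : ℝ => ‖z + t • ee i‖^2) (2 * z i) 0 := by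
  have : (fun t : ℝ => ‖z + t • ee i‖^2) = fun t : ℝ => ((z + t • ee i) 0)^2
     + ((z + t • ee i) 1)^2 + ((z + t • ee i) 2)^2 := by
    ext t; rw [normsq3]
  rw [this]
  have h := (((line_coord z i 0).fun_pow 2).fun_add ((line_coord z i 1).fun_pow 2)).fun_add
    ((line_coord z i 2).fun_pow 2)
  refine h.congr_deriv ?_
  fin_cases i <;> simp

lemma hk_line (s : ℝ) (z : E3) (i : Fin 3) : HasLineDerivAt ℝ (hk s) (hk1 i s z) z (ee i) := by
  unfold HasLineDerivAt hk hk1 hk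
  have h := ((((line_normsq z i).fun_neg).div_const (4*s^2)).exp).const_mul (gc0 / s^3)
  refine h.congr_deriv ?_
  by_cases hs : s = 0
  · subst hs; simp
  · simp; field_simp; ring

lemma hk1_line (s : ℝ) (z : E3) (i m : Fin 3) :
    HasLineDerivAt ℝ (hk1 m s) (hk2 i m s z) z (ee i) := by
  have h0 := hk_line s z i
  unfold HasLineDerivAt at h0 ⊢
  unfold hk1 at h0 ⊢
  unfold hk2
  have h := (((line_coord z i m).fun_neg).div_const (2*s^2)).fun_mul h0
  refine h.congr_deriv ?_
  by_cases hs : s = 0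
  · subst hs; simp
  · simp; field_simp; ring

lemma hk_time {s : ℝ} (hs : 0 < s) (z : E3) :
    HasDerivAt (fun s => hk s z) (2 * s * ∑ i, hk2 i i s z) s := by
  have h1 : HasDerivAt (fun s : ℝ => gc0 / s^3) (-3 * gc0 / s^4) s := by
    have := ((hasDerivAt_pow 3 s).fun_inv (by positivity)).const_mul gc0
    simp only [← div_eq_mul_inv] at this
    refine this.congr_deriv ?_
    field_simp
    norm_num
    ring
  have h2 : HasDerivAt (fun s : ℝ => -‖z‖^2/(4*s^2)) (‖z‖^2/(2*s^3)) s := by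
    have := (((hasDerivAt_pow 2 s).const_mul 4).fun_inv (by positivity)).const_mul (-‖z‖^2)
    simp only [← div_eq_mul_inv] at this
    refine this.congr_deriv ?_
    field_simp
    norm_num
    ring
  have h := h1.fun_mul h2.exp
  unfold hk2 hk
  refine h.congr_deriv ?_
  rw [Fin.sum_univ_three, normsq3]
  simp
  field_simp
  ring

lemma exp_aux (r : ℝ) (_hr : 0 ≤ r) : (1 + r) * Real.exp (-r) ≤ 1 := by
  have := Real.add_one_le_exp r
  rw [Real.exp_neg, ← div_eq_mul_inv, div_le_one (Real.exp_pos _)]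
  linarith

lemma hk_bd {s : ℝ} (hs : 0 < s) (z : E3) : |hk s z| ≤ gc0/s^3 := by
  rw [abs_of_pos (hk_pos hs z)]
  unfold hk
  have := gc0_pos
  have h : Real.exp (-‖z‖^2/(4*s^2)) ≤ 1 := by
    rw [Real.exp_le_one_iff, neg_div]
    have : 0 ≤ ‖z‖^2/(4*s^2) := by positivity
    linarith
  calc _ ≤ gc0/s^3 * 1 := by gcongr
    _ = _ := mul_one _

lemma hk1_bdg {s : ℝ} (hs : 0 < s) (i : Fin 3) (z : E3) :
    |hk1 i s z| ≤ 2*gc0/s^4 * Real.exp (-‖z‖^2/(8*s^2)) := by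
  unfold hk1 hk
  have hg := gc0_pos
  rw [abs_mul, abs_div, abs_neg, abs_of_pos (by positivity : 0 < 2*s^2), abs_mul,
    abs_of_pos (Real.exp_pos _), abs_of_pos (by positivity : 0 < gc0/s^3)]
  have hz := abs_coord_le z i
  set r := ‖z‖^2/(8*s^2) with hr
  have hr0 : 0 ≤ r := by positivity
  have e1 : Real.exp (-‖z‖^2/(4*s^2)) = Real.exp (-r) * Real.exp (-r) := by
    rw [← Real.exp_add]; congr 1; rw [hr]; field_simp; ring
  have e2 : Real.exp (-‖z‖^2/(8*s^2)) = Real.exp (-r) := by congr 1; rw [hr]; ring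
  rw [e1, e2]
  have h3 : ‖z‖ ≤ 4 * s * (1 + r) := by
    have : r * (8 * s^2) = ‖z‖^2 := by rw [hr]; field_simp
    by_contra hc
    push Not at hc
    have h4 : 0 < 4*s*(1+r) := by positivity
    have h5 : (4*s*(1+r))^2 < ‖z‖^2 := by gcongr
    nlinarith [mul_pos hs hs, mul_nonneg hr0 hr0, mul_nonneg (mul_pos hs hs).le (mul_nonneg hr0 hr0), mul_nonneg (mul_pos hs hs).le hr0]
  have h6 := exp_aux r hr0
  calc |z i| / (2*s^2) * (gc0 / s^3 * (Real.exp (-r) * Real.exp (-r)))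
      ≤ (4 * s * (1 + r)) / (2*s^2) * (gc0 / s^3 * (Real.exp (-r) * Real.exp (-r))) := by
        gcongr; exact hz.trans h3
    _ = 2*gc0/s^4 * ((1+r) * Real.exp (-r)) * Real.exp (-r) := by field_simp; ring
    _ ≤ 2*gc0/s^4 * 1 * Real.exp (-r) := by gcongr
    _ = _ := by ring

lemma hk1_bd {s : ℝ} (hs : 0 < s) (i : Fin 3) (z : E3) :
    |hk1 i s z| ≤ 2*gc0/s^4 := by
  have hg := gc0_pos
  have h : Real.exp (-‖z‖^2/(8*s^2)) ≤ 1 := by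
    rw [Real.exp_le_one_iff, neg_div]
    have : 0 ≤ ‖z‖^2/(8*s^2) := by positivity
    linarith
  calc _ ≤ _ := hk1_bdg hs i z
    _ ≤ 2*gc0/s^4 * 1 := by gcongr
    _ = _ := mul_one _

lemma hk2_le {s : ℝ} (hs : 0 < s) (i m : Fin 3) (z : E3) :
    |hk2 i m s z| ≤ (‖z‖^2/(4*s^4) + 1/(2*s^2)) * hk s z := by
  unfold hk2
  rw [abs_mul, abs_of_pos (hk_pos hs z)]
  have := (hk_pos hs z).le
  gcongr
  refine (abs_sub _ _).trans ?_
  rw [abs_div, abs_div, abs_mul, abs_of_pos (by positivity : 0 < 4*s^4), abs_of_pos (by positivity : 0 < 2*s^2)]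
  have h1 := abs_coord_le z i
  have h2 := abs_coord_le z m
  gcongr
  · rw [sq]; gcongr
  · split_ifs <;> simp

lemma hk1_le {s : ℝ} (hs : 0 < s) (i : Fin 3) (z : E3) :
    |hk1 i s z| ≤ (‖z‖/(2*s^2)) * hk s z := by
  unfold hk1
  rw [abs_mul, abs_of_pos (hk_pos hs z), abs_div, abs_neg, abs_of_pos (by positivity : 0 < 2*s^2)]
  have := (hk_pos hs z).le
  have h1 := abs_coord_le z i
  gcongr

lemma hk2_bd {s : ℝ} (hs : 0 < s) (i m : Fin 3) (z : E3) :
    |hk2 i m s z| ≤ 2*gc0/s^5 := by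
  refine (hk2_le hs i m z).trans ?_
  unfold hk
  have hg := gc0_pos
  set r := ‖z‖^2/(4*s^2) with hr
  have hr0 : 0 ≤ r := by positivity
  have e2 : Real.exp (-‖z‖^2/(4*s^2)) = Real.exp (-r) := by congr 1; rw [hr]; ring
  rw [e2]
  have h6 := exp_aux r hr0
  have : ‖z‖^2/(4*s^4) = r / s^2 := by rw [hr]; field_simp
  rw [this]
  calc (r/s^2 + 1/(2*s^2)) * (gc0 / s^3 * Real.exp (-r)) ≤ (r/s^2 + 1/(s^2)) * (gc0 / s^3 * Real.exp (-r)) := by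
        gcongr; nlinarith [sq_nonneg s]
    _ = gc0/s^5 * ((1+r) * Real.exp (-r)) := by field_simp; ring
    _ ≤ gc0/s^5 * 1 := by gcongr
    _ ≤ _ := by rw [mul_one]; gcongr; linarith

/-! ### Convolution -/

lemma Nice.integrable {f : E3 → ℝ} (hf : Nice f) : Integrable f := by
  obtain ⟨R, hR, h1, h2⟩ := hf.bdd
  have : IntegrableOn f (Metric.closedBall 0 R) := by
    refine Measure.integrableOn_of_bounded (M := R) (measure_closedBall_lt_top).ne
      hf.meas.aestronglyMeasurable (Eventually.of_forall fun x => h1 x)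
  refine (integrableOn_iff_integrable_of_support_subset ?_).1 this
  intro x hx
  by_contra hc
  simp only [Metric.mem_closedBall, dist_zero_right, not_le] at hc
  exact hx (h2 x hc)

lemma cv_integrand {k f : E3 → ℝ} {C : ℝ} (hk : Continuous k) (hC : ∀ z, |k z| ≤ C)
    (hf : Integrable f) (x : E3) : Integrable (fun y => k (x-y) * f y) :=
  hf.bdd_mul (c := C) (hk.comp (by fun_prop)).aestronglyMeasurable (Eventually.of_forall fun y => hC _)

lemma cv_cont {k f : E3 → ℝ} {C : ℝ} (hk : Continuous k) (hC : ∀ z, |k z| ≤ C)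
    (hf : Integrable f) : Continuous (cv k f) := by
  unfold cv
  refine continuous_of_dominated (bound := fun y => C * |f y|) (fun x => ?_) (fun x => ?_) ?_ ?_
  · exact (cv_integrand hk hC hf x).aestronglyMeasurable
  · refine Eventually.of_forall fun y => ?_
    rw [norm_mul]; exact mul_le_mul_of_nonneg_right (hC _) (abs_nonneg _)
  · exact hf.abs.const_mul C
  · refine Eventually.of_forall fun y => ?_
    have : Continuous fun x => k (x - y) := hk.comp (by fun_prop)
    fun_prop

lemma cv_line {k k' f : E3 → ℝ} {C C' : ℝ} (hk : Continuous k) (hC : ∀ z, |k z| ≤ C)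
    (hk' : Continuous k') (hC' : ∀ z, |k' z| ≤ C') (hf : Integrable f) {e : E3}
    (hd : ∀ z, HasLineDerivAt ℝ k (k' z) z e) (x : E3) :
    HasLineDerivAt ℝ (cv k f) (cv k' f x) x e := by
  unfold HasLineDerivAt cv
  have := hasDerivAt_integral_of_dominated_loc_of_deriv_le (μ := (volume : Measure E3))
    (F := fun (t:ℝ) y => k (x + t • e - y) * f y) (F' := fun t y => k' (x + t • e - y) * f y)
    (x₀ := (0:ℝ)) (s := Set.univ) (bound := fun y => C' * |f y|) univ_mem
    (Eventually.of_forall fun t => (cv_integrand hk hC hf _).aestronglyMeasurable)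
    (cv_integrand hk hC hf _) (cv_integrand hk' hC' hf _).aestronglyMeasurable
    (Eventually.of_forall fun y t _ => by
      rw [norm_mul]; exact mul_le_mul_of_nonneg_right (hC' _) (abs_nonneg _))
    (hf.abs.const_mul C')
    (Eventually.of_forall fun y t _ => by
      have h := hd (x + t • e - y)
      unfold HasLineDerivAt at h
      have h2 : HasDerivAt (fun τ : ℝ => τ - t) 1 t := (hasDerivAt_id t).sub_const t
      have h3 := HasDerivAt.scomp_of_eq t h h2 (by simp)
      simp only [one_smul] at h3
      refine HasDerivAt.mul_const ?_ _
      have h4 : (fun τ : ℝ => k (x + τ • e - y))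
          = (fun t' : ℝ => k (x + t • e - y + t' • e)) ∘ fun τ : ℝ => τ - t := by
        ext τ
        have : x + τ • e - y = x + t • e - y + (τ - t) • e := by module
        simp only [Function.comp, this]
      rw [h4]
      exact h3)
  have h2 := this.2
  simpa using h2

lemma cv_time {f : E3 → ℝ} (hf : Integrable f) {s : ℝ} (hs : 0 < s) (x : E3) :
    HasDerivAt (fun s => cv (hk s) f x) (2 * s * ∑ i, cv (hk2 i i s) f x) s := by
  have hg := gc0_pos
  have := hasDerivAt_integral_of_dominated_loc_of_deriv_le (μ := (volume : Measure E3))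
    (F := fun (t:ℝ) y => hk t (x - y) * f y)
    (F' := fun t y => (2 * t * ∑ i, hk2 i i t (x - y)) * f y)
    (x₀ := s) (s := Set.Ioo (s/2) (2*s)) (bound := fun y => (2 * (2*s) * (3 * (2*gc0/(s/2)^5))) * |f y|)
    (Ioo_mem_nhds (by linarith) (by linarith))
    (Filter.eventually_of_mem (Ioo_mem_nhds (by linarith) (by linarith) : Set.Ioo (s/2) (2*s) ∈ 𝓝 s) fun t ht =>
      (cv_integrand (hk_cont t) (hk_bd (by have := ht.1; linarith)) hf _).aestronglyMeasurable)
    (cv_integrand (hk_cont s) (hk_bd hs) hf _)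
    (by
      have : Continuous fun y => (2 * s * ∑ i, hk2 i i s (x - y)) := by
        have h : ∀ i, Continuous fun y => hk2 i i s (x-y) := fun i => (hk2_cont i i s).comp (by fun_prop)
        fun_prop
      exact this.aestronglyMeasurable.mul hf.aestronglyMeasurable)
    (Eventually.of_forall fun y t ht => by
      have ht0 : 0 < t := by have := ht.1; linarith
      rw [norm_mul]; refine mul_le_mul_of_nonneg_right ?_ (abs_nonneg _)
      rw [norm_mul, norm_mul]
      have h3 : ‖∑ i, hk2 i i t (x - y)‖ ≤ 3 * (2*gc0/(s/2)^5) := by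
        refine (norm_sum_le _ _).trans ?_
        have : ∀ i, ‖hk2 i i t (x-y)‖ ≤ (2*gc0/(s/2)^5) := fun i => by
          refine (hk2_bd ht0 i i _).trans ?_
          have := ht.1.le
          gcongr
        refine (Finset.sum_le_sum fun i _ => this i).trans ?_
        simp
      have h4 : ‖t‖ ≤ 2*s := by rw [Real.norm_of_nonneg ht0.le]; exact ht.2.le
      have h5 : ‖(2:ℝ)‖ = 2 := by simp
      rw [h5]; gcongr)
    (hf.abs.const_mul _)
    (Eventually.of_forall fun y t ht => by
      have ht0 : 0 < t := by have := ht.1; linarith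
      exact (hk_time ht0 (x-y)).mul_const _)
  have h2 := this.2
  unfold cv
  refine h2.congr_deriv ?_
  symm
  rw [← integral_finsetSum, ← integral_const_mul]
  · congr 1; ext y; rw [Finset.mul_sum, Finset.mul_sum, Finset.sum_mul]
    refine Finset.sum_congr rfl fun i _ => by ring
  · intro i _
    exact cv_integrand (hk2_cont i i s) (hk2_bd hs i i) hf _

lemma sq_exp_bd {c : ℝ} (hc : 0 < c) (r : ℝ) :
    (1+r)^2 * Real.exp (-c * r^2) ≤ (2 + 4/c) * Real.exp (-(c/2) * r^2) := by
  have h1 : (1+r)^2 ≤ (2+4/c) * (1 + c/2*r^2) := by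
    have : (2+4/c) * (1 + c/2*r^2) = 2 + 4/c + c*r^2 + 2 * r^2 := by field_simp; ring
    rw [this]
    have h4 : 0 < 4/c := by positivity
    nlinarith [sq_nonneg (r-1), mul_nonneg hc.le (sq_nonneg r)]
  have h2 : 1 + c/2*r^2 ≤ Real.exp (c/2*r^2) := by
    have := Real.add_one_le_exp (c/2*r^2); linarith
  have h3 : Real.exp (-c * r^2) = Real.exp (-(c/2)*r^2) * Real.exp (-(c/2)*r^2) := by
    rw [← Real.exp_add]; congr 1; ring
  have h4 : Real.exp (c/2*r^2) * Real.exp (-(c/2)*r^2) = 1 := by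
    rw [← Real.exp_add, ← Real.exp_zero]; congr 1; ring
  rw [h3]
  calc (1+r)^2 * (Real.exp (-(c/2)*r^2) * Real.exp (-(c/2)*r^2))
      ≤ ((2+4/c) * Real.exp (c/2*r^2)) * (Real.exp (-(c/2)*r^2) * Real.exp (-(c/2)*r^2)) := by
        gcongr
        exact h1.trans (by gcongr)
    _ = (2+4/c) * (Real.exp (c/2*r^2) * Real.exp (-(c/2)*r^2)) * Real.exp (-(c/2)*r^2) := by ring
    _ = _ := by rw [h4]; ring

lemma pg_integrable {c : ℝ} (hc : 0 < c) :
    Integrable (fun x : E3 => (1+‖x‖)^2 * Real.exp (-c * ‖x‖^2)) := by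
  refine ((gauss_integrable (half_pos hc)).const_mul (2+4/c)).mono'
    (by fun_prop) (Eventually.of_forall fun x => ?_)
  rw [Real.norm_of_nonneg (by positivity)]
  exact sq_exp_bd hc _

lemma dom_integrable {h : E3 → ℝ} (hh : Continuous h) {c K : ℝ} (hc : 0 < c)
    (hb : ∀ x, |h x| ≤ K * ((1+‖x‖)^2 * Real.exp (-c * ‖x‖^2))) : Integrable h :=
  ((pg_integrable hc).const_mul K).mono' hh.aestronglyMeasurable (Eventually.of_forall hb)

lemma integral_line_zero {G G' : E3 → ℝ} {e : E3} (hG : Integrable G) (hG' : Integrable G')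
    (hd : ∀ x, HasLineDerivAt ℝ G (G' x) x e) : ∫ x, G' x = 0 := by
  have := integral_bilinear_hasLineDerivAt_right_eq_neg_left_of_integrable
    (μ := (volume : Measure E3)) (f := fun _ => (1:ℝ)) (f' := fun _ => (0:ℝ)) (g := G) (g' := G')
    (v := e) (B := ContinuousLinearMap.mul ℝ ℝ) (by simp) (by simpa using hG')
    (by simpa using hG) (fun x _ => by simpa [HasLineDerivAt] using hasDerivAt_const (0:ℝ) (1:ℝ)) (fun x _ => hd x)
  simpa using this

lemma cv_abs_le {k k0 f : E3 → ℝ} {C L : ℝ} {x : E3} (hk0 : Continuous k0) (hC : ∀ z, |k0 z| ≤ C)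
    (hf : Integrable f) (h0 : ∀ y, 0 ≤ f y)
    (hL : ∀ y, f y ≠ 0 → |k (x-y)| ≤ L * k0 (x-y)) : |cv k f x| ≤ L * cv k0 f x := by
  unfold cv
  rw [← integral_const_mul, ← Real.norm_eq_abs]
  refine norm_integral_le_of_norm_le (((cv_integrand hk0 hC hf x)).const_mul L)
    (Eventually.of_forall fun y => ?_)
  rw [norm_mul, Real.norm_of_nonneg (h0 y), ← mul_assoc]
  by_cases hy : f y = 0
  · simp [hy]
  · exact mul_le_mul_of_nonneg_right (hL y hy) (h0 y)

lemma ext_pos {f : E3 → ℝ} (hf : Nice f) (h0 : ∀ x, 0 ≤ f x) (h1 : 0 < ∫ x, f x) {s : ℝ}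
    (hs : 0 < s) (x : E3) : 0 < cv (hk s) f x := by
  unfold cv
  rw [integral_pos_iff_support_of_nonneg (fun y => mul_nonneg (hk_pos hs _).le (h0 y))
    (cv_integrand (hk_cont s) (hk_bd hs) hf.integrable x)]
  rw [integral_pos_iff_support_of_nonneg h0 hf.integrable] at h1
  convert h1 using 2
  ext y
  simp [(hk_pos hs (x-y)).ne']

lemma ext_bd {f : E3 → ℝ} (hf : Nice f) (h0 : ∀ x, 0 ≤ f x) {a b : ℝ} (ha : 0 < a) (hab : a ≤ b) :
    ∃ C0 : ℝ, ∀ C ≥ C0, ∀ s ∈ Set.Icc a b, ∀ x,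
      cv (hk s) f x ≤ C * Real.exp (-(1/(8*b^2)) * ‖x‖^2) ∧
      (∀ i, |cv (hk1 i s) f x| ≤ C * (1+‖x‖) * cv (hk s) f x) ∧
      (∀ i m, |cv (hk2 i m s) f x| ≤ C * (1+‖x‖)^2 * cv (hk s) f x) := by
  obtain ⟨R, hR, hf1, hf2⟩ := hf.bdd
  have hg := gc0_pos
  have hb : 0 < b := by linarith
  have hintg : 0 ≤ ∫ x, f x := integral_nonneg h0
  have hsup : ∀ y, f y ≠ 0 → ‖y‖ ≤ R := fun y hy => by
    by_contra hc; exact hy (hf2 y (not_le.1 hc))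
  set c1 := gc0/a^3 * Real.exp (R^2/(4*b^2)) * ∫ x, f x with hc1
  set c2 := (1+R)/(2*a^2) with hc2
  set c3 := (1+R)^2/(4*a^4) + 1/(2*a^2) with hc3
  have h1 : 0 ≤ c1 := by positivity
  have h2 : 0 ≤ c2 := by positivity
  have h3 : 0 ≤ c3 := by positivity
  refine ⟨c1+c2+c3, fun C hC s hs x => ?_⟩
  have hs0 : 0 < s := ha.trans_le hs.1
  have hsa := hs.1
  have hsb := hs.2
  have hu : 0 ≤ cv (hk s) f x := integral_nonneg fun y => mul_nonneg (hk_pos hs0 _).le (h0 y)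
  have hnorm : ∀ y, f y ≠ 0 → ‖x-y‖ ≤ (1+R)*(1+‖x‖) := fun y hy => by
    have := norm_sub_le x y
    have := hsup y hy
    nlinarith [norm_nonneg x]
  refine ⟨?_, fun i => ?_, fun i m => ?_⟩
  · have : cv (hk s) f x ≤ c1 * Real.exp (-(1/(8*b^2)) * ‖x‖^2) := by
      have e : c1 * Real.exp (-(1/(8*b^2)) * ‖x‖^2)
        = ∫ y, (gc0/a^3 * (Real.exp (R^2/(4*b^2)) * Real.exp (-(1/(8*b^2)) * ‖x‖^2))) * f y := by
        rw [integral_const_mul, hc1]; ring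
      rw [e]
      refine integral_mono (cv_integrand (hk_cont s) (hk_bd hs0) hf.integrable x)
        (hf.integrable.const_mul _) fun y => ?_
      by_cases hy : f y = 0
      · simp [hy]
      refine mul_le_mul_of_nonneg_right ?_ (h0 y)
      unfold hk
      have hy' := hsup y hy
      rw [← Real.exp_add]
      gcongr
      have hxy : ‖x‖^2/2 - R^2 ≤ ‖x-y‖^2 := by
        have h5 : ‖x‖ ≤ ‖x-y‖ + R := by
          have := norm_add_le (x-y) y
          rw [sub_add_cancel] at this; linarith
        have h6 : ‖x‖^2 ≤ (‖x-y‖+R)^2 := by gcongr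
        nlinarith [sq_nonneg (‖x-y‖-R)]
      have : -‖x-y‖^2/(4*s^2) ≤ -‖x-y‖^2/(4*b^2) := by
        rw [neg_div, neg_div]
        apply neg_le_neg
        gcongr
      refine this.trans ?_
      have e2 : R^2/(4*b^2) + -(1/(8*b^2)) * ‖x‖^2 = -(‖x‖^2/2-R^2)/(4*b^2) := by
        field_simp; ring
      rw [e2]
      gcongr
    refine this.trans ?_
    gcongr; linarith
  · have : |cv (hk1 i s) f x| ≤ (c2 * (1+‖x‖)) * cv (hk s) f x := by
      refine cv_abs_le (hk_cont s) (hk_bd hs0) hf.integrable h0 fun y hy => ?_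
      refine (hk1_le hs0 i _).trans ?_
      have := (hk_pos hs0 (x-y)).le
      gcongr
      rw [hc2, div_mul_eq_mul_div]
      have := hnorm y hy
      gcongr
    refine this.trans ?_
    gcongr; linarith
  · have : |cv (hk2 i m s) f x| ≤ (c3 * (1+‖x‖)^2) * cv (hk s) f x := by
      refine cv_abs_le (hk_cont s) (hk_bd hs0) hf.integrable h0 fun y hy => ?_
      refine (hk2_le hs0 i m _).trans ?_
      have := (hk_pos hs0 (x-y)).le
      gcongr
      rw [hc3, add_mul]
      have hn := hnorm y hy
      refine add_le_add ?_ ?_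
      · rw [div_mul_eq_mul_div, ← mul_pow]
        gcongr
      · have h7 : 1/(2*s^2) ≤ 1/(2*a^2) := by gcongr
        refine h7.trans ?_
        have : (1:ℝ) ≤ (1+‖x‖)^2 := by nlinarith [norm_nonneg x]
        exact le_mul_of_one_le_right (by positivity) this
    refine this.trans ?_
    gcongr; linarith

/-- admissible Bellman-type data -/
structure BData (p q : ℝ) (B B1 B2 B11 B12 B22 : ℝ → ℝ → ℝ) : Prop where
  c0 : ContinuousOn (fun z : ℝ × ℝ => B z.1 z.2) (Set.Ioi 0 ×ˢ Set.Ioi 0)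
  c1 : ContinuousOn (fun z : ℝ × ℝ => B1 z.1 z.2) (Set.Ioi 0 ×ˢ Set.Ioi 0)
  c2 : ContinuousOn (fun z : ℝ × ℝ => B2 z.1 z.2) (Set.Ioi 0 ×ˢ Set.Ioi 0)
  c11 : ContinuousOn (fun z : ℝ × ℝ => B11 z.1 z.2) (Set.Ioi 0 ×ˢ Set.Ioi 0)
  c12 : ContinuousOn (fun z : ℝ × ℝ => B12 z.1 z.2) (Set.Ioi 0 ×ˢ Set.Ioi 0)
  c22 : ContinuousOn (fun z : ℝ × ℝ => B22 z.1 z.2) (Set.Ioi 0 ×ˢ Set.Ioi 0)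
  d0 : ∀ (u w : ℝ → ℝ) (u' w' t : ℝ), 0 < u t → 0 < w t → HasDerivAt u u' t → HasDerivAt w w' t →
    HasDerivAt (fun t => B (u t) (w t)) (B1 (u t) (w t) * u' + B2 (u t) (w t) * w') t
  d1 : ∀ (u w : ℝ → ℝ) (u' w' t : ℝ), 0 < u t → 0 < w t → HasDerivAt u u' t → HasDerivAt w w' t →
    HasDerivAt (fun t => B1 (u t) (w t)) (B11 (u t) (w t) * u' + B12 (u t) (w t) * w') t
  d2 : ∀ (u w : ℝ → ℝ) (u' w' t : ℝ), 0 < u t → 0 < w t → HasDerivAt u u' t → HasDerivAt w w' t →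
    HasDerivAt (fun t => B2 (u t) (w t)) (B12 (u t) (w t) * u' + B22 (u t) (w t) * w') t
  bd : ∃ K : ℝ, 0 ≤ K ∧ ∀ ζ η : ℝ, 0 < ζ → 0 < η →
    |B ζ η| ≤ K * (ζ^p + η^q) ∧ ζ * |B1 ζ η| ≤ K * (ζ^p + η^q) ∧ η * |B2 ζ η| ≤ K * (ζ^p + η^q) ∧
    ζ^2 * |B11 ζ η| ≤ K * (ζ^p + η^q) ∧ ζ * η * |B12 ζ η| ≤ K * (ζ^p + η^q) ∧
    η^2 * |B22 ζ η| ≤ K * (ζ^p + η^q)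

/-- The estimate behind all the dominations. -/
lemma pow_gauss_bd {p q C u w e : ℝ} (hp : 1 ≤ p) (hq : 1 ≤ q) (hC : 0 ≤ C) (hu : 0 ≤ u) (hw : 0 ≤ w)
    (he : 0 ≤ e) (he1 : e ≤ 1) (h1 : u ≤ C * e) (h2 : w ≤ C * e) :
    u^p + w^q ≤ (C^p + C^q) * e := by
  have a1 : u^p ≤ C^p * e := by
    calc u^p ≤ (C*e)^p := by gcongr
      _ = C^p * e^p := Real.mul_rpow hC he
      _ ≤ C^p * e := by
        gcongr
        exact Real.rpow_le_self_of_le_one he he1 hp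
  have a2 : w^q ≤ C^q * e := by
    calc w^q ≤ (C*e)^q := by gcongr
      _ = C^q * e^q := Real.mul_rpow hC he
      _ ≤ C^q * e := by
        gcongr
        exact Real.rpow_le_self_of_le_one he he1 hq
  linarith

/-- Abstract pointwise bounds. -/
lemma term1_bd {C K S ρ u b x : ℝ} (hC : 1 ≤ C) (hρ : 1 ≤ ρ) (hu : 0 < u)
    (hb : u * |b| ≤ K * S) (hx : |x| ≤ C * ρ^2 * u) :
    |b * x| ≤ C^2 * ρ^2 * (K * S) := by
  rw [abs_mul]
  have h0 : 0 ≤ u * |b| := by positivity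
  calc |b| * |x| ≤ |b| * (C * ρ^2 * u) := by gcongr
    _ = C * ρ^2 * (u * |b|) := by ring
    _ ≤ C^2 * ρ^2 * (K * S) := by
        have : C ≤ C^2 := by nlinarith
        gcongr

lemma term2_bd {C K S ρ u w b x y : ℝ} (hC : 1 ≤ C) (hρ : 1 ≤ ρ) (hu : 0 < u) (_hw : 0 < w)
    (hb : u * w * |b| ≤ K * S) (hx : |x| ≤ C * ρ * u) (hy : |y| ≤ C * ρ * w) :
    |b * x * y| ≤ C^2 * ρ^2 * (K * S) := by
  rw [abs_mul, abs_mul]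
  calc |b| * |x| * |y| ≤ |b| * (C * ρ * u) * (C * ρ * w) := by gcongr
    _ = C^2 * ρ^2 * (u * w * |b|) := by ring
    _ ≤ C^2 * ρ^2 * (K * S) := by gcongr

def QB (B11 B12 B22 : ℝ → ℝ → ℝ) (f g : E3 → ℝ) (s : ℝ) (i : Fin 3) (x : E3) : ℝ :=
  B11 (cv (hk s) f x) (cv (hk s) g x) * cv (hk1 i s) f x * cv (hk1 i s) f x
  + 2 * (B12 (cv (hk s) f x) (cv (hk s) g x) * cv (hk1 i s) f x * cv (hk1 i s) g x)
  + B22 (cv (hk s) f x) (cv (hk s) g x) * cv (hk1 i s) g x * cv (hk1 i s) g x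

structure Pos (f : E3 → ℝ) : Prop where
  nice : Nice f
  nonneg : ∀ x, 0 ≤ f x
  ipos : 0 < ∫ x, f x

lemma Pos.pos {f : E3 → ℝ} (hf : Pos f) {s : ℝ} (hs : 0 < s) (x : E3) : 0 < cv (hk s) f x :=
  ext_pos hf.nice hf.nonneg hf.ipos hs x

lemma Nice.c0 {f : E3 → ℝ} (hf : Nice f) {s : ℝ} (hs : 0 < s) : Continuous (cv (hk s) f) :=
  cv_cont (hk_cont s) (hk_bd hs) hf.integrable
lemma Nice.c1 {f : E3 → ℝ} (hf : Nice f) {s : ℝ} (hs : 0 < s) (i : Fin 3) :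
    Continuous (cv (hk1 i s) f) :=
  cv_cont (hk1_cont i s) (hk1_bd hs i) hf.integrable
lemma Nice.c2 {f : E3 → ℝ} (hf : Nice f) {s : ℝ} (hs : 0 < s) (i m : Fin 3) :
    Continuous (cv (hk2 i m s) f) :=
  cv_cont (hk2_cont i m s) (hk2_bd hs i m) hf.integrable
lemma Nice.l0 {f : E3 → ℝ} (hf : Nice f) {s : ℝ} (hs : 0 < s) (i : Fin 3) (x : E3) :
    HasLineDerivAt ℝ (cv (hk s) f) (cv (hk1 i s) f x) x (ee i) :=
  cv_line (hk_cont s) (hk_bd hs) (hk1_cont i s) (hk1_bd hs i) hf.integrable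
    (fun z => hk_line s z i) x
lemma Nice.l1 {f : E3 → ℝ} (hf : Nice f) {s : ℝ} (hs : 0 < s) (i m : Fin 3) (x : E3) :
    HasLineDerivAt ℝ (cv (hk1 m s) f) (cv (hk2 i m s) f x) x (ee i) :=
  cv_line (hk1_cont m s) (hk1_bd hs m) (hk2_cont i m s) (hk2_bd hs i m) hf.integrable
    (fun z => hk1_line s z i m) x

/-- uniform package of bounds -/
lemma pack {p q : ℝ} (hp : 1 ≤ p) (hq : 1 ≤ q) {B B1 B2 B11 B12 B22 : ℝ → ℝ → ℝ}
    (hB : BData p q B B1 B2 B11 B12 B22) {f g : E3 → ℝ} (hf : Pos f) (hg : Pos g)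
    {a b : ℝ} (ha : 0 < a) (hab : a ≤ b) :
    ∃ D : ℝ, 0 ≤ D ∧ ∀ s ∈ Set.Icc a b, ∀ x,
     |B (cv (hk s) f x) (cv (hk s) g x)| ≤ D * ((1+‖x‖)^2 * Real.exp (-(1/(8*b^2)) * ‖x‖^2)) ∧
     (∀ i, |B1 (cv (hk s) f x) (cv (hk s) g x) * cv (hk1 i s) f x| ≤ D * ((1+‖x‖)^2 * Real.exp (-(1/(8*b^2)) * ‖x‖^2))) ∧
     (∀ i, |B2 (cv (hk s) f x) (cv (hk s) g x) * cv (hk1 i s) g x| ≤ D * ((1+‖x‖)^2 * Real.exp (-(1/(8*b^2)) * ‖x‖^2))) ∧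
     (∀ i, |B1 (cv (hk s) f x) (cv (hk s) g x) * cv (hk2 i i s) f x| ≤ D * ((1+‖x‖)^2 * Real.exp (-(1/(8*b^2)) * ‖x‖^2))) ∧
     (∀ i, |B2 (cv (hk s) f x) (cv (hk s) g x) * cv (hk2 i i s) g x| ≤ D * ((1+‖x‖)^2 * Real.exp (-(1/(8*b^2)) * ‖x‖^2))) ∧
     (∀ i, |QB B11 B12 B22 f g s i x| ≤ 4 * D * ((1+‖x‖)^2 * Real.exp (-(1/(8*b^2)) * ‖x‖^2))) := by
  obtain ⟨Cf, hCf⟩ := ext_bd hf.nice hf.nonneg ha hab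
  obtain ⟨Cg, hCg⟩ := ext_bd hg.nice hg.nonneg ha hab
  obtain ⟨K, hK, hbd⟩ := hB.bd
  set C := max 1 (max Cf Cg) with hCdef
  have hC1 : 1 ≤ C := le_max_left _ _
  have hC2 : Cf ≤ C := (le_max_left _ _).trans (le_max_right _ _)
  have hC3 : Cg ≤ C := (le_max_right _ _).trans (le_max_right _ _)
  have hC0 : 0 ≤ C := by linarith
  refine ⟨C^2 * (K * (C^p+C^q)), by positivity, fun s hs x => ?_⟩
  have hs0 : 0 < s := ha.trans_le hs.1
  obtain ⟨f0, f1, f2⟩ := hCf C hC2 s hs x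
  obtain ⟨g0, g1, g2⟩ := hCg C hC3 s hs x
  have pu := hf.pos hs0 x
  have pw := hg.pos hs0 x
  obtain ⟨k0, k1, k2, k11, k12, k22⟩ := hbd _ _ pu pw
  unfold QB
  generalize cv (hk s) f x = u at *
  generalize cv (hk s) g x = w at *
  set e := Real.exp (-(1/(8*b^2)) * ‖x‖^2) with he
  have e0 : 0 ≤ e := (Real.exp_pos _).le
  have e1 : e ≤ 1 := by
    rw [he, Real.exp_le_one_iff]
    have : 0 ≤ 1/(8*b^2) * ‖x‖^2 := by positivity
    linarith
  have hS := pow_gauss_bd hp hq hC0 pu.le pw.le e0 e1 f0 g0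
  set S := u^p + w^q
  set ρ := 1 + ‖x‖
  have hρ : 1 ≤ ρ := by have := norm_nonneg x; simp only [ρ]; linarith
  have key : C^2 * ρ^2 * (K * S) ≤ C^2 * (K * (C^p+C^q)) * (ρ^2 * e) := by
    calc C^2 * ρ^2 * (K * S) ≤ C^2 * ρ^2 * (K * ((C^p+C^q)*e)) := by gcongr
      _ = _ := by ring
  have up : ∀ {X z : ℝ}, 0 ≤ z → X ≤ C * ρ * z → X ≤ C * ρ^2 * z := fun hz h => h.trans (by
    have : ρ ≤ ρ^2 := by nlinarith
    gcongr)
  have hS0 : 0 ≤ K * S := by positivity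
  refine ⟨?_, fun i => ?_, fun i => ?_, fun i => ?_, fun i => ?_, fun i => ?_⟩
  · refine (k0.trans ?_).trans key
    have : 1 ≤ C^2 * ρ^2 := by
      have h1 : 1 ≤ C^2 := by nlinarith
      have h2 : 1 ≤ ρ^2 := by nlinarith
      nlinarith
    exact le_mul_of_one_le_left hS0 this
  · exact (term1_bd hC1 hρ pu k1 (up pu.le (f1 i))).trans key
  · exact (term1_bd hC1 hρ pw k2 (up pw.le (g1 i))).trans key
  · exact (term1_bd hC1 hρ pu k1 (f2 i i)).trans key
  · exact (term1_bd hC1 hρ pw k2 (g2 i i)).trans key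
  · have t1 := (term2_bd hC1 hρ pu pu (by rwa [← sq]) (f1 i) (f1 i)).trans key
    have t2 := (term2_bd hC1 hρ pu pw k12 (f1 i) (g1 i)).trans key
    have t3 := (term2_bd hC1 hρ pw pw (by rwa [← sq]) (g1 i) (g1 i)).trans key
    rw [abs_le] at t1 t2 t3 ⊢
    constructor <;> linarith [t1.1, t1.2, t2.1, t2.2, t3.1, t3.2]

lemma J_lemma {p q : ℝ} (hp : 1 ≤ p) (hq : 1 ≤ q) {B B1 B2 B11 B12 B22 : ℝ → ℝ → ℝ}
    (hB : BData p q B B1 B2 B11 B12 B22) {f g : E3 → ℝ} (hf : Pos f) (hg : Pos g)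
    {s : ℝ} (hs : 0 < s) :
    HasDerivAt (fun s => ∫ x, B (cv (hk s) f x) (cv (hk s) g x))
      (-2 * s * ∫ x, ∑ i, QB B11 B12 B22 f g s i x) s ∧
    Integrable (fun x => B (cv (hk s) f x) (cv (hk s) g x)) ∧
    ∀ i, Integrable (QB B11 B12 B22 f g s i) := by
  obtain ⟨D, hD, hb⟩ := pack hp hq hB hf hg (half_pos hs) (by linarith : s/2 ≤ 2*s)
  have hc : 0 < 1/(8*(2*s)^2) := by positivity
  have hcomp : ∀ {Φ : ℝ → ℝ → ℝ}, ContinuousOn (fun z : ℝ × ℝ => Φ z.1 z.2) (Set.Ioi 0 ×ˢ Set.Ioi 0) →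
      ∀ t, 0 < t → Continuous fun x => Φ (cv (hk t) f x) (cv (hk t) g x) := fun hΦ t ht =>
    hΦ.comp_continuous ((hf.nice.c0 ht).prodMk (hg.nice.c0 ht)) (fun x => ⟨hf.pos ht x, hg.pos ht x⟩)
  have hs' : s ∈ Set.Icc (s/2) (2*s) := ⟨by linarith, by linarith⟩
  have i0 : Integrable (fun x => B (cv (hk s) f x) (cv (hk s) g x)) :=
    dom_integrable (hcomp hB.c0 s hs) hc fun x => (hb s hs' x).1
  have i1 : ∀ i, Integrable (fun x => B1 (cv (hk s) f x) (cv (hk s) g x) * cv (hk1 i s) f x) := fun i =>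
    dom_integrable ((hcomp hB.c1 s hs).mul (hf.nice.c1 hs i)) hc fun x => (hb s hs' x).2.1 i
  have i2 : ∀ i, Integrable (fun x => B2 (cv (hk s) f x) (cv (hk s) g x) * cv (hk1 i s) g x) := fun i =>
    dom_integrable ((hcomp hB.c2 s hs).mul (hg.nice.c1 hs i)) hc fun x => (hb s hs' x).2.2.1 i
  have i3 : ∀ i, Integrable (fun x => B1 (cv (hk s) f x) (cv (hk s) g x) * cv (hk2 i i s) f x) := fun i =>
    dom_integrable ((hcomp hB.c1 s hs).mul (hf.nice.c2 hs i i)) hc fun x => (hb s hs' x).2.2.2.1 i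
  have i4 : ∀ i, Integrable (fun x => B2 (cv (hk s) f x) (cv (hk s) g x) * cv (hk2 i i s) g x) := fun i =>
    dom_integrable ((hcomp hB.c2 s hs).mul (hg.nice.c2 hs i i)) hc fun x => (hb s hs' x).2.2.2.2.1 i
  have i5 : ∀ i, Integrable (QB B11 B12 B22 f g s i) := fun i => by
    refine dom_integrable ?_ hc fun x => (hb s hs' x).2.2.2.2.2 i
    unfold QB
    have h11 := hcomp hB.c11 s hs
    have h12 := hcomp hB.c12 s hs
    have h22 := hcomp hB.c22 s hs
    have hf1 := hf.nice.c1 hs i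
    have hg1 := hg.nice.c1 hs i
    exact (((h11.mul hf1).mul hf1).add (continuous_const.mul ((h12.mul hf1).mul hg1))).add
      ((h22.mul hg1).mul hg1)
  refine ⟨?_, i0, i5⟩
  have hdiv : ∀ i, ∫ x, (QB B11 B12 B22 f g s i x
      + (B1 (cv (hk s) f x) (cv (hk s) g x) * cv (hk2 i i s) f x
      + B2 (cv (hk s) f x) (cv (hk s) g x) * cv (hk2 i i s) g x)) = 0 := fun i => by
    refine integral_line_zero (e := ee i) ((i1 i).add (i2 i)) ((i5 i).add ((i3 i).add (i4 i))) fun x => ?_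
    have df := hf.nice.l0 hs i x
    have dg := hg.nice.l0 hs i x
    have ddf := hf.nice.l1 hs i i x
    have ddg := hg.nice.l1 hs i i x
    unfold HasLineDerivAt at df dg ddf ddg ⊢
    have h1 := hB.d1 _ _ _ _ 0 (hf.pos hs _) (hg.pos hs _) df dg
    have h2 := hB.d2 _ _ _ _ 0 (hf.pos hs _) (hg.pos hs _) df dg
    have h := (h1.fun_mul ddf).fun_add (h2.fun_mul ddg)
    refine HasDerivAt.congr_deriv h ?_
    simp only [zero_smul, add_zero, QB]
    ring
  have main := hasDerivAt_integral_of_dominated_loc_of_deriv_le (μ := (volume : Measure E3))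
    (F := fun (t:ℝ) x => B (cv (hk t) f x) (cv (hk t) g x))
    (F' := fun t x => B1 (cv (hk t) f x) (cv (hk t) g x) * (2 * t * ∑ i, cv (hk2 i i t) f x)
      + B2 (cv (hk t) f x) (cv (hk t) g x) * (2 * t * ∑ i, cv (hk2 i i t) g x))
    (x₀ := s) (s := Set.Ioo (s/2) (2*s))
    (bound := fun x => 24 * s * (D * ((1+‖x‖)^2 * Real.exp (-(1/(8*(2*s)^2)) * ‖x‖^2))))
    (Ioo_mem_nhds (by linarith) (by linarith))
    (Filter.eventually_of_mem (Ioo_mem_nhds (by linarith) (by linarith) : Set.Ioo (s/2) (2*s) ∈ 𝓝 s)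
      fun t ht => (hcomp hB.c0 t (by have := ht.1; linarith)).aestronglyMeasurable)
    i0
    (by
      have h1 := hcomp hB.c1 s hs
      have h2 := hcomp hB.c2 s hs
      have h3 : ∀ i, Continuous (cv (hk2 i i s) f) := fun i => hf.nice.c2 hs i i
      have h4 : ∀ i, Continuous (cv (hk2 i i s) g) := fun i => hg.nice.c2 hs i i
      refine Continuous.aestronglyMeasurable ?_
      exact (h1.mul (continuous_const.mul (continuous_finsetSum _ fun i _ => h3 i))).add
        (h2.mul (continuous_const.mul (continuous_finsetSum _ fun i _ => h4 i))))
    (Eventually.of_forall fun x t ht => by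
      have ht0 : 0 < t := by have := ht.1; linarith
      have ht' : t ∈ Set.Icc (s/2) (2*s) := ⟨ht.1.le, ht.2.le⟩
      obtain ⟨-, -, -, b1, b2, -⟩ := hb t ht' x
      set E := D * ((1+‖x‖)^2 * Real.exp (-(1/(8*(2*s)^2)) * ‖x‖^2)) with hE
      have hE0 : 0 ≤ E := by positivity
      have e1 : B1 (cv (hk t) f x) (cv (hk t) g x) * (2 * t * ∑ i, cv (hk2 i i t) f x)
        + B2 (cv (hk t) f x) (cv (hk t) g x) * (2 * t * ∑ i, cv (hk2 i i t) g x)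
        = 2 * t * ∑ i, (B1 (cv (hk t) f x) (cv (hk t) g x) * cv (hk2 i i t) f x +
            B2 (cv (hk t) f x) (cv (hk t) g x) * cv (hk2 i i t) g x) := by
        rw [Finset.sum_add_distrib, ← Finset.mul_sum, ← Finset.mul_sum]; ring
      rw [e1, norm_mul, Real.norm_of_nonneg (by positivity : 0 ≤ 2 * t)]
      have e2 : ‖∑ i, (B1 (cv (hk t) f x) (cv (hk t) g x) * cv (hk2 i i t) f x +
            B2 (cv (hk t) f x) (cv (hk t) g x) * cv (hk2 i i t) g x)‖ ≤ 6 * E := by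
        refine (norm_sum_le _ _).trans ?_
        have : ∀ i ∈ (Finset.univ : Finset (Fin 3)), ‖(B1 (cv (hk t) f x) (cv (hk t) g x) * cv (hk2 i i t) f x +
            B2 (cv (hk t) f x) (cv (hk t) g x) * cv (hk2 i i t) g x)‖ ≤ 2 * E := fun i _ => by
          refine (norm_add_le _ _).trans ?_
          have := b1 i
          have := b2 i
          simp only [Real.norm_eq_abs]
          linarith
        refine (Finset.sum_le_sum this).trans ?_
        simp; linarith
      have h5 : t ≤ 2*s := ht.2.le
      calc 2 * t * _ ≤ 2 * (2*s) * (6 * E) := by gcongr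
        _ = 24 * s * E := by ring)
    (((pg_integrable hc).const_mul D).const_mul (24*s))
    (Eventually.of_forall fun x t ht => by
      have ht0 : 0 < t := by have := ht.1; linarith
      exact hB.d0 _ _ _ _ t (hf.pos ht0 x) (hg.pos ht0 x) (cv_time hf.nice.integrable ht0 x)
        (cv_time hg.nice.integrable ht0 x))
  refine main.2.congr_deriv ?_
  have e1 : ∀ x, B1 (cv (hk s) f x) (cv (hk s) g x) * (2 * s * ∑ i, cv (hk2 i i s) f x)
        + B2 (cv (hk s) f x) (cv (hk s) g x) * (2 * s * ∑ i, cv (hk2 i i s) g x)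
        = 2 * s * ∑ i, (B1 (cv (hk s) f x) (cv (hk s) g x) * cv (hk2 i i s) f x +
            B2 (cv (hk s) f x) (cv (hk s) g x) * cv (hk2 i i s) g x) := fun x => by
        rw [Finset.sum_add_distrib, ← Finset.mul_sum, ← Finset.mul_sum]; ring
  simp only [e1]
  have i34 : ∀ i, Integrable (fun x => B1 (cv (hk s) f x) (cv (hk s) g x) * cv (hk2 i i s) f x
      + B2 (cv (hk s) f x) (cv (hk s) g x) * cv (hk2 i i s) g x) := fun i => (i3 i).add (i4 i)
  rw [integral_const_mul, integral_finsetSum _ fun i _ => i34 i,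
    integral_finsetSum _ fun i _ => i5 i]
  have e2 : ∀ i, ∫ x, (B1 (cv (hk s) f x) (cv (hk s) g x) * cv (hk2 i i s) f x
      + B2 (cv (hk s) f x) (cv (hk s) g x) * cv (hk2 i i s) g x) = - ∫ x, QB B11 B12 B22 f g s i x := fun i => by
    have := hdiv i
    rw [integral_add (i5 i) (i34 i)] at this
    linarith
  simp only [e2, Finset.sum_neg_distrib]
  ring

lemma young_simple {p q ζ η : ℝ} (hpq : p.HolderConjugate q) (hζ : 0 ≤ ζ) (hη : 0 ≤ η) :
    ζ * η ≤ ζ^p + η^q := by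
  have h := Real.young_inequality_of_nonneg hζ hη hpq
  have h1 : ζ^p / p ≤ ζ^p := div_le_self (by positivity) hpq.lt.le
  have h2 : η^q / q ≤ η^q := div_le_self (by positivity) hpq.symm.lt.le
  linarith

lemma prod_BData {p q : ℝ} (hpq : p.HolderConjugate q) :
    BData p q (fun ζ η => ζ*η) (fun _ η => η) (fun ζ _ => ζ) (fun _ _ => 0) (fun _ _ => 1)
      (fun _ _ => 0) where
  c0 := by fun_prop
  c1 := by fun_prop
  c2 := by fun_prop
  c11 := by fun_prop
  c12 := by fun_prop
  c22 := by fun_prop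
  d0 := fun u w u' w' t _ _ hu hw => (hu.fun_mul hw).congr_deriv (by ring)
  d1 := fun u w u' w' t _ _ hu hw => hw.congr_deriv (by ring)
  d2 := fun u w u' w' t _ _ hu hw => hu.congr_deriv (by ring)
  bd := ⟨1, zero_le_one, fun ζ η hζ hη => by
    have h := young_simple hpq hζ.le hη.le
    have h0 : 0 ≤ ζ^p + η^q := by positivity
    simp only [abs_mul, abs_of_pos hζ, abs_of_pos hη, one_mul, abs_zero, abs_one, mul_one, mul_zero]
    exact ⟨h, h, by linarith [mul_comm ζ η], h0, h, h0⟩⟩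

section bell
variable (p : ℝ)
def bq : ℝ := p/(p-1)
def bA : ℝ := 6/(bq p * (bq p - 1))
def bS (ζ η : ℝ) : ℝ := ζ^p + η^(bq p)
def bW (ζ η : ℝ) : ℝ := ζ^2 * (bS p ζ η)^((p-2)/p)
def bB (ζ η : ℝ) : ℝ := bA p * bS p ζ η + bW p ζ η
def bB1 (ζ η : ℝ) : ℝ := (bA p * p * ζ^p + bW p ζ η * (2 + (p-2) * (ζ^p/bS p ζ η)))/ζ
def bB2 (ζ η : ℝ) : ℝ :=
  (bA p * bq p * η^(bq p) + bW p ζ η * (2 - bq p) * (η^(bq p)/bS p ζ η))/η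
def bB11 (ζ η : ℝ) : ℝ := (bA p * p * (p-1) * ζ^p
  + bW p ζ η * (2 + (p-2) * (ζ^p/bS p ζ η) * (p + 3 - 2 * (ζ^p/bS p ζ η))))/ζ^2
def bB12 (ζ η : ℝ) : ℝ := (2 * (2 - bq p) * bW p ζ η * (η^(bq p)/bS p ζ η)^2)/(ζ*η)
def bB22 (ζ η : ℝ) : ℝ := (bA p * bq p * (bq p - 1) * η^(bq p)
  + (2 - bq p) * bW p ζ η * (η^(bq p)/bS p ζ η) * (bq p - 1) * (1 - 2 * (η^(bq p)/bS p ζ η)))/η^2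
end bell

lemma bS_pos {p ζ η : ℝ} (hζ : 0 < ζ) (hη : 0 < η) : 0 < bS p ζ η := by
  unfold bS; positivity

lemma pow_curve {p u' t : ℝ} {u : ℝ → ℝ} (h0 : 0 < u t) (hu : HasDerivAt u u' t) :
    HasDerivAt (fun t => (u t)^p) (p * (u t)^p / u t * u') t := by
  refine (hu.rpow_const (p := p) (Or.inl h0.ne')).congr_deriv ?_
  rw [Real.rpow_sub_one h0.ne']; ring

lemma bS_curve {p u' w' t : ℝ} {u w : ℝ → ℝ} (h0 : 0 < u t) (h1 : 0 < w t) (hu : HasDerivAt u u' t)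
    (hw : HasDerivAt w w' t) :
    HasDerivAt (fun t => bS p (u t) (w t)) (p * (u t)^p / u t * u' + bq p * (w t)^(bq p) / w t * w') t :=
  (pow_curve h0 hu).fun_add (pow_curve h1 hw)

lemma bW_curve {p u' w' t : ℝ} {u w : ℝ → ℝ} (h0 : 0 < u t) (h1 : 0 < w t) (hu : HasDerivAt u u' t)
    (hw : HasDerivAt w w' t) :
    HasDerivAt (fun t => bW p (u t) (w t)) (bW p (u t) (w t) * (2 / u t * u' +
      ((p-2)/p) / bS p (u t) (w t) * (p * (u t)^p / u t * u' + bq p * (w t)^(bq p) / w t * w'))) t := by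
  have hS := bS_pos (p := p) h0 h1
  have := (hu.fun_pow 2).fun_mul (pow_curve (p := (p-2)/p) hS (bS_curve h0 h1 hu hw))
  refine this.congr_deriv ?_
  unfold bW
  norm_num
  field_simp

lemma bell_c {p : ℝ} : 
    ContinuousOn (fun z : ℝ × ℝ => bB p z.1 z.2) (Set.Ioi 0 ×ˢ Set.Ioi 0) ∧
    ContinuousOn (fun z : ℝ × ℝ => bB1 p z.1 z.2) (Set.Ioi 0 ×ˢ Set.Ioi 0) ∧
    ContinuousOn (fun z : ℝ × ℝ => bB2 p z.1 z.2) (Set.Ioi 0 ×ˢ Set.Ioi 0) ∧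
    ContinuousOn (fun z : ℝ × ℝ => bB11 p z.1 z.2) (Set.Ioi 0 ×ˢ Set.Ioi 0) ∧
    ContinuousOn (fun z : ℝ × ℝ => bB12 p z.1 z.2) (Set.Ioi 0 ×ˢ Set.Ioi 0) ∧
    ContinuousOn (fun z : ℝ × ℝ => bB22 p z.1 z.2) (Set.Ioi 0 ×ˢ Set.Ioi 0) := by
  have hX : ContinuousOn (fun z : ℝ × ℝ => z.1^p) (Set.Ioi 0 ×ˢ Set.Ioi 0) :=
    continuousOn_fst.rpow_const fun z hz => Or.inl (ne_of_gt hz.1)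
  have hY : ContinuousOn (fun z : ℝ × ℝ => z.2^(bq p)) (Set.Ioi 0 ×ˢ Set.Ioi 0) :=
    continuousOn_snd.rpow_const fun z hz => Or.inl (ne_of_gt hz.2)
  have hS : ContinuousOn (fun z : ℝ × ℝ => bS p z.1 z.2) (Set.Ioi 0 ×ˢ Set.Ioi 0) := hX.add hY
  have hne : ∀ z : ℝ × ℝ, z ∈ Set.Ioi (0:ℝ) ×ˢ Set.Ioi (0:ℝ) → bS p z.1 z.2 ≠ 0 :=
    fun z hz => (bS_pos hz.1 hz.2).ne'
  have hW : ContinuousOn (fun z : ℝ × ℝ => bW p z.1 z.2) (Set.Ioi 0 ×ˢ Set.Ioi 0) :=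
    (continuousOn_fst.pow 2).mul (hS.rpow_const fun z hz => Or.inl (hne z hz))
  have hx : ContinuousOn (fun z : ℝ × ℝ => z.1^p/bS p z.1 z.2) (Set.Ioi 0 ×ˢ Set.Ioi 0) := hX.div hS hne
  have hy : ContinuousOn (fun z : ℝ × ℝ => z.2^(bq p)/bS p z.1 z.2) (Set.Ioi 0 ×ˢ Set.Ioi 0) := hY.div hS hne
  have n1 : ∀ z : ℝ × ℝ, z ∈ Set.Ioi (0:ℝ) ×ˢ Set.Ioi (0:ℝ) → z.1 ≠ 0 := fun z hz => ne_of_gt hz.1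
  have n2 : ∀ z : ℝ × ℝ, z ∈ Set.Ioi (0:ℝ) ×ˢ Set.Ioi (0:ℝ) → z.2 ≠ 0 := fun z hz => ne_of_gt hz.2
  unfold bB bB1 bB2 bB11 bB12 bB22
  refine ⟨?_, ?_, ?_, ?_, ?_, ?_⟩
  · exact (continuousOn_const.mul hS).add hW
  · exact ((continuousOn_const.mul hX).add (hW.mul (continuousOn_const.add (continuousOn_const.mul hx)))).div
      continuousOn_fst n1
  · exact ((continuousOn_const.mul hY).add ((hW.mul continuousOn_const).mul hy)).div
      continuousOn_snd n2
  · exact ((continuousOn_const.mul hX).add (hW.mul (continuousOn_const.add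
      ((continuousOn_const.mul hx).mul (continuousOn_const.sub (continuousOn_const.mul hx)))))).div
      (continuousOn_fst.pow 2) fun z hz => pow_ne_zero 2 (n1 z hz)
  · exact ((continuousOn_const.mul hW).mul (hy.pow 2)).div (continuousOn_fst.mul continuousOn_snd)
      fun z hz => mul_ne_zero (n1 z hz) (n2 z hz)
  · exact ((continuousOn_const.mul hY).add ((((continuousOn_const.mul hW).mul hy).mul
      continuousOn_const).mul (continuousOn_const.sub (continuousOn_const.mul hy)))).div
      (continuousOn_snd.pow 2) fun z hz => pow_ne_zero 2 (n2 z hz)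

lemma bell_d0 {p : ℝ} (hp : 2 ≤ p) (u w : ℝ → ℝ) (u' w' t : ℝ) (h0 : 0 < u t) (h1 : 0 < w t) (hu : HasDerivAt u u' t)
    (hw : HasDerivAt w w' t) :
    HasDerivAt (fun t => bB p (u t) (w t)) (bB1 p (u t) (w t) * u' + bB2 p (u t) (w t) * w') t := by
  have hS := bS_pos (p := p) h0 h1
  have hp1 : p - 1 ≠ 0 := by linarith
  have hp0 : p ≠ 0 := by linarith
  refine (((bS_curve (p := p) h0 h1 hu hw).const_mul (bA p)).fun_add (bW_curve h0 h1 hu hw)).congr_deriv ?_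
  unfold bB1 bB2
  have e : bS p (u t) (w t) = (u t)^p + (w t)^(bq p) := rfl
  generalize bW p (u t) (w t) = W at *
  rw [e] at hS ⊢
  generalize (u t)^p = X at *
  generalize (w t)^(bq p) = Y at *
  generalize u t = a at *
  generalize w t = b at *
  generalize bA p = A
  unfold bq
  field_simp
  ring

lemma bell_d1 {p : ℝ} (hp : 2 ≤ p) (u w : ℝ → ℝ) (u' w' t : ℝ) (h0 : 0 < u t) (h1 : 0 < w t) (hu : HasDerivAt u u' t)
    (hw : HasDerivAt w w' t) :
    HasDerivAt (fun t => bB1 p (u t) (w t)) (bB11 p (u t) (w t) * u' + bB12 p (u t) (w t) * w') t := by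
  have hS := bS_pos (p := p) h0 h1
  have hp1 : p - 1 ≠ 0 := by linarith
  have hp0 : p ≠ 0 := by linarith
  have hX := pow_curve (p := p) h0 hu
  have dS := bS_curve (p := p) h0 h1 hu hw
  have dW := bW_curve (p := p) h0 h1 hu hw
  refine (((hX.const_mul (bA p * p)).fun_add (dW.fun_mul
    (((hX.fun_div dS hS.ne').const_mul (p-2)).const_add 2))).fun_div hu h0.ne').congr_deriv ?_
  clear dW dS hX
  unfold bB11 bB12
  have e : bS p (u t) (w t) = (u t)^p + (w t)^(bq p) := rfl
  generalize bW p (u t) (w t) = W at *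
  rw [e] at hS ⊢
  generalize (u t)^p = X at *
  generalize (w t)^(bq p) = Y at *
  generalize u t = a at *
  generalize w t = b at *
  generalize bA p = A
  unfold bq
  field_simp
  ring

lemma bell_d2 {p : ℝ} (hp : 2 ≤ p) (u w : ℝ → ℝ) (u' w' t : ℝ) (h0 : 0 < u t) (h1 : 0 < w t) (hu : HasDerivAt u u' t)
    (hw : HasDerivAt w w' t) :
    HasDerivAt (fun t => bB2 p (u t) (w t)) (bB12 p (u t) (w t) * u' + bB22 p (u t) (w t) * w') t := by
  have hS := bS_pos (p := p) h0 h1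
  have hp1 : p - 1 ≠ 0 := by linarith
  have hp0 : p ≠ 0 := by linarith
  have hY := pow_curve (p := bq p) h1 hw
  have dS := bS_curve (p := p) h0 h1 hu hw
  have dW := bW_curve (p := p) h0 h1 hu hw
  refine (((hY.const_mul (bA p * bq p)).fun_add ((dW.mul_const (2 - bq p)).fun_mul
    (hY.fun_div dS hS.ne'))).fun_div hw h1.ne').congr_deriv ?_
  clear dW dS hY
  unfold bB22 bB12
  have e : bS p (u t) (w t) = (u t)^p + (w t)^(bq p) := rfl
  generalize bW p (u t) (w t) = W at *
  rw [e] at hS ⊢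
  generalize (u t)^p = X at *
  generalize (w t)^(bq p) = Y at *
  generalize u t = a at *
  generalize w t = b at *
  generalize bA p = A
  unfold bq
  field_simp
  ring

lemma bW_le {p ζ η : ℝ} (hp : 2 ≤ p) (hζ : 0 < ζ) (hη : 0 < η) : bW p ζ η ≤ bS p ζ η := by
  have hS := bS_pos (p := p) hζ hη
  have h1 : ζ^2 ≤ (bS p ζ η)^(2/p) := by
    have : ζ^2 = (ζ^p)^(2/p) := by
      rw [← Real.rpow_mul hζ.le, mul_div_cancel₀ _ (by linarith : p ≠ 0)]; norm_cast
    rw [this]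
    apply Real.rpow_le_rpow (by positivity) _ (by positivity)
    unfold bS
    have : 0 < η^(bq p) := by positivity
    linarith
  unfold bW
  calc ζ^2 * bS p ζ η ^((p-2)/p) ≤ (bS p ζ η)^(2/p) * bS p ζ η ^((p-2)/p) := by gcongr
    _ = bS p ζ η := by
      rw [← Real.rpow_add hS]
      have : 2/p + (p-2)/p = 1 := by field_simp; ring
      rw [this, Real.rpow_one]

lemma bW_ge {p ζ η : ℝ} (hp : 2 ≤ p) (hζ : 0 < ζ) (hη : 0 < η) :
    ζ^2 * η^2 ≤ bW p ζ η * η^(bq p) := by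
  have hY : 0 < η^(bq p) := by positivity
  have hYS : η^(bq p) ≤ bS p ζ η := by
    unfold bS
    have : 0 < ζ^p := by positivity
    linarith
  have hp1 : p - 1 ≠ 0 := by linarith
  have hp0 : p ≠ 0 := by linarith
  unfold bW
  have h2 : η^2 = (η^(bq p))^((p-2)/p) * η^(bq p) := by
    rw [← Real.rpow_mul hη.le, ← Real.rpow_add hη]
    have : bq p * ((p-2)/p) + bq p = 2 := by unfold bq; field_simp; ring
    rw [this]; norm_cast
  have : 0 ≤ (p-2)/p := div_nonneg (by linarith) (by linarith)
  rw [h2, mul_assoc]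
  gcongr

lemma bq_facts {p : ℝ} (hp : 2 ≤ p) : 1 < bq p ∧ bq p ≤ 2 ∧ 0 < bA p ∧ bA p * bq p * (bq p - 1) = 6 := by
  have h1 : 1 < bq p := by unfold bq; rw [lt_div_iff₀ (by linarith)]; linarith
  have h2 : bq p ≤ 2 := by unfold bq; rw [div_le_iff₀ (by linarith)]; linarith
  have h3 : 0 < bq p - 1 := by linarith
  refine ⟨h1, h2, ?_, ?_⟩
  · unfold bA; positivity
  · unfold bA; field_simp

lemma q_aux {q : ℝ} (q1 : 1 < q) (q2 : q ≤ 2) : |(2-q)*(q-1)| ≤ 1 := by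
  rw [abs_of_nonneg (mul_nonneg (by linarith) (by linarith))]
  nlinarith

set_option maxHeartbeats 800000 in
lemma bell_bd {p : ℝ} (hp : 2 ≤ p) {ζ η : ℝ} (hζ : 0 < ζ) (hη : 0 < η) :
    |bB p ζ η| ≤ ((bA p + 3) * p^2) * (ζ^p + η^(bq p)) ∧
    ζ * |bB1 p ζ η| ≤ ((bA p + 3) * p^2) * (ζ^p + η^(bq p)) ∧
    η * |bB2 p ζ η| ≤ ((bA p + 3) * p^2) * (ζ^p + η^(bq p)) ∧
    ζ^2 * |bB11 p ζ η| ≤ ((bA p + 3) * p^2) * (ζ^p + η^(bq p)) ∧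
    ζ * η * |bB12 p ζ η| ≤ ((bA p + 3) * p^2) * (ζ^p + η^(bq p)) ∧
    η^2 * |bB22 p ζ η| ≤ ((bA p + 3) * p^2) * (ζ^p + η^(bq p)) := by
  obtain ⟨q1, q2, A0, A6⟩ := bq_facts hp
  have hS := bS_pos (p := p) hζ hη
  have hWS := bW_le hp hζ hη
  have hW : 0 < bW p ζ η := by unfold bW; positivity
  have hX : 0 < ζ^p := by positivity
  have hY : 0 < η^(bq p) := by positivity
  have e : ζ^p + η^(bq p) = bS p ζ η := rfl
  have hx1 : ζ^p / bS p ζ η ≤ 1 := by rw [div_le_one hS, ← e]; linarith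
  have hy1 : η^(bq p) / bS p ζ η ≤ 1 := by rw [div_le_one hS, ← e]; linarith
  have hx0 : 0 < ζ^p / bS p ζ η := by positivity
  have hy0 : 0 < η^(bq p) / bS p ζ η := by positivity
  have hXS : ζ^p ≤ bS p ζ η := by rw [← e]; linarith
  have hYS : η^(bq p) ≤ bS p ζ η := by rw [← e]; linarith
  rw [e]
  unfold bB bB1 bB2 bB11 bB12 bB22
  rw [abs_div, abs_div, abs_div, abs_div, abs_div, abs_of_pos hζ, abs_of_pos hη, abs_of_pos (pow_pos hζ 2),
    abs_of_pos (pow_pos hη 2), abs_of_pos (mul_pos hζ hη), mul_div_cancel₀ _ hζ.ne',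
    mul_div_cancel₀ _ hη.ne', mul_div_cancel₀ _ (pow_pos hζ 2).ne',
    mul_div_cancel₀ _ (pow_pos hη 2).ne', mul_div_cancel₀ _ (mul_pos hζ hη).ne']
  generalize ζ^p / bS p ζ η = x at *
  generalize η^(bq p) / bS p ζ η = y at *
  generalize bW p ζ η = W at *
  generalize bS p ζ η = S at *
  generalize ζ^p = X at *
  generalize η^(bq p) = Y at *
  generalize bq p = q at *
  generalize bA p = A at *
  clear e
  have hAS : 0 < A * S := by positivity
  have hp4 : 4 ≤ p^2 := by nlinarith
  have hpp : 2 * p ≤ p^2 := by nlinarith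
  have key : ∀ {Z : ℝ} (c d : ℝ), |Z| ≤ c * (A * S) + d * S → c ≤ p^2 → d ≤ 3 * p^2 →
      |Z| ≤ (A+3)*p^2 * S := fun c d h hc hd => by
    refine h.trans ?_
    have h1 : c * (A*S) ≤ p^2 * (A*S) := by gcongr
    have h2 : d * S ≤ 3*p^2 * S := by gcongr
    linarith
  have hAX : A * X ≤ A * S := by gcongr
  have hAY : A * Y ≤ A * S := by gcongr
  have bnd : ∀ {a c : ℝ}, 0 ≤ c → |a| ≤ c → |W * a| ≤ c * S := fun {a c} hc h => by
    rw [abs_mul, abs_of_pos hW, mul_comm]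
    gcongr
  refine ⟨?_, ?_, ?_, ?_, ?_, ?_⟩
  · apply key 1 1 _ (by linarith) (by linarith)
    rw [abs_of_pos (by positivity)]; linarith
  · apply key p p _ (by linarith) (by linarith)
    refine (abs_add_le _ _).trans (add_le_add ?_ (bnd (by linarith) ?_))
    · rw [abs_of_pos (by positivity)]; nlinarith
    · rw [abs_le]; constructor <;> nlinarith
  · apply key 2 1 _ (by linarith) (by linarith)
    refine (abs_add_le _ _).trans (add_le_add ?_ ?_)
    · rw [abs_of_pos (by positivity)]; nlinarith
    · rw [mul_assoc]; apply bnd zero_le_one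
      rw [abs_le]; constructor <;> nlinarith
  · apply key (p*(p-1)) (2 + (p-2)*(p+3)) _ (by nlinarith) (by nlinarith)
    refine (abs_add_le _ _).trans (add_le_add ?_ (bnd (by nlinarith) ?_))
    · have : 0 < p - 1 := by linarith
      rw [abs_of_pos (by positivity)]
      have : 0 ≤ p * (p-1) := by positivity
      nlinarith
    · have hk : 0 ≤ p - 2 := by linarith
      have h3 : 0 ≤ p + 3 - 2 * x := by linarith
      rw [abs_of_nonneg (by positivity)]
      have h4 : (p - 2) * x * (p + 3 - 2*x) ≤ (p-2) * 1 * (p+3) := by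
        gcongr; linarith
      linarith
  · apply key 0 2 _ (by linarith) (by linarith)
    have : 2 * (2-q) * W * y^2 = W * (2 * (2-q) * y^2) := by ring
    rw [this, zero_mul, zero_add]
    apply bnd (by norm_num)
    have hy2 : y^2 ≤ 1 := by nlinarith
    have h2q : 0 ≤ 2 - q := by linarith
    rw [abs_of_nonneg (by positivity)]
    nlinarith [sq_nonneg y]
  · apply key 2 1 _ (by linarith) (by linarith)
    refine (abs_add_le _ _).trans (add_le_add ?_ ?_)
    · have : 0 < q - 1 := by linarith
      rw [abs_of_pos (by positivity)]
      have h5 : q * (q-1) ≤ 2 * 1 := by gcongr; linarith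
      have h6 : 0 ≤ q * (q-1) := by positivity
      calc A * q * (q-1) * Y = (q*(q-1)) * (A*Y) := by ring
        _ ≤ (2*1) * (A*S) := by gcongr
        _ = _ := by ring
    · have : (2-q) * W * y * (q-1) * (1-2*y) = W * (((2-q) * (q-1)) * (y * (1-2*y))) := by ring
      rw [this]; apply bnd zero_le_one
      have a1 : |(2-q)*(q-1)| ≤ 1 := q_aux q1 q2
      have a2 : |y * (1-2*y)| ≤ 1 := by rw [abs_le]; constructor <;> nlinarith
      rw [abs_mul]
      calc _ ≤ (1:ℝ) * 1 := by gcongr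
        _ = 1 := one_mul 1

set_option maxHeartbeats 800000 in
lemma bell_lower {p : ℝ} (hp : 2 ≤ p) {ζ η : ℝ} (hζ : 0 < ζ) (hη : 0 < η) :
    ∃ l m : ℝ, 0 ≤ l ∧ 0 ≤ m ∧ 1 ≤ l * m ∧ ∀ a b : ℝ,
      l * a^2 + m * b^2 ≤ bB11 p ζ η * a * a + 2 * (bB12 p ζ η * a * b) + bB22 p ζ η * b * b := by
  obtain ⟨q1, q2, A0, A6⟩ := bq_facts hp
  have hS := bS_pos (p := p) hζ hη
  have hWS := bW_le hp hζ hη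
  have hW : 0 < bW p ζ η := by unfold bW; positivity
  have hX : 0 < ζ^p := by positivity
  have hY : 0 < η^(bq p) := by positivity
  have e : ζ^p + η^(bq p) = bS p ζ η := rfl
  have hx1 : ζ^p / bS p ζ η ≤ 1 := by rw [div_le_one hS, ← e]; linarith
  have hy1 : η^(bq p) / bS p ζ η ≤ 1 := by rw [div_le_one hS, ← e]; linarith
  have hx0 : 0 < ζ^p / bS p ζ η := by positivity
  have hy0 : 0 < η^(bq p) / bS p ζ η := by positivity
  have hWy : bW p ζ η * (η^(bq p) / bS p ζ η) ≤ η^(bq p) := by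
    rw [mul_div_assoc', div_le_iff₀ hS, mul_comm]; gcongr
  refine ⟨bW p ζ η/ζ^2, η^(bq p)/η^2, by positivity, by positivity, ?_, fun a b => ?_⟩
  · rw [div_mul_div_comm, le_div_iff₀ (by positivity), one_mul]; exact bW_ge hp hζ hη
  unfold bB11 bB12 bB22
  generalize ζ^p / bS p ζ η = x at *
  generalize η^(bq p) / bS p ζ η = y at *
  generalize bW p ζ η = W at *
  clear e
  generalize bS p ζ η = S at *
  generalize ζ^p = X at *
  generalize η^(bq p) = Y at *
  generalize bq p = q at *
  generalize bA p = A at *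
  obtain ⟨c, rfl⟩ : ∃ c, a = c * ζ := ⟨a/ζ, by field_simp⟩
  obtain ⟨d, rfl⟩ : ∃ d, b = d * η := ⟨b/η, by field_simp⟩
  have e1 : W/ζ^2 * (c*ζ)^2 + Y/η^2*(d*η)^2 = W * c^2 + Y * d^2 := by field_simp
  have e2 : ∀ N1 N2 N3 : ℝ, N1/ζ^2*(c*ζ)*(c*ζ) + 2*(N2/(ζ*η)*(c*ζ)*(d*η)) + N3/η^2*(d*η)*(d*η)
      = N1 * c^2 + 2 * N2 * (c*d) + N3 * d^2 := fun N1 N2 N3 => by field_simp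
  rw [e1, e2, A6]
  have h2q : 0 ≤ 2 - q := by linarith
  have hp1 : 0 ≤ p - 1 := by linarith
  have hk : 0 ≤ p - 2 := by linarith
  have h3 : 0 ≤ p + 3 - 2 * x := by linarith
  have t1 : 2 * W * c^2 ≤ (A*p*(p-1)*X + W * (2 + (p-2)*x*(p+3-2*x))) * c^2 := by
    have g1 : 0 ≤ A*p*(p-1)*X * c^2 := by positivity
    have g2 : 0 ≤ W * ((p-2)*x*(p+3-2*x)) * c^2 := by positivity
    linarith
  have hy4 : W * y^4 ≤ Y := by
    have : y^4 ≤ y := by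
      have : y^3 ≤ 1 := pow_le_one₀ hy0.le hy1
      nlinarith
    calc W * y^4 ≤ W * y := by gcongr
      _ ≤ Y := hWy
  have t2 : -(W * c^2 + 4 * Y * d^2) ≤ 2 * (2*(2-q)*W*y^2) * (c*d) := by
    have s1 : 0 ≤ W * (c + 2*(2-q)*y^2*d)^2 := by positivity
    have s2 : (2-q)^2 * (W * y^4) ≤ 1 * Y := by
      gcongr; nlinarith
    have s3 : (2-q)^2 * (W * y^4) * d^2 ≤ 1 * Y * d^2 := by gcongr
    have s4 : W * (c + 2*(2-q)*y^2*d)^2 = W * c^2 + 2 * (2*(2-q)*W*y^2) * (c*d)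
      + 4 * ((2-q)^2 * (W * y^4) * d^2) := by ring
    linarith
  have t3 : -(Y * d^2) ≤ (2-q)*W*y*(q-1)*(1-2*y) * d^2 := by
    have a1 : |(2-q)*(q-1)| ≤ 1 := q_aux q1 q2
    have a2 : |(1-2*y)| ≤ 1 := by rw [abs_le]; constructor <;> linarith
    have a3 : |(2-q)*(q-1)| * |(1-2*y)| * (W*y) ≤ 1 * 1 * Y := by gcongr
    have a4 : -Y ≤ (2-q)*W*y*(q-1)*(1-2*y) := by
      have : (2-q)*W*y*(q-1)*(1-2*y) = ((2-q)*(q-1)) * (1-2*y) * (W*y) := by ring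
      rw [this]
      have := neg_abs_le (((2-q)*(q-1)) * (1-2*y) * (W*y))
      rw [abs_mul, abs_mul, abs_of_pos (by positivity : 0 < W * y)] at this
      linarith
    have a5 := mul_le_mul_of_nonneg_right a4 (sq_nonneg d)
    linarith
  linarith

lemma bell_BData {p : ℝ} (hp : 2 ≤ p) :
    BData p (bq p) (bB p) (bB1 p) (bB2 p) (bB11 p) (bB12 p) (bB22 p) where
  c0 := bell_c.1
  c1 := bell_c.2.1
  c2 := bell_c.2.2.1
  c11 := bell_c.2.2.2.1
  c12 := bell_c.2.2.2.2.1
  c22 := bell_c.2.2.2.2.2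
  d0 := bell_d0 hp
  d1 := bell_d1 hp
  d2 := bell_d2 hp
  bd := ⟨(bA p + 3)*p^2, by have := (bq_facts hp).2.2.1; positivity, fun _ _ => bell_bd hp⟩

/-! ### Control predicate -/

def Ctrl (ψ : ℝ → ℝ) (A : ℝ) : Prop := ∃ M M' : ℝ → ℝ, ∀ s > 0,
  HasDerivAt M (M' s) s ∧ |ψ s| ≤ - M' s ∧ 0 ≤ M s ∧ M s ≤ A

lemma Ctrl.mono {ψ φ : ℝ → ℝ} {A B : ℝ} (h : Ctrl ψ A) (hφ : ∀ s > 0, |φ s| ≤ |ψ s|) (hAB : A ≤ B) :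
    Ctrl φ B := by
  obtain ⟨M, M', hM⟩ := h
  refine ⟨M, M', fun s hs => ?_⟩
  obtain ⟨a, b, c, d⟩ := hM s hs
  exact ⟨a, (hφ s hs).trans b, c, d.trans hAB⟩

lemma Ctrl.add {ψ φ : ℝ → ℝ} {A B : ℝ} (h : Ctrl ψ A) (h' : Ctrl φ B) :
    Ctrl (fun s => ψ s + φ s) (A+B) := by
  obtain ⟨M, M', hM⟩ := h
  obtain ⟨N, N', hN⟩ := h'
  refine ⟨fun s => M s + N s, fun s => M' s + N' s, fun s hs => ?_⟩
  obtain ⟨a, b, c, d⟩ := hM s hs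
  obtain ⟨a', b', c', d'⟩ := hN s hs
  refine ⟨a.fun_add a', (abs_add_le _ _).trans (by linarith), by linarith, by linarith⟩

lemma Ctrl.zero {ψ : ℝ → ℝ} {A : ℝ} (hA : 0 ≤ A) (h : ∀ s > 0, ψ s = 0) : Ctrl ψ A :=
  ⟨fun _ => 0, fun _ => 0, fun s hs => ⟨hasDerivAt_const _ _, by simp [h s hs], le_refl _, hA⟩⟩

lemma Ctrl.sum {ι : Type*} (S : Finset ι) {ψ : ι → ℝ → ℝ} {A : ι → ℝ} (h : ∀ i ∈ S, Ctrl (ψ i) (A i)) :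
    Ctrl (fun s => ∑ i ∈ S, ψ i s) (∑ i ∈ S, A i) := by
  classical
  induction S using Finset.induction_on with
  | empty => exact Ctrl.zero (by simp) (by simp)
  | insert a S ha ih =>
    simp only [Finset.sum_insert ha]
    exact (h a (by simp)).add (ih fun i hi => h i (by simp [hi]))

lemma Ctrl.diff {ψ Φ : ℝ → ℝ} {A : ℝ} (h : Ctrl ψ A) (hΦ : ∀ s > 0, HasDerivAt Φ (ψ s) s)
    {a b : ℝ} (ha : 0 < a) (hab : a ≤ b) : |Φ a - Φ b| ≤ A := by
  obtain ⟨M, M', hM⟩ := h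
  have key : ∀ e : ℝ, |e| = 1 → M b + e * Φ b ≤ M a + e * Φ a := fun e he => by
    have : AntitoneOn (fun s => M s + e * Φ s) (Set.Icc a b) := by
      have hd : ∀ s ∈ Set.Icc a b, HasDerivAt (fun s => M s + e * Φ s) (M' s + e * ψ s) s := fun s hs => by
        have hs0 : 0 < s := ha.trans_le hs.1
        exact (hM s hs0).1.fun_add ((hΦ s hs0).const_mul e)
      refine antitoneOn_of_deriv_nonpos (convex_Icc a b) (fun s hs => (hd s hs).continuousAt.continuousWithinAt)
        (fun s hs => (hd s (interior_subset hs)).differentiableAt.differentiableWithinAt) fun s hs => ?_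
      have hs' := interior_subset hs
      rw [(hd s hs').deriv]
      have h1 := (hM s (ha.trans_le hs'.1)).2.1
      have h2 : |e * ψ s| = |ψ s| := by rw [abs_mul, he, one_mul]
      have h3 := le_abs_self (e * ψ s)
      linarith
    exact this ⟨le_refl _, hab⟩ ⟨hab, le_refl _⟩ hab
  have h1 := key 1 (by simp)
  have h2 := key (-1) (by simp)
  obtain ⟨-, -, -, a4⟩ := hM a ha
  obtain ⟨-, -, b3, -⟩ := hM b (ha.trans_le hab)
  rw [abs_le]; constructor <;> linarith

/-! ### Integrability facts for convolutions -/

lemma hk1_integrable {s : ℝ} (hs : 0 < s) (i : Fin 3) : Integrable (hk1 i s) := by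
  refine ((gauss_integrable (b := 1/(8*s^2)) (by positivity)).const_mul (2*gc0/s^4)).mono'
    (hk1_cont i s).aestronglyMeasurable (Eventually.of_forall fun z => ?_)
  refine (hk1_bdg hs i z).trans (le_of_eq ?_)
  congr 2; ring

lemma cv_eq_conv (k f : E3 → ℝ) : cv k f = convolution f k (ContinuousLinearMap.mul ℝ ℝ) volume := by
  ext x; unfold cv convolution; simp [mul_comm]

lemma cv_integrable {k f : E3 → ℝ} (hk : Integrable k) (hf : Integrable f) : Integrable (cv k f) := by
  rw [cv_eq_conv]; exact Integrable.integrable_convolution _ hf hk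

lemma cv_integral {k f : E3 → ℝ} (hk : Integrable k) (hf : Integrable f) :
    ∫ x, cv k f x = (∫ x, k x) * ∫ x, f x := by
  rw [cv_eq_conv, integral_convolution _ hf hk]
  simp [mul_comm]

lemma cv_bd {k f : E3 → ℝ} {C : ℝ} (hC : ∀ z, |k z| ≤ C) (hf : Integrable f) (x : E3) :
    |cv k f x| ≤ C * ∫ y, |f y| := by
  unfold cv
  rw [← integral_const_mul, ← Real.norm_eq_abs]
  refine norm_integral_le_of_norm_le (hf.abs.const_mul C) (Eventually.of_forall fun y => ?_)
  rw [norm_mul]; exact mul_le_mul_of_nonneg_right (hC _) (abs_nonneg _)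

def Psi (i m : Fin 3) (f g : E3 → ℝ) (s : ℝ) : ℝ := ∫ x, cv (hk1 i s) f x * cv (hk1 m s) g x

lemma psi_integrable {f g : E3 → ℝ} (hf : Nice f) (hg : Nice g) {s : ℝ} (hs : 0 < s) (i m : Fin 3) :
    Integrable (fun x => cv (hk1 i s) f x * cv (hk1 m s) g x) :=
  (cv_integrable (hk1_integrable hs m) hg.integrable).bdd_mul (c := 2*gc0/s^4 * ∫ y, |f y|)
    (hf.c1 hs i).aestronglyMeasurable (Eventually.of_forall fun x => cv_bd (hk1_bd hs i) hf.integrable x)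

lemma cv_add {k f g : E3 → ℝ} {C : ℝ} (hk : Continuous k) (hC : ∀ z, |k z| ≤ C)
    (hf : Integrable f) (hg : Integrable g) (x : E3) :
    cv k (fun y => f y + g y) x = cv k f x + cv k g x := by
  unfold cv
  rw [← integral_add (cv_integrand hk hC hf x) (cv_integrand hk hC hg x)]
  congr 1; ext y; ring

lemma cv_sub {k f g : E3 → ℝ} {C : ℝ} (hk : Continuous k) (hC : ∀ z, |k z| ≤ C)
    (hf : Integrable f) (hg : Integrable g) (x : E3) :
    cv k (fun y => f y - g y) x = cv k f x - cv k g x := by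
  unfold cv
  rw [← integral_sub (cv_integrand hk hC hf x) (cv_integrand hk hC hg x)]
  congr 1; ext y; ring

lemma cv_smul (k f : E3 → ℝ) (c : ℝ) (x : E3) : cv k (fun y => c * f y) x = c * cv k f x := by
  unfold cv
  rw [← integral_const_mul]
  congr 1; ext y; ring

lemma Psi_comm (i m : Fin 3) (f g : E3 → ℝ) (s : ℝ) : Psi i m f g s = Psi m i g f s := by
  unfold Psi; congr 1; ext x; ring

lemma Psi_add_left {f f' g : E3 → ℝ} (hf : Nice f) (hf' : Nice f') (hg : Nice g) {s : ℝ} (hs : 0 < s)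
    (i m : Fin 3) : Psi i m (fun x => f x + f' x) g s = Psi i m f g s + Psi i m f' g s := by
  unfold Psi
  rw [← integral_add (psi_integrable hf hg hs i m) (psi_integrable hf' hg hs i m)]
  congr 1; ext x
  rw [cv_add (hk1_cont i s) (hk1_bd hs i) hf.integrable hf'.integrable]; ring

lemma Psi_sub_left {f f' g : E3 → ℝ} (hf : Nice f) (hf' : Nice f') (hg : Nice g) {s : ℝ} (hs : 0 < s)
    (i m : Fin 3) : Psi i m (fun x => f x - f' x) g s = Psi i m f g s - Psi i m f' g s := by
  unfold Psi
  rw [← integral_sub (psi_integrable hf hg hs i m) (psi_integrable hf' hg hs i m)]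
  congr 1; ext x
  rw [cv_sub (hk1_cont i s) (hk1_bd hs i) hf.integrable hf'.integrable]; ring

lemma Psi_smul_left (i m : Fin 3) (f g : E3 → ℝ) (c s : ℝ) :
    Psi i m (fun x => c * f x) g s = c * Psi i m f g s := by
  unfold Psi
  rw [← integral_const_mul]
  congr 1; ext x; rw [cv_smul]; ring

lemma Psi_add_right {f f' g : E3 → ℝ} (hf : Nice f) (hf' : Nice f') (hg : Nice g) {s : ℝ} (hs : 0 < s)
    (i m : Fin 3) : Psi i m g (fun x => f x + f' x) s = Psi i m g f s + Psi i m g f' s := by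
  rw [Psi_comm, Psi_add_left hf hf' hg hs, Psi_comm, Psi_comm m i f']

lemma Psi_sub_right {f f' g : E3 → ℝ} (hf : Nice f) (hf' : Nice f') (hg : Nice g) {s : ℝ} (hs : 0 < s)
    (i m : Fin 3) : Psi i m g (fun x => f x - f' x) s = Psi i m g f s - Psi i m g f' s := by
  rw [Psi_comm, Psi_sub_left hf hf' hg hs, Psi_comm, Psi_comm m i f']

lemma Psi_smul_right (i m : Fin 3) (f g : E3 → ℝ) (c s : ℝ) :
    Psi i m f (fun x => c * g x) s = c * Psi i m f g s := by
  rw [Psi_comm, Psi_smul_left, Psi_comm]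

/-! ### Nice functions -/

lemma Nice.of_le {f g : E3 → ℝ} (hf : Nice f) (hg : Measurable g) (h : ∀ x, |g x| ≤ |f x|) : Nice g := by
  obtain ⟨R, hR, h1, h2⟩ := hf.bdd
  refine ⟨hg, R, hR, fun x => (h x).trans (h1 x), fun x hx => ?_⟩
  have := h x
  rw [h2 x hx] at this
  simpa using this

lemma Nice.pos_part {f : E3 → ℝ} (hf : Nice f) : Nice (fun x => max (f x) 0) :=
  hf.of_le (hf.meas.max measurable_const) fun x => by
    rcases le_total (f x) 0 with h | h
    · simp [max_eq_right h]
    · simp [max_eq_left h]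

lemma Nice.neg_part {f : E3 → ℝ} (hf : Nice f) : Nice (fun x => max (-f x) 0) :=
  hf.of_le (hf.meas.neg.max measurable_const) fun x => by
    rcases le_total (-f x) 0 with h | h
    · simp [max_eq_right h]
    · simp [max_eq_left h]

lemma Nice.add {f g : E3 → ℝ} (hf : Nice f) (hg : Nice g) : Nice (fun x => f x + g x) := by
  obtain ⟨R, hR, h1, h2⟩ := hf.bdd
  obtain ⟨R', hR', h1', h2'⟩ := hg.bdd
  refine ⟨hf.meas.add hg.meas, R + R', by linarith, fun x => (abs_add_le _ _).trans (add_le_add (h1 x) (h1' x)),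
    fun x hx => ?_⟩
  rw [h2 x (by linarith), h2' x (by linarith), add_zero]

lemma Nice.smul {f : E3 → ℝ} (hf : Nice f) (c : ℝ) : Nice (fun x => c * f x) := by
  obtain ⟨R, hR, h1, h2⟩ := hf.bdd
  refine ⟨hf.meas.const_mul c, (|c|+1) * R, by positivity, fun x => ?_, fun x hx => ?_⟩
  · rw [abs_mul]; have := h1 x; gcongr; linarith
  · rw [h2 x (lt_of_le_of_lt (le_mul_of_one_le_left hR.le (by linarith [abs_nonneg c])) hx), mul_zero]

lemma Nice.rpow {f : E3 → ℝ} (hf : Nice f) {p : ℝ} (hp : 0 < p) : Nice (fun x => |f x|^p) := by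
  obtain ⟨R, hR, h1, h2⟩ := hf.bdd
  refine ⟨(hf.meas.abs).pow_const p, R + R^p, by positivity, fun x => ?_, fun x hx => ?_⟩
  · rw [abs_of_nonneg (by positivity)]
    have : |f x|^p ≤ R^p := by have := h1 x; gcongr
    linarith
  · have : 0 < R^p := by positivity
    rw [h2 x (by linarith), abs_zero, Real.zero_rpow hp.ne']

lemma jensen {f : E3 → ℝ} (hf : Nice f) (h0 : ∀ x, 0 ≤ f x) {p q : ℝ} (hpq : p.HolderConjugate q)
    {s : ℝ} (hs : 0 < s) (x : E3) : (cv (hk s) f x)^p ≤ cv (hk s) (fun y => |f y|^p) x := by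
  have hp := hpq.pos
  have hu : 0 ≤ cv (hk s) f x := integral_nonneg fun y => mul_nonneg (hk_pos hs _).le (h0 y)
  set u := cv (hk s) f x with hu_def
  have hk1 : ∫ y, hk s (x - y) = 1 := by
    rw [integral_sub_left_eq_self (fun y => hk s y) volume x, hk_integral hs]
  have hki : Integrable fun y => hk s (x-y) := (hk_integrable hs).comp_sub_left x
  have i1 := cv_integrand (hk_cont s) (hk_bd hs) hf.integrable x
  have i2 := cv_integrand (hk_cont s) (hk_bd hs) (hf.rpow hp).integrable x
  have h := integral_mono (f := fun y => (hk s (x-y) * f y) * u^(p-1))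
    (g := fun y => (hk s (x-y) * |f y|^p) * (1/p) + hk s (x-y) * (u^p / q))
    (i1.mul_const _) ((i2.mul_const _).add (hki.mul_const _)) (fun y => by
      have hy := Real.young_inequality_of_nonneg (h0 y) (by positivity : 0 ≤ u^(p-1)) hpq
      rw [← Real.rpow_mul hu, hpq.sub_one_mul_conj] at hy
      have := mul_le_mul_of_nonneg_left hy (hk_pos hs (x-y)).le
      beta_reduce
      rw [abs_of_nonneg (h0 y)]
      calc _ = hk s (x-y) * (f y * u^(p-1)) := by ring
        _ ≤ _ := this
        _ = _ := by ring)
  rw [integral_mul_const, integral_add (i2.mul_const _) (hki.mul_const _), integral_mul_const,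
    integral_mul_const, hk1] at h
  change u * u^(p-1) ≤ cv (hk s) (fun y => |f y|^p) x * (1/p) + _ at h
  have e : u * u^(p-1) = u^p := by
    rcases hu.eq_or_lt with h | h
    · rw [← h, Real.zero_rpow hp.ne', zero_mul]
    · rw [Real.rpow_sub_one h.ne']; field_simp
  rw [e] at h
  have e2 : 1/q = 1 - 1/p := by have := hpq.inv_add_inv_eq_one; simp only [one_div]; linarith
  have e3 : u^p / q = u^p - u^p * (1/p) := by rw [div_eq_mul_one_div, e2]; ring
  rw [e3] at h
  have : u^p * (1/p) ≤ cv (hk s) (fun y => |f y|^p) x * (1/p) := by linarith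
  exact le_of_mul_le_mul_right this (by positivity)

lemma jensen_int {f : E3 → ℝ} (hf : Nice f) (h0 : ∀ x, 0 ≤ f x) {p q : ℝ} (hpq : p.HolderConjugate q)
    {s : ℝ} (hs : 0 < s) : Integrable (fun x => (cv (hk s) f x)^p) ∧
    ∫ x, (cv (hk s) f x)^p ≤ ∫ x, |f x|^p := by
  have hp := hpq.pos
  have i := cv_integrable (hk_integrable hs) (hf.rpow hp).integrable
  have hu : ∀ x, 0 ≤ cv (hk s) f x := fun x => integral_nonneg fun y => mul_nonneg (hk_pos hs _).le (h0 y)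
  have j : Integrable (fun x => (cv (hk s) f x)^p) := by
    refine i.mono' ((hf.c0 hs).rpow_const fun x => Or.inr hp.le).aestronglyMeasurable
      (Eventually.of_forall fun x => ?_)
    rw [Real.norm_of_nonneg (Real.rpow_nonneg (hu x) _)]
    exact jensen hf h0 hpq hs x
  refine ⟨j, (integral_mono j i fun x => jensen hf h0 hpq hs x).trans ?_⟩
  rw [cv_integral (hk_integrable hs) (hf.rpow hp).integrable, hk_integral hs, one_mul]

lemma bell_pos {p : ℝ} (hp : 2 ≤ p) {f g : E3 → ℝ} (hf : Pos f) (hg : Pos g) (i m : Fin 3) :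
    Ctrl (fun s => s * Psi i m f g s) (((bA p + 3) * p^2) * ((∫ x, |f x|^p) + ∫ x, |g x|^(bq p))) := by
  obtain ⟨q1, q2, A0, A6⟩ := bq_facts hp
  have hpq : p.HolderConjugate (bq p) := by
    have := Real.HolderConjugate.conjExponent (p := p) (by linarith)
    exact this
  refine ⟨fun s => ∫ x, bB p (cv (hk s) f x) (cv (hk s) g x),
    fun s => -2 * s * ∫ x, ∑ i, QB (bB11 p) (bB12 p) (bB22 p) f g s i x, fun s hs => ?_⟩
  obtain ⟨d, i0, iQ⟩ := J_lemma (by linarith : 1 ≤ p) q1.le (bell_BData hp) hf hg hs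
  have hBnn : ∀ x, 0 ≤ bB p (cv (hk s) f x) (cv (hk s) g x) := fun x => by
    have h1 := hf.pos hs x
    have h2 := hg.pos hs x
    have := bS_pos (p := p) h1 h2
    unfold bB bW
    positivity
  refine ⟨d, ?_, integral_nonneg hBnn, ?_⟩
  · have hQi : Integrable fun x => ∑ i, QB (bB11 p) (bB12 p) (bB22 p) f g s i x :=
      integrable_finsetSum _ fun i _ => iQ i
    have h1 : |Psi i m f g s| ≤ ∫ x, ∑ i, QB (bB11 p) (bB12 p) (bB22 p) f g s i x := by
      unfold Psi
      rw [← Real.norm_eq_abs]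
      refine norm_integral_le_of_norm_le hQi (Eventually.of_forall fun x => ?_)
      obtain ⟨l, k, hl, hk, hlk, hq⟩ := bell_lower hp (hf.pos hs x) (hg.pos hs x)
      have hQ : ∀ j, l * (cv (hk1 j s) f x)^2 + k * (cv (hk1 j s) g x)^2
          ≤ QB (bB11 p) (bB12 p) (bB22 p) f g s j x := fun j => hq _ _
      have h2 : l * (cv (hk1 i s) f x)^2 + k * (cv (hk1 m s) g x)^2 ≤
          ∑ j, QB (bB11 p) (bB12 p) (bB22 p) f g s j x := by
        refine le_trans ?_ (Finset.sum_le_sum fun j _ => hQ j)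
        rw [Finset.sum_add_distrib]
        refine add_le_add ?_ ?_
        · exact Finset.single_le_sum (f := fun j => l * (cv (hk1 j s) f x)^2)
            (fun j _ => mul_nonneg hl (sq_nonneg _)) (Finset.mem_univ i)
        · exact Finset.single_le_sum (f := fun j => k * (cv (hk1 j s) g x)^2)
            (fun j _ => mul_nonneg hk (sq_nonneg _)) (Finset.mem_univ m)
      refine le_trans ?_ h2
      generalize cv (hk1 i s) f x = a
      generalize cv (hk1 m s) g x = b
      rw [Real.norm_eq_abs]
      have h3 : (a*b)^2 ≤ (l * a^2 + k*b^2)^2 := by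
        have : (l*k) * (a*b)^2 ≥ 1 * (a*b)^2 := by gcongr
        nlinarith [sq_nonneg (l*a^2-k*b^2), sq_nonneg (a*b)]
      exact abs_le_of_sq_le_sq h3 (by positivity)
    rw [abs_mul, abs_of_pos hs]
    have h0 : 0 ≤ ∫ x, ∑ i, QB (bB11 p) (bB12 p) (bB22 p) f g s i x := (abs_nonneg _).trans h1
    nlinarith
  · obtain ⟨jf, hjf⟩ := jensen_int hf.nice hf.nonneg hpq hs
    obtain ⟨jg, hjg⟩ := jensen_int hg.nice hg.nonneg hpq.symm hs
    have jj : Integrable (fun x => (cv (hk s) f x)^p + (cv (hk s) g x)^(bq p)) := jf.add jg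
    have h := integral_mono i0 (jj.const_mul ((bA p + 3) * p^2)) fun x =>
      (le_abs_self _).trans (bell_bd hp (hf.pos hs x) (hg.pos hs x)).1
    refine h.trans ?_
    have e : ∫ x, ((cv (hk s) f x)^p + (cv (hk s) g x)^(bq p)) = _ := integral_add jf jg
    rw [integral_const_mul, e]
    have hK : 0 ≤ (bA p + 3) * p^2 := by positivity
    gcongr

lemma Psi_zero_left {f g : E3 → ℝ} (hf : f =ᵐ[volume] 0) (i m : Fin 3) (s : ℝ) : Psi i m f g s = 0 := by
  have : ∀ x, cv (hk1 i s) f x = 0 := fun x => by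
    unfold cv
    rw [integral_congr_ae (g := fun _ => (0:ℝ))]
    · simp
    · filter_upwards [hf] with y hy
      simp [hy]
  simp [Psi, this]

lemma Nice.zero_or_pos {f : E3 → ℝ} (hf : Nice f) (h0 : ∀ x, 0 ≤ f x) : f =ᵐ[volume] 0 ∨ Pos f := by
  rcases (integral_nonneg h0 : 0 ≤ ∫ x, f x).eq_or_lt with h | h
  · exact Or.inl ((integral_eq_zero_iff_of_nonneg h0 hf.integrable).1 h.symm)
  · exact Or.inr ⟨hf, h0, h⟩

lemma bell_nonneg {p : ℝ} (hp : 2 ≤ p) {f g : E3 → ℝ} (hf : Nice f) (hg : Nice g)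
    (hf0 : ∀ x, 0 ≤ f x) (hg0 : ∀ x, 0 ≤ g x) (i m : Fin 3) :
    Ctrl (fun s => s * Psi i m f g s) (((bA p + 3) * p^2) * ((∫ x, |f x|^p) + ∫ x, |g x|^(bq p))) := by
  obtain ⟨q1, q2, A0, A6⟩ := bq_facts hp
  have hA : 0 ≤ ((bA p + 3) * p^2) * ((∫ x, |f x|^p) + ∫ x, |g x|^(bq p)) := by
    have h1 : 0 ≤ ∫ x, |f x|^p := integral_nonneg fun x => by positivity
    have h2 : 0 ≤ ∫ x, |g x|^(bq p) := integral_nonneg fun x => by positivity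
    positivity
  rcases hf.zero_or_pos hf0 with h | h
  · exact Ctrl.zero hA fun s _ => by rw [Psi_zero_left h, mul_zero]
  rcases hg.zero_or_pos hg0 with h' | h'
  · exact Ctrl.zero hA fun s _ => by rw [Psi_comm, Psi_zero_left h', mul_zero]
  exact bell_pos hp h h' i m

lemma part_le {f : E3 → ℝ} (hf : Nice f) {p : ℝ} (hp : 0 < p) :
    (∫ x, |max (f x) 0|^p) ≤ ∫ x, |f x|^p ∧ (∫ x, |max (-f x) 0|^p) ≤ ∫ x, |f x|^p := by
  constructor
  · refine integral_mono (hf.pos_part.rpow hp).integrable (hf.rpow hp).integrable fun x => ?_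
    beta_reduce
    refine Real.rpow_le_rpow (abs_nonneg _) ?_ hp.le
    rcases le_total (f x) 0 with h | h
    · simp [max_eq_right h]
    · simp [max_eq_left h]
  · refine integral_mono (hf.neg_part.rpow hp).integrable (hf.rpow hp).integrable fun x => ?_
    beta_reduce
    refine Real.rpow_le_rpow (abs_nonneg _) ?_ hp.le
    rcases le_total (-f x) 0 with h | h
    · simp [max_eq_right h]
    · simp [max_eq_left h]

lemma Ctrl.neg {ψ : ℝ → ℝ} {A : ℝ} (h : Ctrl ψ A) : Ctrl (fun s => - ψ s) A :=
  h.mono (fun s _ => by simp) le_rfl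

lemma Ctrl.congr {ψ φ : ℝ → ℝ} {A : ℝ} (h : Ctrl ψ A) (e : ∀ s > 0, φ s = ψ s) : Ctrl φ A :=
  h.mono (fun s hs => by rw [e s hs]) le_rfl

lemma bell_signed {p : ℝ} (hp : 2 ≤ p) {f g : E3 → ℝ} (hf : Nice f) (hg : Nice g) (i m : Fin 3) :
    Ctrl (fun s => s * Psi i m f g s)
      ((4 * ((bA p + 3) * p^2)) * ((∫ x, |f x|^p) + ∫ x, |g x|^(bq p))) := by
  obtain ⟨q1, q2, A0, A6⟩ := bq_facts hp
  have hK : 0 ≤ (bA p + 3) * p^2 := by positivity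
  obtain ⟨f1, f2⟩ := part_le hf (by linarith : 0 < p)
  obtain ⟨g1, g2⟩ := part_le hg (by linarith : 0 < bq p)
  have m0 : ∀ (h : E3 → ℝ) x, 0 ≤ max (h x) 0 := fun h x => le_max_right _ _
  have k : ∀ {F G : E3 → ℝ}, Nice F → Nice G → (∀ x, 0 ≤ F x) → (∀ x, 0 ≤ G x) →
      (∫ x, |F x|^p) ≤ (∫ x, |f x|^p) → (∫ x, |G x|^(bq p)) ≤ (∫ x, |g x|^(bq p)) →
      Ctrl (fun s => s * Psi i m F G s) (((bA p + 3) * p^2) * ((∫ x, |f x|^p) + ∫ x, |g x|^(bq p))) :=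
    fun hF hG hF0 hG0 h1 h2 => (bell_nonneg hp hF hG hF0 hG0 i m).mono (fun _ _ => le_rfl) (by gcongr)
  have c1 := k hf.pos_part hg.pos_part (fun x => m0 f x) (fun x => m0 g x) f1 g1
  have c2 := k hf.neg_part hg.pos_part (fun x => le_max_right _ _) (fun x => m0 g x) f2 g1
  have c3 := k hf.pos_part hg.neg_part (fun x => m0 f x) (fun x => le_max_right _ _) f1 g2
  have c4 := k hf.neg_part hg.neg_part (fun x => le_max_right _ _) (fun x => le_max_right _ _) f2 g2
  refine (((c1.add c2.neg).add c3.neg).add c4).mono (fun s hs => le_of_eq ?_) (le_of_eq (by ring))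
  congr 1
  have ef : f = fun x => max (f x) 0 - max (-f x) 0 := by
    ext x; rcases le_total (f x) 0 with h | h
    · rw [max_eq_right h, max_eq_left (by linarith)]; ring
    · rw [max_eq_left h, max_eq_right (by linarith)]; ring
  have eg : g = fun x => max (g x) 0 - max (-g x) 0 := by
    ext x; rcases le_total (g x) 0 with h | h
    · rw [max_eq_right h, max_eq_left (by linarith)]; ring
    · rw [max_eq_left h, max_eq_right (by linarith)]; ring
  have e1 : Psi i m f g s = Psi i m (fun x => max (f x) 0) g s - Psi i m (fun x => max (-f x) 0) g s := by
    conv_lhs => rw [ef]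
    exact Psi_sub_left hf.pos_part hf.neg_part hg hs i m
  have e2 : ∀ F : E3 → ℝ, Nice F → Psi i m F g s =
      Psi i m F (fun x => max (g x) 0) s - Psi i m F (fun x => max (-g x) 0) s := fun F hF => by
    conv_lhs => rw [eg]
    exact Psi_sub_right hg.pos_part hg.neg_part hF hs i m
  rw [e1, e2 _ hf.pos_part, e2 _ hf.neg_part]; ring

lemma bell {p q : ℝ} (hpq : p.HolderConjugate q) : ∃ K : ℝ, 0 ≤ K ∧ ∀ (f g : E3 → ℝ), Nice f → Nice g →
    ∀ i m : Fin 3, Ctrl (fun s => s * Psi i m f g s) (K * ((∫ x, |f x|^p) + ∫ x, |g x|^q)) := by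
  have h1 := hpq.lt
  have h2 := hpq.symm.lt
  rcases le_total 2 p with h | h
  · have e : bq p = q := by rw [hpq.conjugate_eq]; rfl
    obtain ⟨q1, q2, A0, A6⟩ := bq_facts h
    refine ⟨4 * ((bA p + 3) * p^2), by positivity, fun f g hf hg i m => ?_⟩
    rw [← e]
    exact bell_signed h hf hg i m
  · have hq : 2 ≤ q := by
      have := hpq.mul_eq_add
      nlinarith
    have e : bq q = p := by rw [hpq.symm.conjugate_eq]; rfl
    obtain ⟨q1, q2, A0, A6⟩ := bq_facts hq
    refine ⟨4 * ((bA q + 3) * q^2), by positivity, fun f g hf hg i m => ?_⟩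
    have := bell_signed hq hg hf m i
    rw [e, add_comm (∫ x, |g x|^q)] at this
    refine this.congr fun s _ => by rw [Psi_comm]

/-! ### Off-diagonal estimate -/

lemma exp_poly4 {t : ℝ} (ht : 0 ≤ t) : (1+t)^4 * Real.exp (-(t^2/32)) ≤ 16384 := by
  have h := Real.quadratic_le_exp_of_nonneg (x := t^2/32) (by positivity)
  have h1 : (1+t)^4 ≤ 16384 * Real.exp (t^2/32) := by
    have : (1+t)^4 ≤ 8 * (1+t^4) := by
      nlinarith [sq_nonneg (t-1), sq_nonneg (t^2-1), sq_nonneg (t*(t-1)), mul_nonneg ht (sq_nonneg (t-1)),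
        sq_nonneg ((t-1)^2)]
    have h2 : 8*(1+t^4) ≤ 16384 * (1 + t^2/32 + (t^2/32)^2/2) := by nlinarith [sq_nonneg t]
    linarith
  rw [Real.exp_neg, ← div_eq_mul_inv, div_le_iff₀ (Real.exp_pos _)]
  exact h1

lemma exp_poly4' {ρ s : ℝ} (hρ : 0 ≤ ρ) (hs : 0 < s) :
    s * (s^3 * (Real.exp (-ρ^2/(32*s^2)) / s^8)) ≤ 16384 / (ρ+s)^4 := by
  have h := exp_poly4 (t := ρ/s) (by positivity)
  have e : -((ρ/s)^2/32) = -ρ^2/(32*s^2) := by field_simp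
  rw [e] at h
  have e2 : (1+ρ/s)^4 = (ρ+s)^4/s^4 := by rw [← div_pow]; congr 1; field_simp; ring
  rw [e2] at h
  rw [le_div_iff₀ (by positivity)]
  refine le_trans (le_of_eq ?_) h
  field_simp

lemma two_gauss {s : ℝ} (hs : 0 < s) (x y y' : E3) :
    Real.exp (-‖x-y‖^2/(8*s^2)) * Real.exp (-‖x-y'‖^2/(8*s^2)) ≤
    Real.exp (-‖y'-y‖^2/(32*s^2)) * Real.exp (-(1/16) * ‖x-y‖^2/s^2) := by
  rw [← Real.exp_add, ← Real.exp_add, Real.exp_le_exp]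
  have h : ‖y'-y‖ ≤ ‖x-y‖ + ‖x-y'‖ := by
    have : y' - y = (x-y) - (x-y') := by abel
    rw [this]; exact norm_sub_le _ _
  have h2 : ‖y'-y‖^2 ≤ 2*‖x-y‖^2 + 2*‖x-y'‖^2 := by
    have := norm_nonneg (y'-y)
    nlinarith [sq_nonneg (‖x-y‖ - ‖x-y'‖)]
  have e1 : -‖x-y‖^2/(8*s^2) + -‖x-y'‖^2/(8*s^2) = (-4*‖x-y‖^2 - 4*‖x-y'‖^2)/(32*s^2) := by field_simp; ring
  have e2 : -‖y'-y‖^2/(32*s^2) + -(1/16) * ‖x-y‖^2/s^2 = (-‖y'-y‖^2 - 2*‖x-y‖^2)/(32*s^2) := by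
    field_simp; ring
  rw [e1, e2]
  refine div_le_div_of_nonneg_right ?_ (by positivity)
  nlinarith [sq_nonneg ‖x-y'‖]

def gc1 : ℝ := ∫ z : E3, Real.exp (-(1/16) * ‖z‖^2)

lemma gc1_nonneg : 0 ≤ gc1 := integral_nonneg fun z => (Real.exp_pos _).le

lemma gauss16 {s : ℝ} (hs : 0 < s) (y : E3) : Integrable (fun x : E3 => Real.exp (-(1/16) * ‖x-y‖^2/s^2)) ∧
    ∫ x : E3, Real.exp (-(1/16) * ‖x-y‖^2/s^2) = s^3 * gc1 := by
  constructor
  · have h := (gauss_integrable (b := 1/(16*s^2)) (by positivity)).comp_sub_right y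
    refine h.congr (Eventually.of_forall fun x => ?_)
    simp only []
    congr 1; field_simp
  · rw [integral_sub_right_eq_self (fun x : E3 => Real.exp (-(1/16) * ‖x‖^2/s^2)) y, gauss_scale hs, gc1]

lemma shift_gauss {s R : ℝ} (hs : 0 < s) (x y : E3) (hy : ‖y‖ ≤ R) :
    Real.exp (-(1/16) * ‖x-y‖^2/s^2) ≤ Real.exp (R^2/(16*s^2)) * Real.exp (-(1/(32*s^2)) * ‖x‖^2) := by
  rw [← Real.exp_add, Real.exp_le_exp]
  have h : ‖x‖ ≤ ‖x-y‖ + ‖y‖ := by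
    simpa using norm_add_le (x-y) y
  have h2 : ‖x‖^2 ≤ 2*‖x-y‖^2 + 2*R^2 := by
    have := norm_nonneg x
    have := norm_nonneg y
    nlinarith [sq_nonneg (‖x-y‖ - ‖y‖)]
  have e1 : -(1/16) * ‖x-y‖^2/s^2 = (-2*‖x-y‖^2)/(32*s^2) := by field_simp; ring
  have e2 : R^2/(16*s^2) + -(1/(32*s^2)) * ‖x‖^2 = (2*R^2-‖x‖^2)/(32*s^2) := by field_simp; ring
  rw [e1, e2]
  gcongr
  linarith

lemma hk1_hk1 {s : ℝ} (hs : 0 < s) (i m : Fin 3) (x y y' : E3) :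
    |hk1 i s (x-y)| * |hk1 m s (x-y')| ≤ (4*gc0^2) * (Real.exp (-‖y'-y‖^2/(32*s^2)) / s^8) *
      Real.exp (-(1/16) * ‖x-y‖^2/s^2) := by
  have hg := gc0_pos
  calc _ ≤ (2*gc0/s^4 * Real.exp (-‖x-y‖^2/(8*s^2))) * (2*gc0/s^4 * Real.exp (-‖x-y'‖^2/(8*s^2))) :=
        mul_le_mul (hk1_bdg hs i _) (hk1_bdg hs m _) (abs_nonneg _) (by positivity)
    _ = (4*gc0^2/s^8) * (Real.exp (-‖x-y‖^2/(8*s^2)) * Real.exp (-‖x-y'‖^2/(8*s^2))) := by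
        field_simp; ring
    _ ≤ (4*gc0^2/s^8) * (Real.exp (-‖y'-y‖^2/(32*s^2)) * Real.exp (-(1/16) * ‖x-y‖^2/s^2)) := by
        exact mul_le_mul_of_nonneg_left (two_gauss hs x y y') (by positivity)
    _ = _ := by field_simp

lemma ww_integrable {f g : E3 → ℝ} (hf : Nice f) (hg : Nice g) {e : E3 × E3 → ℝ} {K : ℝ}
    (he : Measurable e) (hK : ∀ z, |e z| ≤ K) :
    Integrable (fun z : E3 × E3 => (|f z.1| * |g z.2|) * e z) (volume.prod volume) := by
  have h := (hf.integrable.abs).mul_prod (hg.integrable.abs)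
  have := h.bdd_mul (c := K) (f := e) he.aestronglyMeasurable (Eventually.of_forall fun z => hK z)
  refine this.congr (Eventually.of_forall fun z => ?_)
  simp only []; ring

lemma off_bd {f g : E3 → ℝ} (hf : Nice f) (hg : Nice g) {s : ℝ} (hs : 0 < s) (i m : Fin 3) :
    |s * Psi i m f g s| ≤ ∫ z : E3 × E3, (|f z.1| * |g z.2|) *
      ((4*gc0^2*gc1*16384) / (‖z.2-z.1‖+s)^4) ∂(volume.prod volume) := by
  have hg0 := gc0_pos
  have hg1 := gc1_nonneg
  obtain ⟨R, hR, hf1, hf2⟩ := hf.bdd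
  set H : E3 → E3 × E3 → ℝ := fun x z => (hk1 i s (x-z.1) * f z.1) * (hk1 m s (x-z.2) * g z.2) with hH
  have e1 : Psi i m f g s = ∫ x, ∫ z, H x z ∂(volume.prod volume) := by
    unfold Psi cv
    congr 1; ext x
    rw [← integral_prod_mul]
  have hb : ∀ x z, |H x z| ≤ (|f z.1| * |g z.2|) * ((4*gc0^2) * (Real.exp (-‖z.2-z.1‖^2/(32*s^2)) / s^8) *
      Real.exp (-(1/16) * ‖x-z.1‖^2/s^2)) := fun x z => by
    simp only [hH, abs_mul]
    calc _ = (|f z.1| * |g z.2|) * (|hk1 i s (x-z.1)| * |hk1 m s (x-z.2)|) := by ring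
      _ ≤ _ := mul_le_mul_of_nonneg_left (hk1_hk1 hs i m _ _ _) (by positivity)
  have hHm : Measurable (Function.uncurry H) := by
    have := (hk1_cont i s).measurable
    have := (hk1_cont m s).measurable
    have := hf.meas
    have := hg.meas
    simp only [hH, Function.uncurry_def]
    fun_prop
  have hHi : Integrable (Function.uncurry H) (volume.prod (volume.prod volume)) := by
    have h := ((gauss_integrable (b := 1/(32*s^2)) (by positivity)).const_mul
      ((4*gc0^2) * (1 / s^8) * Real.exp (R^2/(16*s^2)))).mul_prod
      (hf.integrable.abs.mul_prod hg.integrable.abs)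
    refine h.mono' hHm.aestronglyMeasurable (Eventually.of_forall fun w => ?_)
    obtain ⟨x, z⟩ := w
    refine (hb x z).trans ?_
    simp only []
    by_cases hz : f z.1 = 0
    · simp [hz]
    have hzR : ‖z.1‖ ≤ R := by by_contra hc; exact hz (hf2 _ (not_le.1 hc))
    rw [mul_comm]
    have h1 := shift_gauss hs x z.1 hzR
    have h2 : Real.exp (-‖z.2-z.1‖^2/(32*s^2)) ≤ 1 := by
      rw [Real.exp_le_one_iff, neg_div]
      have : 0 ≤ ‖z.2-z.1‖^2/(32*s^2) := by positivity
      linarith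
    calc _ ≤ (4*gc0^2 * (1/s^8) * (Real.exp (R^2/(16*s^2)) * Real.exp (-(1/(32*s^2)) * ‖x‖^2))) *
          (|f z.1| * |g z.2|) := by gcongr
      _ = _ := by ring
  rw [e1, integral_integral_swap hHi, ← integral_const_mul, ← Real.norm_eq_abs]
  refine norm_integral_le_of_norm_le (ww_integrable hf hg ?_ (K := (4*gc0^2*gc1*16384) / s^4) ?_)
    (Eventually.of_forall fun z => ?_)
  · fun_prop
  · intro z
    rw [abs_of_nonneg (by positivity)]
    gcongr
    linarith [norm_nonneg (z.2-z.1)]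
  · have h1 : |∫ x, H x z| ≤ ∫ x, ((|f z.1| * |g z.2|) * ((4*gc0^2) * (Real.exp (-‖z.2-z.1‖^2/(32*s^2)) / s^8))) *
        Real.exp (-(1/16) * ‖x-z.1‖^2/s^2) := by
      rw [← Real.norm_eq_abs]
      refine norm_integral_le_of_norm_le ((gauss16 hs z.1).1.const_mul _) (Eventually.of_forall fun x => ?_)
      refine (hb x z).trans (le_of_eq ?_)
      ring
    rw [integral_const_mul, (gauss16 hs z.1).2] at h1
    rw [Real.norm_eq_abs, abs_mul, abs_of_pos hs]
    calc s * |∫ x, H x z| ≤ s * (((|f z.1| * |g z.2|) * ((4*gc0^2) * (Real.exp (-‖z.2-z.1‖^2/(32*s^2)) / s^8)))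
            * (s^3 * gc1)) := by gcongr
      _ = (|f z.1| * |g z.2|) * ((4*gc0^2*gc1) *
          (s * (s^3 * (Real.exp (-‖z.2-z.1‖^2/(32*s^2)) / s^8)))) := by ring
      _ ≤ (|f z.1| * |g z.2|) * ((4*gc0^2*gc1) * (16384 / (‖z.2-z.1‖+s)^4)) := by
        gcongr; exact exp_poly4' (norm_nonneg _) hs
      _ = _ := by ring

lemma off_ctrl : ∃ D : ℝ, 0 ≤ D ∧ ∀ (f g : E3 → ℝ), Nice f → Nice g → ∀ (i m : Fin 3) (A : ℝ),
    (∀ s > 0, ∫ z : E3 × E3, (|f z.1| * |g z.2|) * (D / (‖z.2-z.1‖+s)^3) ∂(volume.prod volume) ≤ A) →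
    Ctrl (fun s => s * Psi i m f g s) A := by
  have hg0 := gc0_pos
  have hg1 := gc1_nonneg
  set D := 4*gc0^2*gc1*16384 with hD
  have hD0 : 0 ≤ D := by positivity
  refine ⟨D, hD0, fun f g hf hg i m A hA => ?_⟩
  have mono : ∀ {s t : ℝ}, 0 < s → s ≤ t → ∀ z : E3 × E3, ∀ n : ℕ, |D/(‖z.2-z.1‖+t)^n| ≤ D/s^n :=
    fun {s t} hs hst z n => by
      have := hs.trans_le hst
      rw [abs_of_nonneg (by positivity)]
      gcongr
      linarith [norm_nonneg (z.2-z.1)]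
  refine ⟨fun s => ∫ z : E3 × E3, (|f z.1| * |g z.2|) * (D / (‖z.2-z.1‖+s)^3) ∂(volume.prod volume),
    fun s => ∫ z : E3 × E3, (|f z.1| * |g z.2|) * (-3*D / (‖z.2-z.1‖+s)^4) ∂(volume.prod volume),
    fun s hs => ⟨?_, ?_, integral_nonneg fun z => by positivity, hA s hs⟩⟩
  · have hs2 : 0 < s/2 := by linarith
    have hm := hf.meas
    have hm' := hg.meas
    have := hasDerivAt_integral_of_dominated_loc_of_deriv_le (μ := (volume : Measure E3).prod (volume : Measure E3))
      (F := fun (t:ℝ) z => (|f z.1| * |g z.2|) * (D / (‖z.2-z.1‖+t)^3))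
      (F' := fun t z => (|f z.1| * |g z.2|) * (-3*D / (‖z.2-z.1‖+t)^4))
      (x₀ := s) (s := Set.Ioi (s/2)) (bound := fun z => (|f z.1| * |g z.2|) * (3*(D/(s/2)^4)))
      (Ioi_mem_nhds (by linarith)) (Eventually.of_forall fun t => by
        apply Measurable.aestronglyMeasurable; fun_prop)
      (ww_integrable hf hg (by fun_prop) (fun z => mono hs le_rfl z 3))
      (by apply Measurable.aestronglyMeasurable; fun_prop)
      (Eventually.of_forall fun z t ht => by
        have h := mono hs2 (le_of_lt ht) z 4
        rw [norm_mul, Real.norm_of_nonneg (by positivity : 0 ≤ |f z.1| * |g z.2|)]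
        gcongr
        have e : -3*D / (‖z.2-z.1‖+t)^4 = -3 * (D/(‖z.2-z.1‖+t)^4) := by ring
        rw [e, norm_mul, Real.norm_eq_abs (D/_)]
        have : ‖(-3:ℝ)‖ = 3 := by norm_num
        rw [this]
        gcongr)
      (ww_integrable hf hg (e := fun _ => 3*(D/(s/2)^4)) (by fun_prop) (fun z => le_rfl))
      (Eventually.of_forall fun z t ht => by
        have ht0 : 0 < t := hs2.trans ht
        have hp : 0 < ‖z.2-z.1‖+t := by positivity
        have h := ((((hasDerivAt_id t).const_add ‖z.2-z.1‖).fun_pow 3).fun_inv (by positivity)).const_mul D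
        refine (h.const_mul (|f z.1| * |g z.2|)).congr_deriv ?_
        congr 1
        simp only [id]
        field_simp
        norm_num
        try ring)
    exact this.2
  · refine (off_bd hf hg hs i m).trans ?_
    rw [← integral_neg]
    refine integral_mono (ww_integrable hf hg (by fun_prop) (fun z => mono hs le_rfl z 4)) 
      ((ww_integrable hf hg (e := fun z => 3 * (D / (‖z.2-z.1‖+s)^4)) (K := 3*(D/s^4)) (by fun_prop)
        (fun z => by rw [abs_mul, abs_of_pos (by norm_num : (0:ℝ) < 3)]; gcongr; exact mono hs le_rfl z 4)).congr
        (Eventually.of_forall fun z => by simp only []; ring)) fun z => ?_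
    simp only []
    have : -(|f z.1| * |g z.2| * (-3 * D / (‖z.2 - z.1‖ + s) ^ 4)) =
      |f z.1| * |g z.2| * (3 * (D / (‖z.2 - z.1‖ + s) ^ 4)) := by ring
    rw [this]
    gcongr
    have : 0 ≤ D / (‖z.2 - z.1‖ + s) ^ 4 := by positivity
    linarith

/-! ### The identity -/

lemma Nice.of_test {f : E3 → ℝ} (hc : Continuous f) (hs : HasCompactSupport f) : Nice f := by
  obtain ⟨C, hC⟩ := hs.exists_bound_of_continuous hc
  obtain ⟨R, hR⟩ := hs.isCompact.isBounded.subset_closedBall (0:E3)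
  refine ⟨hc.measurable, |C| + |R| + 1, by positivity, fun x => ?_, fun x hx => ?_⟩
  · have := hC x
    rw [Real.norm_eq_abs] at this
    linarith [le_abs_self C, abs_nonneg R]
  · by_contra h
    have := hR (subset_tsupport f h)
    rw [mem_closedBall_zero_iff] at this
    linarith [le_abs_self R, abs_nonneg C]

lemma pds_cont {φ : E3 → ℝ} (hφ : ContDiff ℝ 1 φ) (i : Fin 3) : Continuous (pds φ i) := by
  unfold pds
  exact (hφ.continuous_fderiv (by norm_num)).clm_apply continuous_const

lemma pds_supp {φ : E3 → ℝ} (hs : HasCompactSupport φ) (i : Fin 3) : HasCompactSupport (pds φ i) :=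
  hs.fderiv_apply ℝ (ee i)

lemma pds_nice {φ : E3 → ℝ} (hφ : ContDiff ℝ 1 φ) (hs : HasCompactSupport φ) (i : Fin 3) : Nice (pds φ i) :=
  Nice.of_test (pds_cont hφ i) (pds_supp hs i)

lemma cv_pds {φ : E3 → ℝ} (hφ : ContDiff ℝ 1 φ) (hs : HasCompactSupport φ) (i : Fin 3)
    {k k' : E3 → ℝ} {C C' : ℝ} (hk : Continuous k) (hC : ∀ z, |k z| ≤ C)
    (hk' : Continuous k') (hC' : ∀ z, |k' z| ≤ C')
    (hd : ∀ z, HasLineDerivAt ℝ k (k' z) z (ee i)) (x : E3) :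
    cv k (pds φ i) x = cv k' φ x := by
  have hn := Nice.of_test hφ.continuous hs
  have hn' := pds_nice hφ hs i
  have i1 := cv_integrand hk hC hn.integrable x
  have i2 := cv_integrand hk hC hn'.integrable x
  have i3 := cv_integrand hk' hC' hn.integrable x
  have h := integral_line_zero (G := fun y => k (x-y) * φ y)
    (G' := fun y => k (x-y) * pds φ i y - k' (x-y) * φ y) (e := ee i) i1 (i2.sub i3) (fun y => by
      unfold HasLineDerivAt
      have a1 : HasDerivAt (fun t : ℝ => k (x - (y + t • ee i))) (- k' (x-y)) 0 := by
        have h0 := hd (x-y)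
        unfold HasLineDerivAt at h0
        have h1 : HasDerivAt (fun t : ℝ => k (x - y + t • ee i)) (k' (x-y)) (-(0:ℝ)) := by simpa using h0
        have := h1.scomp (0:ℝ) (hasDerivAt_neg (0:ℝ))
        refine (this.congr_deriv (by simp)).congr_of_eventuallyEq (Eventually.of_forall fun t => ?_)
        simp only [Function.comp]
        congr 1; rw [neg_smul]; abel
      have a2 : HasDerivAt (fun t : ℝ => φ (y + t • ee i)) (pds φ i y) 0 :=
        ((hφ.differentiable (by norm_num)) y).hasFDerivAt.hasLineDerivAt (ee i)
      refine (a1.fun_mul a2).congr_deriv ?_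
      simp; ring)
  rw [integral_sub i2 i3] at h
  unfold cv; linarith

lemma cv1_pds {φ : E3 → ℝ} (hφ : ContDiff ℝ 1 φ) (hs : HasCompactSupport φ) (i m : Fin 3)
    {s : ℝ} (h : 0 < s) (x : E3) : cv (hk1 m s) (pds φ i) x = cv (hk2 i m s) φ x :=
  cv_pds hφ hs i (hk1_cont m s) (hk1_bd h m) (hk2_cont i m s) (hk2_bd h i m) (fun z => hk1_line s z i m) x

lemma hk2_symm (i m : Fin 3) (s : ℝ) : hk2 i m s = hk2 m i s := by
  ext z; unfold hk2; simp only [eq_comm (a := i) (b := m)]; ring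

lemma Psi_swap1 {φ g : E3 → ℝ} (hφ : ContDiff ℝ 1 φ) (hs : HasCompactSupport φ) (i j m : Fin 3)
    {s : ℝ} (h : 0 < s) : Psi i m (pds φ j) g s = Psi j m (pds φ i) g s := by
  unfold Psi
  congr 1; ext x
  rw [cv1_pds hφ hs _ _ h, cv1_pds hφ hs _ _ h, hk2_symm]

lemma ibp {f g : E3 → ℝ} (hf : Nice f) (hg : Nice g) (i j m : Fin 3) {s : ℝ} (hs : 0 < s) :
    ∫ x, cv (hk2 j i s) f x * cv (hk1 m s) g x = - ∫ x, cv (hk1 i s) f x * cv (hk2 j m s) g x := by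
  have i1 : Integrable (fun x => cv (hk2 j i s) f x * cv (hk1 m s) g x) :=
    (cv_integrable (hk1_integrable hs m) hg.integrable).bdd_mul (c := 2*gc0/s^5 * ∫ y, |f y|)
      (hf.c2 hs j i).aestronglyMeasurable (Eventually.of_forall fun x => cv_bd (hk2_bd hs j i) hf.integrable x)
  have i2 : Integrable (fun x => cv (hk1 i s) f x * cv (hk2 j m s) g x) :=
    (cv_integrable (hk1_integrable hs i) hf.integrable).mul_bdd (c := 2*gc0/s^5 * ∫ y, |g y|)
      (hg.c2 hs j m).aestronglyMeasurable (Eventually.of_forall fun x => cv_bd (hk2_bd hs j m) hg.integrable x)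
  have h := integral_line_zero (G := fun x => cv (hk1 i s) f x * cv (hk1 m s) g x)
    (G' := fun x => cv (hk2 j i s) f x * cv (hk1 m s) g x + cv (hk1 i s) f x * cv (hk2 j m s) g x)
    (e := ee j) (psi_integrable hf hg hs i m) (i1.add i2) (fun x => by
      have a1 := hf.l1 hs j i x
      have a2 := hg.l1 hs j m x
      unfold HasLineDerivAt at *
      refine (a1.fun_mul a2).congr_deriv ?_
      simp)
  rw [integral_add i1 i2] at h
  linarith

lemma Psi_swap2 {φ g : E3 → ℝ} (hφ : ContDiff ℝ 1 φ) (hs : HasCompactSupport φ) (hg : Nice g) (i j m : Fin 3)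
    {s : ℝ} (h : 0 < s) : Psi i m (pds φ j) g s = Psi i j (pds φ m) g s := by
  have hn := Nice.of_test hφ.continuous hs
  have k : ∀ j m, Psi i m (pds φ j) g s = - ∫ x, cv (hk1 i s) φ x * cv (hk2 j m s) g x := fun j m => by
    rw [← ibp hn hg i j m h]
    unfold Psi
    congr 1; ext x
    rw [cv1_pds hφ hs _ _ h]
  rw [k, k, hk2_symm]

def vc (v : E3 → E3) (j : Fin 3) (x : E3) : ℝ := v x j

lemma vc_contDiff {Ω : Set E3} {v : E3 → E3} (hv : IsTestSol Ω v) (j : Fin 3) : ContDiff ℝ 1 (vc v j) := by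
  have : ContDiff ℝ 1 v := hv.smooth.of_le (by exact_mod_cast le_top)
  exact (EuclideanSpace.proj j : E3 →L[ℝ] ℝ).contDiff.comp this

lemma vc_supp {Ω : Set E3} {v : E3 → E3} (hv : IsTestSol Ω v) (j : Fin 3) : HasCompactSupport (vc v j) :=
  hv.compsupp.comp_left (g := fun x : E3 => x j) (by simp)

lemma pd_eq {Ω : Set E3} {v : E3 → E3} (hv : IsTestSol Ω v) (i j : Fin 3) : pd v i j = pds (vc v j) i := by
  have h1 : ContDiff ℝ 1 v := hv.smooth.of_le (by exact_mod_cast le_top)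
  ext x
  unfold pd pds
  have h := (EuclideanSpace.proj j : E3 →L[ℝ] ℝ).hasFDerivAt.comp x
    ((h1.differentiable (by norm_num)) x).hasFDerivAt
  have h2 : fderiv ℝ (vc v j) x = _ := h.fderiv
  rw [h2]; rfl

lemma pd_nice {Ω : Set E3} {v : E3 → E3} (hv : IsTestSol Ω v) (i j : Fin 3) : Nice (pd v i j) := by
  rw [pd_eq hv]; exact pds_nice (vc_contDiff hv j) (vc_supp hv j) i

def om (v : E3 → E3) (m j : Fin 3) (x : E3) : ℝ := pd v m j x - pd v j m x

lemma Nice.sub {f g : E3 → ℝ} (hf : Nice f) (hg : Nice g) : Nice (fun x => f x - g x) := by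
  have := hf.add (hg.smul (-1))
  refine (this.of_le (hf.meas.sub hg.meas) fun x => le_of_eq ?_)
  congr 1; ring

lemma psi_identity {Ω : Set E3} {v : E3 → E3} (hv : IsTestSol Ω v) {g : E3 → ℝ} (hg : Nice g) (i j : Fin 3)
    {s : ℝ} (hs : 0 < s) :
    ∑ m, Psi m m (pd v i j) g s = ∑ m, Psi i m (om v m j) g s := by
  have h1 : ∀ m, Psi m m (pd v i j) g s = Psi i m (pd v m j) g s := fun m => by
    rw [pd_eq hv, pd_eq hv]; exact Psi_swap1 (vc_contDiff hv j) (vc_supp hv j) _ _ _ hs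
  have h2 : ∀ m, Psi i m (pd v j m) g s = Psi i j (pd v m m) g s := fun m => by
    rw [pd_eq hv, pd_eq hv]; exact Psi_swap2 (vc_contDiff hv m) (vc_supp hv m) hg _ _ _ hs
  have h3 : ∀ m, Psi i m (om v m j) g s = Psi i m (pd v m j) g s - Psi i m (pd v j m) g s := fun m =>
    Psi_sub_left (pd_nice hv m j) (pd_nice hv j m) hg hs i m
  have h4 : ∑ m, Psi i j (pd v m m) g s = 0 := by
    have e : (fun x => pd v 0 0 x + pd v 1 1 x + pd v 2 2 x) = fun _ => (0:ℝ) := by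
      ext x; have := hv.sol x; simpa [vdiv, Fin.sum_univ_three] using this
    rw [Fin.sum_univ_three, ← Psi_add_left (pd_nice hv 0 0) (pd_nice hv 1 1) hg hs,
      ← Psi_add_left ((pd_nice hv 0 0).add (pd_nice hv 1 1)) (pd_nice hv 2 2) hg hs, e]
    simp [Psi, cv]
  simp only [h1, h3, Finset.sum_sub_distrib, h2, h4, sub_zero]

/-! ### The function Phi -/

def Phi (f g : E3 → ℝ) (s : ℝ) : ℝ := ∫ x, cv (hk s) f x * cv (hk s) g x

lemma phi_integrable {f g : E3 → ℝ} (hf : Nice f) (hg : Nice g) {s : ℝ} (hs : 0 < s) :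
    Integrable (fun x => cv (hk s) f x * cv (hk s) g x) :=
  (cv_integrable (hk_integrable hs) hg.integrable).bdd_mul (c := gc0/s^3 * ∫ y, |f y|)
    (hf.c0 hs).aestronglyMeasurable (Eventually.of_forall fun x => cv_bd (hk_bd hs) hf.integrable x)

lemma Phi_comm (f g : E3 → ℝ) (s : ℝ) : Phi f g s = Phi g f s := by
  unfold Phi; congr 1; ext x; ring

lemma Phi_sub_left {f f' g : E3 → ℝ} (hf : Nice f) (hf' : Nice f') (hg : Nice g) {s : ℝ} (hs : 0 < s) :
    Phi (fun x => f x - f' x) g s = Phi f g s - Phi f' g s := by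
  unfold Phi
  rw [← integral_sub (phi_integrable hf hg hs) (phi_integrable hf' hg hs)]
  congr 1; ext x
  rw [cv_sub (hk_cont s) (hk_bd hs) hf.integrable hf'.integrable]; ring

lemma phi_deriv_pos {f g : E3 → ℝ} (hf : Pos f) (hg : Pos g) {s : ℝ} (hs : 0 < s) :
    HasDerivAt (Phi f g) (-4 * s * ∑ m, Psi m m f g s) s := by
  have h2 : (2:ℝ).HolderConjugate 2 := Real.HolderConjugate.two_two
  have h := (J_lemma (by norm_num) (by norm_num) (prod_BData h2) hf hg hs).1
  refine h.congr_deriv ?_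
  unfold QB Psi
  rw [← integral_finsetSum _ fun i _ => psi_integrable hf.nice hg.nice hs i i]
  have : ∀ x, ∑ i, ((0:ℝ) * cv (hk1 i s) f x * cv (hk1 i s) f x + 2 * (1 * cv (hk1 i s) f x * cv (hk1 i s) g x)
    + 0 * cv (hk1 i s) g x * cv (hk1 i s) g x) = 2 * ∑ i, cv (hk1 i s) f x * cv (hk1 i s) g x := fun x => by
    rw [Finset.mul_sum]; congr 1; ext i; ring
  simp only [this]
  rw [integral_const_mul]; ring

lemma ball_nice : Nice ((Metric.closedBall (0:E3) 1).indicator fun _ => (1:ℝ)) := by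
  refine ⟨measurable_const.indicator Metric.isClosed_closedBall.measurableSet, 1, one_pos, fun x => ?_, fun x hx => ?_⟩
  · by_cases h : x ∈ Metric.closedBall (0:E3) 1
    · rw [Set.indicator_of_mem h]; simp
    · rw [Set.indicator_of_notMem h]; simp
  · apply Set.indicator_of_notMem
    simpa using hx

lemma pos_of_nonneg {f : E3 → ℝ} (hf : Nice f) (h0 : ∀ x, 0 ≤ f x) :
    Pos (fun x => f x + (Metric.closedBall (0:E3) 1).indicator (fun _ => (1:ℝ)) x) := by
  have hb : ∀ x, 0 ≤ (Metric.closedBall (0:E3) 1).indicator (fun _ => (1:ℝ)) x := fun x =>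
    Set.indicator_nonneg (fun _ _ => zero_le_one) x
  refine ⟨hf.add ball_nice, fun x => add_nonneg (h0 x) (hb x), ?_⟩
  rw [integral_add hf.integrable ball_nice.integrable]
  have h1 : 0 ≤ ∫ x, f x := integral_nonneg h0
  have h2 : 0 < ∫ x, (Metric.closedBall (0:E3) 1).indicator (fun _ => (1:ℝ)) x := by
    rw [integral_indicator Metric.isClosed_closedBall.measurableSet]
    simp only [integral_const, smul_eq_mul, mul_one, measureReal_restrict_apply_univ]
    exact ENNReal.toReal_pos (Metric.measure_closedBall_pos _ _ one_pos).ne' measure_closedBall_lt_top.ne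
  linarith

lemma phi_deriv {f g : E3 → ℝ} (hf : Nice f) (hg : Nice g) {s : ℝ} (hs : 0 < s) :
    HasDerivAt (Phi f g) (-4 * s * ∑ m, Psi m m f g s) s := by
  have key : ∀ {f : E3 → ℝ}, Nice f → ∃ f1 f2, Pos f1 ∧ Pos f2 ∧ f = fun x => f1 x - f2 x := fun {f} hf => by
    refine ⟨_, _, pos_of_nonneg hf.pos_part (fun x => le_max_right _ _),
      pos_of_nonneg hf.neg_part (fun x => le_max_right _ _), ?_⟩
    ext x; rcases le_total (f x) 0 with h | h
    · rw [max_eq_right h, max_eq_left (by linarith)]; ring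
    · rw [max_eq_left h, max_eq_right (by linarith)]; ring
  obtain ⟨f1, f2, p1, p2, rfl⟩ := key hf
  obtain ⟨g1, g2, q1, q2, rfl⟩ := key hg
  have eP : ∀ m, Psi m m (fun x => f1 x - f2 x) (fun x => g1 x - g2 x) s =
      (Psi m m f1 g1 s - Psi m m f1 g2 s) - (Psi m m f2 g1 s - Psi m m f2 g2 s) := fun m => by
    rw [Psi_sub_left p1.nice p2.nice hg hs, Psi_sub_right q1.nice q2.nice p1.nice hs,
      Psi_sub_right q1.nice q2.nice p2.nice hs]
  have d := ((phi_deriv_pos p1 q1 hs).fun_sub (phi_deriv_pos p1 q2 hs)).fun_sub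
    ((phi_deriv_pos p2 q1 hs).fun_sub (phi_deriv_pos p2 q2 hs))
  refine (d.congr_deriv ?_).congr_of_eventuallyEq ?_
  · simp only [eP, Finset.sum_sub_distrib]; ring
  · filter_upwards [Ioi_mem_nhds hs] with t ht
    have ht : 0 < t := ht
    rw [Phi_sub_left p1.nice p2.nice hg ht, Phi_comm f1, Phi_comm f2, Phi_sub_left q1.nice q2.nice p1.nice ht,
      Phi_sub_left q1.nice q2.nice p2.nice ht, Phi_comm g1, Phi_comm g1, Phi_comm g2, Phi_comm g2]

/-! ### Limits -/

lemma phi_infty {f g : E3 → ℝ} (hf : Nice f) (hg : Nice g) :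
    ∃ C : ℝ, ∀ s > 0, |Phi f g s| ≤ C / s^3 := by
  refine ⟨gc0 * (∫ y, |f y|) * ∫ y, |g y|, fun s hs => ?_⟩
  have hi := cv_integrable (hk_integrable hs) (hg.integrable.abs)
  unfold Phi
  have h1 : ∀ x, ‖cv (hk s) f x * cv (hk s) g x‖ ≤ (gc0/s^3 * ∫ y, |f y|) * cv (hk s) (fun y => |g y|) x := fun x => by
    rw [norm_mul]
    have a := cv_bd (hk_bd hs) hf.integrable x
    have b : ‖cv (hk s) g x‖ ≤ cv (hk s) (fun y => |g y|) x := by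
      unfold cv
      refine norm_integral_le_of_norm_le (cv_integrand (hk_cont s) (hk_bd hs) hg.integrable.abs x)
        (Eventually.of_forall fun y => ?_)
      rw [norm_mul, Real.norm_of_nonneg (hk_pos hs _).le, Real.norm_eq_abs]
    exact mul_le_mul a b (norm_nonneg _) ((abs_nonneg _).trans a)
  have := norm_integral_le_of_norm_le (hi.const_mul _) (Eventually.of_forall h1)
  rw [integral_const_mul, cv_integral (hk_integrable hs) hg.integrable.abs, hk_integral hs] at this
  rw [← Real.norm_eq_abs]
  refine this.trans (le_of_eq ?_)
  ring

lemma hk_moment : ∃ C : ℝ, 0 ≤ C ∧ ∀ s > 0, Integrable (fun z => ‖z‖ * hk s z) ∧ ∫ z, ‖z‖ * hk s z ≤ C * s := by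
  refine ⟨2 * gc0 * ∫ z : E3, Real.exp (-(1/8) * ‖z‖^2), ?_, fun s hs => ?_⟩
  · have := gc0_pos
    have : 0 ≤ ∫ z : E3, Real.exp (-(1/8) * ‖z‖^2) := integral_nonneg fun z => (Real.exp_pos _).le
    positivity
  have hg := gc0_pos
  have hb : ∀ z : E3, ‖z‖ * hk s z ≤ (2*s*(gc0/s^3)) * Real.exp (-(1/8) * ‖z‖^2/s^2) := fun z => by
    have h1 := Real.add_one_le_exp (‖z‖^2/(8*s^2))
    have h2 : ‖z‖ ≤ 2*s * Real.exp (‖z‖^2/(8*s^2)) := by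
      have : ‖z‖ ≤ 2*s * (‖z‖^2/(8*s^2) + 1) := by
        have e : 2*s * (‖z‖^2/(8*s^2) + 1) = (‖z‖^2 + 8*s^2)/(4*s) := by field_simp; ring
        rw [e, le_div_iff₀ (by positivity)]
        nlinarith [sq_nonneg (‖z‖ - 2*s)]
      refine this.trans ?_
      gcongr
    have e : Real.exp (-(1/8) * ‖z‖^2/s^2) = Real.exp (‖z‖^2/(8*s^2)) * Real.exp (-‖z‖^2/(4*s^2)) := by
      rw [← Real.exp_add]; congr 1; field_simp; ring
    rw [e]
    unfold hk
    calc _ ≤ (2*s * Real.exp (‖z‖^2/(8*s^2))) * (gc0/s^3 * Real.exp (-‖z‖^2/(4*s^2))) := by gcongr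
      _ = _ := by ring
  have hi : Integrable (fun z : E3 => (2*s*(gc0/s^3)) * Real.exp (-(1/8) * ‖z‖^2/s^2)) := by
    refine ((gauss_integrable (b := 1/(8*s^2)) (by positivity)).congr
      (Eventually.of_forall fun z => ?_)).const_mul _
    simp only []
    congr 1; field_simp
  have hi2 : Integrable (fun z => ‖z‖ * hk s z) := by
    refine hi.mono' (continuous_norm.mul (hk_cont s)).aestronglyMeasurable (Eventually.of_forall fun z => ?_)
    rw [Real.norm_of_nonneg (mul_nonneg (norm_nonneg _) (hk_pos hs z).le)]
    exact hb z
  refine ⟨hi2, (integral_mono hi2 hi hb).trans (le_of_eq ?_)⟩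
  rw [integral_const_mul, gauss_scale hs]
  field_simp

lemma cv_close {F : E3 → ℝ} (hF : Nice F) {L : ℝ} (hL : ∀ x y, |F x - F y| ≤ L * ‖x-y‖) :
    ∃ C : ℝ, 0 ≤ C ∧ ∀ s > 0, ∀ x, |cv (hk s) F x - F x| ≤ C * s := by
  obtain ⟨C, hC, h⟩ := hk_moment
  refine ⟨|L| * C, by positivity, fun s hs x => ?_⟩
  obtain ⟨hi, hb⟩ := h s hs
  have hk1 : ∫ y, hk s (x - y) = 1 := by
    rw [integral_sub_left_eq_self (fun y => hk s y) volume x, hk_integral hs]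
  have hki : Integrable fun y => hk s (x-y) := (hk_integrable hs).comp_sub_left x
  have e : cv (hk s) F x - F x = ∫ y, hk s (x-y) * (F y - F x) := by
    have : (fun y => hk s (x-y) * (F y - F x)) = fun y => hk s (x-y) * F y - hk s (x-y) * F x := by
      ext y; ring
    rw [this, integral_sub (cv_integrand (hk_cont s) (hk_bd hs) hF.integrable x) (hki.mul_const _),
      integral_mul_const, hk1, one_mul]; rfl
  have hj : Integrable (fun y => |L| * (‖x-y‖ * hk s (x-y))) := (hi.comp_sub_left x).const_mul |L|
  rw [e, ← Real.norm_eq_abs]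
  refine (norm_integral_le_of_norm_le hj (Eventually.of_forall fun y => ?_)).trans ?_
  · rw [norm_mul, Real.norm_of_nonneg (hk_pos hs _).le, Real.norm_eq_abs, abs_sub_comm]
    have h1 := hL x y
    have h2 : L * ‖x-y‖ ≤ |L| * ‖x-y‖ := by gcongr; exact le_abs_self L
    calc _ ≤ hk s (x-y) * (|L| * ‖x-y‖) := by
          have := (hk_pos hs (x-y)).le
          gcongr; linarith
      _ = _ := by ring
  · rw [integral_const_mul, integral_sub_left_eq_self (fun y => ‖y‖ * hk s y) volume x, mul_assoc]
    gcongr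

lemma cv_self_adj {f g : E3 → ℝ} (hf : Nice f) (hg : Nice g) {s : ℝ} (hs : 0 < s) :
    ∫ x, f x * cv (hk s) g x = ∫ x, cv (hk s) f x * g x := by
  have hm := hf.meas
  have hm' := hg.meas
  have hkm := (hk_cont s).measurable
  have hi : Integrable (Function.uncurry fun x y => hk s (x-y) * (f x * g y)) (volume.prod volume) := by
    have h := hf.integrable.mul_prod hg.integrable
    exact h.bdd_mul (c := gc0/s^3) (f := fun z : E3 × E3 => hk s (z.1-z.2))
      (by apply Measurable.aestronglyMeasurable; fun_prop) (Eventually.of_forall fun z => hk_bd hs _)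
  calc ∫ x, f x * cv (hk s) g x = ∫ x, ∫ y, hk s (x-y) * (f x * g y) := by
        congr 1; ext x; unfold cv; rw [← integral_const_mul]; congr 1; ext y; ring
    _ = ∫ y, ∫ x, hk s (x-y) * (f x * g y) := integral_integral_swap hi
    _ = _ := by
        congr 1; ext y; unfold cv; rw [← integral_mul_const]; congr 1; ext x
        rw [← hk_neg s (x-y), neg_sub]; ring

lemma phi_zero {F g : E3 → ℝ} (hF : Nice F) {L : ℝ} (hL : ∀ x y, |F x - F y| ≤ L * ‖x-y‖) (hg : Nice g) :
    ∃ C : ℝ, ∀ s > 0, |Phi F g s - ∫ x, F x * g x| ≤ C * s := by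
  obtain ⟨C, hC, h⟩ := cv_close hF hL
  obtain ⟨R, hR, hF1, hF2⟩ := hF.bdd
  refine ⟨2 * C * ∫ y, |g y|, fun s hs => ?_⟩
  have ig := cv_integrable (hk_integrable hs) hg.integrable
  have i1 : Integrable (fun x => F x * g x) :=
    hg.integrable.bdd_mul (c := R) hF.meas.aestronglyMeasurable (Eventually.of_forall hF1)
  have i2 : Integrable (fun x => cv (hk s) F x * g x) :=
    hg.integrable.bdd_mul (c := gc0/s^3 * ∫ y, |F y|) (hF.c0 hs).aestronglyMeasurable
      (Eventually.of_forall fun x => cv_bd (hk_bd hs) hF.integrable x)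
  have i3 : Integrable (fun x => F x * cv (hk s) g x) :=
    ig.bdd_mul (c := R) hF.meas.aestronglyMeasurable (Eventually.of_forall hF1)
  have e : Phi F g s - ∫ x, F x * g x = (∫ x, (cv (hk s) F x - F x) * cv (hk s) g x)
      + ∫ x, (cv (hk s) F x - F x) * g x := by
    simp only [sub_mul]
    rw [integral_sub (phi_integrable hF hg hs) i3, integral_sub i2 i1, cv_self_adj hF hg hs]
    unfold Phi; ring
  rw [e]
  have j1 : |∫ x, (cv (hk s) F x - F x) * cv (hk s) g x| ≤ (C * s) * ∫ x, |g x| := by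
    have hi := cv_integrable (hk_integrable hs) (hg.integrable.abs)
    rw [← Real.norm_eq_abs]
    refine (norm_integral_le_of_norm_le (hi.const_mul (C*s)) (Eventually.of_forall fun x => ?_)).trans ?_
    · rw [norm_mul]
      have b : ‖cv (hk s) g x‖ ≤ cv (hk s) (fun y => |g y|) x := by
        unfold cv
        refine norm_integral_le_of_norm_le (cv_integrand (hk_cont s) (hk_bd hs) hg.integrable.abs x)
          (Eventually.of_forall fun y => ?_)
        rw [norm_mul, Real.norm_of_nonneg (hk_pos hs _).le, Real.norm_eq_abs]
      exact mul_le_mul (h s hs x) b (norm_nonneg _) (by positivity)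
    · rw [integral_const_mul, cv_integral (hk_integrable hs) hg.integrable.abs, hk_integral hs, one_mul]
  have j2 : |∫ x, (cv (hk s) F x - F x) * g x| ≤ (C * s) * ∫ x, |g x| := by
    rw [← Real.norm_eq_abs, ← integral_const_mul]
    refine (norm_integral_le_of_norm_le (hg.integrable.abs.const_mul (C*s)) (Eventually.of_forall fun x => ?_))
    rw [norm_mul]
    exact mul_le_mul_of_nonneg_right (h s hs x) (norm_nonneg _)
  refine (abs_add_le _ _).trans ?_
  linarith

lemma Ctrl.const_mul {ψ : ℝ → ℝ} {A : ℝ} (h : Ctrl ψ A) {c : ℝ} (hc : 0 ≤ c) :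
    Ctrl (fun s => c * ψ s) (c * A) := by
  obtain ⟨M, M', hM⟩ := h
  refine ⟨fun s => c * M s, fun s => c * M' s, fun s hs => ?_⟩
  obtain ⟨a, b, c', d⟩ := hM s hs
  refine ⟨a.const_mul c, ?_, by positivity, mul_le_mul_of_nonneg_left d hc⟩
  rw [abs_mul, abs_of_nonneg hc, ← mul_neg]; exact mul_le_mul_of_nonneg_left b hc

lemma pd_lip {Ω : Set E3} {v : E3 → E3} (hv : IsTestSol Ω v) (i j : Fin 3) :
    ∃ L : ℝ, ∀ x y, |pd v i j x - pd v i j y| ≤ L * ‖x-y‖ := by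
  have h1 : ContDiff ℝ 1 (pd v i j) := by
    rw [pd_eq hv]
    have : ContDiff ℝ 2 v := hv.smooth.of_le (WithTop.coe_le_coe.2 le_top)
    have h2 : ContDiff ℝ 2 (vc v j) :=
      (EuclideanSpace.proj j : E3 →L[ℝ] ℝ).contDiff.comp this
    unfold pds
    exact (h2.fderiv_right (m := 1) (by norm_num)).clm_apply contDiff_const
  have h2 : HasCompactSupport (pd v i j) := by
    rw [pd_eq hv]; exact pds_supp (vc_supp hv j) i
  obtain ⟨K, hK⟩ := h1.lipschitzWith_of_hasCompactSupport h2 (by norm_num)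
  refine ⟨K, fun x y => ?_⟩
  have := hK.dist_le_mul x y
  rwa [dist_eq_norm, dist_eq_norm] at this

lemma main_dual {Ω : Set E3} {v : E3 → E3} (hv : IsTestSol Ω v) {g : E3 → ℝ} (hg : Nice g) (i j : Fin 3)
    {A : Fin 3 → ℝ} (hA : ∀ m, Ctrl (fun s => s * Psi i m (om v m j) g s) (A m)) :
    |∫ x, pd v i j x * g x| ≤ 4 * ∑ m, A m := by
  have hF := pd_nice hv i j
  obtain ⟨L, hL⟩ := pd_lip hv i j
  have c1 := ((Ctrl.sum Finset.univ fun m _ => hA m).const_mul (by norm_num : (0:ℝ) ≤ 4)).neg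
  have hd : ∀ s > 0, HasDerivAt (Phi (pd v i j) g) (-(4 * ∑ m, s * Psi i m (om v m j) g s)) s := fun s hs => by
    refine (phi_deriv hF hg hs).congr_deriv ?_
    rw [psi_identity hv hg i j hs, ← Finset.mul_sum]; ring
  obtain ⟨C1, h1⟩ := phi_infty hF hg
  obtain ⟨C2, h2⟩ := phi_zero hF hL hg
  set I := ∫ x, pd v i j x * g x
  have hT : Tendsto (fun T : ℝ => 4 * ∑ m, A m + |C1| / T^3 + |C2| * T⁻¹) atTop (𝓝 (4 * ∑ m, A m + 0 + |C2| * 0)) := by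
    refine (tendsto_const_nhds.add ?_).add (tendsto_inv_atTop_zero.const_mul _)
    exact Tendsto.div_atTop tendsto_const_nhds (tendsto_pow_atTop (by norm_num))
  have : |I| ≤ 4 * ∑ m, A m + 0 + |C2| * 0 := by
    refine ge_of_tendsto hT ?_
    filter_upwards [eventually_ge_atTop (1:ℝ)] with T hT
    have hT0 : 0 < T := by linarith
    have a1 := h1 T hT0
    have a2 := h2 T⁻¹ (by positivity)
    have a3 := c1.diff hd (a := T⁻¹) (b := T) (by positivity) ((inv_le_one_of_one_le₀ hT).trans hT)
    have a4 : C1 / T^3 ≤ |C1| / T^3 := by gcongr; exact le_abs_self _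
    have a5 : C2 * T⁻¹ ≤ |C2| * T⁻¹ := by gcongr; exact le_abs_self _
    rw [abs_le] at *
    constructor <;> linarith
  simpa using this

/-! ### One-dimensional kernel integrals -/

lemma lint_abs (f : ℝ → ℝ≥0∞) (a : ℝ) :
    ∫⁻ t, f |t - a| = 2 * ∫⁻ t in Set.Ioi (0:ℝ), f t := by
  rw [lintegral_sub_right_eq_self (fun t => f |t|) a]
  rw [← lintegral_add_compl (fun t => f |t|) (measurableSet_Ioi (a := (0:ℝ))), two_mul]
  congr 1
  · refine setLIntegral_congr_fun measurableSet_Ioi (fun t ht => ?_)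
    simp only [abs_of_pos (Set.mem_Ioi.1 ht)]
  · rw [Set.compl_Ioi]
    have A : MeasurePreserving (fun x : ℝ => -x) volume volume := Measure.measurePreserving_neg volume
    have B : MeasurableEmbedding (fun x : ℝ => -x) := (Homeomorph.neg ℝ).measurableEmbedding
    rw [← A.setLIntegral_comp_preimage_emb B (fun t => f |t|)]
    simp only [abs_neg, Set.neg_preimage, Set.neg_Iic, neg_zero]
    rw [setLIntegral_congr (Ioi_ae_eq_Ici (a := (0:ℝ)) (μ := volume)).symm]
    refine setLIntegral_congr_fun measurableSet_Ioi (fun t ht => ?_)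
    simp only [abs_of_pos (Set.mem_Ioi.1 ht)]

lemma kern_L2 {b ρ : ℝ} (hb : 1 < b) (hρ : 0 < ρ) (x : ℝ) :
    ∫⁻ t, ENNReal.ofReal ((ρ + |t - x|) ^ (-b)) ≤ ENNReal.ofReal (2 / (b-1) * ρ ^ (1-b)) := by
  rw [lint_abs (fun t => ENNReal.ofReal ((ρ + t) ^ (-b))) x]
  have hi : IntegrableOn (fun t : ℝ => (t + ρ) ^ (-b)) (Set.Ioi 0) :=
    integrableOn_add_rpow_Ioi_of_lt (by linarith) (by linarith)
  have e1 : ∫⁻ t in Set.Ioi (0:ℝ), ENNReal.ofReal ((ρ + t) ^ (-b))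
      = ENNReal.ofReal (∫ t in Set.Ioi (0:ℝ), (t + ρ) ^ (-b)) := by
    rw [ofReal_integral_eq_lintegral_ofReal hi]
    · simp only [add_comm]
    · filter_upwards [ae_restrict_mem measurableSet_Ioi] with t ht
      exact Real.rpow_nonneg (by linarith [Set.mem_Ioi.1 ht]) _
  have e2 : ∫ t in Set.Ioi (0:ℝ), (t + ρ) ^ (-b) = ρ ^ (1-b) / (b-1) := by
    have A : MeasurePreserving (fun x : ℝ => x + ρ) volume volume := measurePreserving_add_right volume ρ
    have B : MeasurableEmbedding (fun x : ℝ => x + ρ) := (Homeomorph.addRight ρ).measurableEmbedding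
    have := A.setIntegral_preimage_emb B (fun t => t ^ (-b)) (Set.Ioi ρ)
    simp only [Set.preimage_add_const_Ioi, sub_self] at this
    rw [this, integral_Ioi_rpow_of_lt (by linarith) hρ]
    rw [show -b + 1 = 1 - b by ring, neg_div, ← div_neg]; congr 1; ring
  rw [e1, e2, show (2:ℝ≥0∞) = ENNReal.ofReal 2 by simp, ← ENNReal.ofReal_mul (by norm_num)]
  apply ENNReal.ofReal_le_ofReal
  apply le_of_eq; ring

lemma kern_L0 {σ ρ : ℝ} (h1 : σ < 1) (hρ : 0 < ρ) (a : ℝ) :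
    ∫⁻ t, ENNReal.ofReal (if |t - a| < ρ then |t - a| ^ (-σ) else 0) ≤
      ENNReal.ofReal (2 / (1-σ) * ρ ^ (1-σ)) := by
  rw [lint_abs (fun t => ENNReal.ofReal (if t < ρ then t ^ (-σ) else 0)) a]
  have hi : IntervalIntegrable (fun t : ℝ => t ^ (-σ)) volume 0 ρ :=
    intervalIntegral.intervalIntegrable_rpow' (by linarith)
  have hi2 : IntegrableOn (fun t : ℝ => t ^ (-σ)) (Set.Ioo 0 ρ) :=
    ((intervalIntegrable_iff_integrableOn_Ioo_of_le hρ.le).1 hi)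
  have e1 : ∫⁻ t in Set.Ioi (0:ℝ), ENNReal.ofReal (if t < ρ then t ^ (-σ) else 0)
      = ∫⁻ t in Set.Ioo 0 ρ, ENNReal.ofReal (t ^ (-σ)) := by
    rw [← lintegral_indicator measurableSet_Ioi, ← lintegral_indicator measurableSet_Ioo]
    congr 1; ext t
    by_cases h0 : 0 < t <;> by_cases h2 : t < ρ <;> simp [Set.indicator, h0, h2]
  have e2 : ∫⁻ t in Set.Ioo 0 ρ, ENNReal.ofReal (t ^ (-σ)) = ENNReal.ofReal (∫ t in Set.Ioo 0 ρ, t ^ (-σ)) := by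
    rw [ofReal_integral_eq_lintegral_ofReal hi2]
    filter_upwards [ae_restrict_mem measurableSet_Ioo] with t ht
    exact Real.rpow_nonneg ht.1.le _
  have e3 : ∫ t in Set.Ioo 0 ρ, t ^ (-σ) = ρ ^ (1-σ) / (1-σ) := by
    rw [← integral_Ioc_eq_integral_Ioo, ← intervalIntegral.integral_of_le hρ.le,
      integral_rpow (Or.inl (by linarith)), Real.zero_rpow (by linarith)]
    rw [show -σ + 1 = 1 - σ by ring]; ring
  rw [e1, e2, e3, show (2:ℝ≥0∞) = ENNReal.ofReal 2 by simp, ← ENNReal.ofReal_mul (by norm_num)]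
  apply ENNReal.ofReal_le_ofReal
  apply le_of_eq; ring

lemma kern_L1 {σ : ℝ} (h0 : 0 < σ) (h1 : σ < 1) {ρ : ℝ} (hρ : 0 < ρ) (a x : ℝ) :
    ∫⁻ t, ENNReal.ofReal (|t - a| ^ (-σ) * (ρ + |t - x|) ^ (-3 : ℝ)) ≤
      ENNReal.ofReal ((2 / (1-σ) + 1) * ρ ^ (-σ-2)) := by
  have pt : ∀ t, ENNReal.ofReal (|t - a| ^ (-σ) * (ρ + |t - x|) ^ (-3 : ℝ)) ≤
      ENNReal.ofReal (ρ ^ (-3 : ℝ)) * ENNReal.ofReal (if |t - a| < ρ then |t - a| ^ (-σ) else 0)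
      + ENNReal.ofReal (ρ ^ (-σ)) * ENNReal.ofReal ((ρ + |t - x|) ^ (-3 : ℝ)) := by
    intro t
    have p3 : 0 ≤ (ρ + |t-x|) ^ (-3:ℝ) := Real.rpow_nonneg (by positivity) _
    have pσ : 0 ≤ |t-a| ^ (-σ) := Real.rpow_nonneg (by positivity) _
    rw [← ENNReal.ofReal_mul (by positivity), ← ENNReal.ofReal_mul (by positivity)]
    by_cases h : |t - a| < ρ
    · rw [if_pos h]
      refine le_trans (ENNReal.ofReal_le_ofReal ?_) le_self_add
      rw [mul_comm]
      apply mul_le_mul_of_nonneg_right _ pσ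
      exact Real.rpow_le_rpow_of_nonpos hρ (by linarith [abs_nonneg (t-x)]) (by norm_num)
    · rw [if_neg h]
      refine le_trans (ENNReal.ofReal_le_ofReal ?_) le_add_self
      apply mul_le_mul_of_nonneg_right _ p3
      exact Real.rpow_le_rpow_of_nonpos hρ (not_lt.1 h) (by linarith)
  refine (lintegral_mono pt).trans ?_
  rw [lintegral_add_right _ (by fun_prop), lintegral_const_mul' _ _ (by simp), lintegral_const_mul' _ _ (by simp)]
  refine (add_le_add (mul_le_mul_right (kern_L0 h1 hρ a) _) (mul_le_mul_right (kern_L2 (by norm_num) hρ x) _)).trans ?_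
  have : 0 < 1 - σ := by linarith
  rw [← ENNReal.ofReal_mul (by positivity), ← ENNReal.ofReal_mul (by positivity), ← ENNReal.ofReal_add (by positivity) (by positivity)]
  apply ENNReal.ofReal_le_ofReal
  apply le_of_eq
  have a1 : ρ ^ (-3:ℝ) * ρ ^ (1-σ) = ρ ^ (-σ-2) := by rw [← Real.rpow_add hρ]; congr 1; ring
  have a2 : ρ ^ (-σ) * ρ ^ ((1:ℝ)-3) = ρ ^ (-σ-2) := by rw [← Real.rpow_add hρ]; congr 1; ring
  calc _ = 2/(1-σ) * (ρ ^ (-3:ℝ) * ρ ^ (1-σ)) + (ρ ^ (-σ) * ρ ^ ((1:ℝ)-3)) := by ring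
    _ = _ := by rw [a1, a2]; ring

lemma kern_R3 {σ : ℝ} (h0 : 0 < σ) (h1 : σ < 1) : ∃ C, 0 ≤ C ∧ ∀ (h : ℝ), 0 < h → ∀ (x0 x1 x2 : ℝ)
    (a : ℝ → ℝ → ℝ),
    ∫⁻ y0, ∫⁻ y1, ∫⁻ t, ENNReal.ofReal (|t - a y0 y1| ^ (-σ) * (h + |y0 - x0| + |y1 - x1| + |t - x2|) ^ (-3 : ℝ)) ≤
      ENNReal.ofReal (C * h ^ (-σ)) := by
  have h1' : 0 < 1 - σ := by linarith
  have h2' : 0 < σ+2-1 := by linarith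
  have h3' : 0 < σ+1-1 := by linarith
  refine ⟨(2 / (1-σ) + 1) * (2 / (σ+2-1) * (2 / (σ+1-1))), by positivity, ?_⟩
  intro h hh x0 x1 x2 a
  calc _ ≤ ∫⁻ y0, ∫⁻ y1, ENNReal.ofReal ((2 / (1-σ) + 1) * (h + |y0 - x0| + |y1 - x1|) ^ (-σ-2)) := by
        gcongr with y0 y1
        exact kern_L1 h0 h1 (by positivity) _ _
    _ ≤ ∫⁻ y0, ENNReal.ofReal (2 / (1-σ) + 1) * ENNReal.ofReal (2 / (σ+2-1) * (h + |y0 - x0|) ^ (1 - (σ+2))) := by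
        gcongr with y0
        simp_rw [ENNReal.ofReal_mul (show 0 ≤ 2 / (1-σ) + 1 by positivity)]
        rw [lintegral_const_mul' _ _ (by simp)]
        refine mul_le_mul_right ?_ _
        rw [show -σ - 2 = -(σ+2) by ring]
        exact kern_L2 (by linarith) (by positivity) _
    _ ≤ _ := by
        rw [lintegral_const_mul' _ _ (by simp)]
        simp_rw [ENNReal.ofReal_mul (show 0 ≤ 2 / (σ+2-1) by apply div_nonneg <;> linarith)]
        rw [lintegral_const_mul' _ _ (by simp), show 1 - (σ+2) = -(σ+1) by ring]
        refine (mul_le_mul_right (mul_le_mul_right (kern_L2 (by linarith) hh _) _) _).trans ?_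
        rw [← ENNReal.ofReal_mul (by apply div_nonneg <;> linarith), ← ENNReal.ofReal_mul (by positivity)]
        apply ENNReal.ofReal_le_ofReal
        rw [show 1 - (σ+1) = -σ by ring]
        apply le_of_eq; ring

lemma mk3_0 (a b c : ℝ) : mk3 a b c 0 = a := by simp [mk3]
lemma mk3_1 (a b c : ℝ) : mk3 a b c 1 = b := by simp [mk3]
lemma mk3_2 (a b c : ℝ) : mk3 a b c 2 = c := by simp [mk3]

lemma lint_E3 (F : E3 → ℝ≥0∞) (hF : Measurable F) :
    ∫⁻ y, F y = ∫⁻ y0, ∫⁻ y1, ∫⁻ t, F (mk3 y0 y1 t) := by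
  rw [← (PiLp.volume_preserving_toLp (Fin 3)).lintegral_comp hF]
  have hm : Measurable (fun z : Fin 3 → ℝ => F (WithLp.toLp 2 z)) :=
    hF.comp (PiLp.volume_preserving_toLp (Fin 3)).measurable
  have e1 := (volume_preserving_piFinSuccAbove (fun _ : Fin 3 => ℝ) 0).symm
  rw [← e1.lintegral_comp hm, Measure.volume_eq_prod, lintegral_prod _ (by
    exact (hm.comp (MeasurableEquiv.measurable _)).aemeasurable)]
  congr 1; ext y0
  have hm2 : Measurable (fun z : Fin 2 → ℝ => F (WithLp.toLp 2 ((MeasurableEquiv.piFinSuccAbove (fun _ : Fin 3 => ℝ) 0).symm (y0, z)))) :=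
    (hm.comp (MeasurableEquiv.measurable _)).comp (measurable_const.prodMk measurable_id)
  have e2 := (volume_preserving_finTwoArrow ℝ).symm
  rw [← e2.lintegral_comp hm2, Measure.volume_eq_prod, lintegral_prod _ (by
    exact (hm2.comp (MeasurableEquiv.measurable _)).aemeasurable)]
  congr 1; ext y1; congr 1; ext t; congr 1
  ext k; fin_cases k <;> simp [mk3, MeasurableEquiv.piFinSuccAbove, MeasurableEquiv.finTwoArrow, Fin.insertNth, MeasurableEquiv.piFinTwo]

lemma measurable_proj12 : Continuous proj12 := by
  unfold proj12 mk2
  refine (PiLp.continuous_toLp 2 _).comp ?_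
  refine continuous_pi (fun k => ?_)
  fin_cases k <;> simp <;> fun_prop

lemma kern_E3 {σ : ℝ} (h0 : 0 < σ) (h1 : σ < 1) : ∃ C, 0 ≤ C ∧ ∀ (h : ℝ), 0 < h → ∀ (x : E3)
    (a : E2 → ℝ), Continuous a →
    ∫⁻ y : E3, ENNReal.ofReal (|y 2 - a (proj12 y)| ^ (-σ) * (‖y - x‖ + h) ^ (-3 : ℝ)) ≤
      ENNReal.ofReal (C * h ^ (-σ)) := by
  obtain ⟨C, hC, hk⟩ := kern_R3 h0 h1
  refine ⟨27 * C, by positivity, fun h hh x a ha => ?_⟩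
  have hc := measurable_proj12
  rw [lint_E3 _ (by
    have : Measurable fun y : E3 => y 2 := (EuclideanSpace.proj (2 : Fin 3) : E3 →L[ℝ] ℝ).continuous.measurable
    have h2 : Measurable fun y : E3 => a (proj12 y) := (ha.comp hc).measurable
    fun_prop)]
  have := hk h hh (x 0) (x 1) (x 2) (fun y0 y1 => a (mk2 y0 y1))
  calc _ ≤ ∫⁻ y0, ∫⁻ y1, ∫⁻ t, ENNReal.ofReal 27 * ENNReal.ofReal (|t - a (mk2 y0 y1)| ^ (-σ) * (h + |y0 - x 0| + |y1 - x 1| + |t - x 2|) ^ (-3 : ℝ)) := by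
        gcongr with y0 y1 t
        rw [← ENNReal.ofReal_mul (by norm_num)]
        apply ENNReal.ofReal_le_ofReal
        rw [show proj12 (mk3 y0 y1 t) = mk2 y0 y1 by simp only [proj12, mk3_0, mk3_1], mk3_2, mul_left_comm]
        refine mul_le_mul_of_nonneg_left ?_ (by positivity)
        have n0 := PiLp.norm_apply_le (mk3 y0 y1 t - x) 0
        have n1 := PiLp.norm_apply_le (mk3 y0 y1 t - x) 1
        have n2 := PiLp.norm_apply_le (mk3 y0 y1 t - x) 2
        simp only [PiLp.sub_apply, mk3_0, mk3_1, mk3_2, Real.norm_eq_abs] at n0 n1 n2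
        have e : (h + |y0 - x 0| + |y1 - x 1| + |t - x 2|)/3 ≤ ‖mk3 y0 y1 t - x‖ + h := by linarith
        refine (Real.rpow_le_rpow_of_nonpos (by positivity) e (by norm_num)).trans ?_
        rw [Real.div_rpow (by positivity) (by norm_num)]
        rw [show (3:ℝ) ^ (-3:ℝ) = 1/27 by rw [Real.rpow_neg (by norm_num)]; norm_num]
        apply le_of_eq; ring
    _ ≤ _ := by
        simp_rw [lintegral_const_mul' _ _ (ENNReal.ofReal_ne_top)]
        rw [show 27 * C * h ^ (-σ) = 27 * (C * h ^ (-σ)) by ring, ENNReal.ofReal_mul (by norm_num)]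
        exact mul_le_mul_right this _

/-! ### Geometry of the domain -/

lemma iso_mp (f : E3 ≃ᵢ E3) : MeasurePreserving f volume volume := by
  have h1 := f.toRealLinearIsometryEquiv.measurePreserving
  have h2 := (measurePreserving_add_right (volume : Measure E3) (f 0)).comp h1
  have : ((fun x => x + f 0) ∘ f.toRealLinearIsometryEquiv : E3 → E3) = f := by
    ext1 x; simp
  rw [← this]; exact h2

lemma kern_iso {σ : ℝ} (h0 : 0 < σ) (h1 : σ < 1) : ∃ C, 0 ≤ C ∧ ∀ (h : ℝ), 0 < h → ∀ (x : E3)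
    (f : E3 ≃ᵢ E3) (a : E2 → ℝ), Continuous a →
    ∫⁻ y : E3, ENNReal.ofReal (|(f y) 2 - a (proj12 (f y))| ^ (-σ) * (‖y - x‖ + h) ^ (-3 : ℝ)) ≤
      ENNReal.ofReal (C * h ^ (-σ)) := by
  obtain ⟨C, hC, hk⟩ := kern_E3 h0 h1
  refine ⟨C, hC, fun h hh x f a ha => ?_⟩
  have := hk h hh (f x) a ha
  rw [← (iso_mp f).lintegral_comp (by
    have : Measurable fun y : E3 => y 2 := (EuclideanSpace.proj (2 : Fin 3) : E3 →L[ℝ] ℝ).continuous.measurable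
    have h2 : Measurable fun y : E3 => a (proj12 y) := (ha.comp measurable_proj12).measurable
    have h5 := measurable_proj12
    fun_prop)] at this
  simpa only [← dist_eq_norm, f.dist_eq] using this

lemma proj12_dist (u w : E3) : dist (proj12 u) (proj12 w) ≤ dist u w := by
  rw [EuclideanSpace.dist_eq, EuclideanSpace.dist_eq]
  apply Real.sqrt_le_sqrt
  simp [Fin.sum_univ_succ, proj12, mk2]

lemma proj12_zero : proj12 0 = 0 := by
  ext k; fin_cases k <;> simp [proj12, mk2]

lemma frontier_ne {Ω : Set E3} (hΩ : IsLipschitzDomain Ω) : (frontier Ω).Nonempty := by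
  by_contra h
  rw [Set.not_nonempty_iff_eq_empty, ← isClopen_iff_frontier_eq_empty, isClopen_iff] at h
  rcases h with h | h
  · exact hΩ.nonempty.ne_empty h
  · exact NormedSpace.unbounded_univ ℝ E3 (h ▸ hΩ.isBounded)

lemma frontier_cpt {Ω : Set E3} (hΩ : IsLipschitzDomain Ω) : IsCompact (frontier Ω) :=
  Metric.isCompact_of_isClosed_isBounded isClosed_frontier
    (hΩ.isBounded.closure.subset frontier_subset_closure)

lemma notin_frontier {Ω : Set E3} (hΩ : IsLipschitzDomain Ω) {y : E3} (hy : y ∈ Ω) : y ∉ frontier Ω := by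
  intro h
  have : y ∈ Ω ∩ frontier Ω := ⟨hy, h⟩
  rw [hΩ.isOpen.inter_frontier_eq] at this
  exact this

lemma dB_pos {Ω : Set E3} (hΩ : IsLipschitzDomain Ω) {y : E3} (hy : y ∈ Ω) : 0 < dB Ω y :=
  (isClosed_frontier.notMem_iff_infDist_pos (frontier_ne hΩ)).1 (notin_frontier hΩ hy)

lemma dB_nonneg (Ω : Set E3) (y : E3) : 0 ≤ dB Ω y := Metric.infDist_nonneg

lemma dB_cont (Ω : Set E3) : Continuous (dB Ω) := Metric.continuous_infDist_pt _

lemma dB_lip (Ω : Set E3) (x y : E3) : dB Ω x ≤ dB Ω y + ‖x - y‖ := by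
  rw [← dist_eq_norm]; exact Metric.infDist_le_infDist_add_dist

lemma chart_bound {Ω : Set E3} (hΩ : IsLipschitzDomain Ω) (P : E3) (hP : P ∈ frontier Ω) :
    ∃ (η : ℝ) (f : E3 ≃ᵢ E3) (a : E2 → ℝ), 0 < η ∧ Continuous a ∧ ∀ y ∈ Ω, y ∈ Metric.ball P η →
      0 < |(f y) 2 - a (proj12 (f y))| ∧ |(f y) 2 - a (proj12 (f y))| ≤ 2 * dB Ω y := by
  obtain ⟨f, R, R', r, a, hf, hR, hR', hr, hr1, hlip, -, hfr, -⟩ := hΩ.charts P hP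
  have key : ∀ z : E3, dist z P < min R R' → (z ∈ frontier Ω ↔ (f z) 2 = a (proj12 (f z))) := by
    intro z hz
    have h1 : dist (f z) 0 < min R R' := by rw [← hf, f.dist_eq]; exact hz
    have h2 : ‖proj12 (f z)‖ < R := by
      have := proj12_dist (f z) 0
      rw [proj12_zero, dist_zero_right] at this
      exact this.trans_lt (h1.trans_le (min_le_left _ _))
    have h3 : |(f z) 2| < R' := by
      have := PiLp.norm_apply_le (f z) 2
      rw [dist_zero_right] at h1
      exact (this.trans_lt h1).trans_le (min_le_right _ _)
    have := hfr (f z) h2 h3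
    rwa [f.symm_apply_apply] at this
  refine ⟨min R R' / 2, f, a, by positivity, hlip.continuous, fun y hy hyP => ?_⟩
  rw [Metric.mem_ball] at hyP
  have hm : 0 < min R R' := by positivity
  constructor
  · rw [abs_pos, sub_ne_zero]
    intro h
    exact notin_frontier hΩ hy ((key y (by linarith)).2 h)
  · obtain ⟨Q, hQ, hQd⟩ := (frontier_cpt hΩ).exists_infDist_eq_dist (frontier_ne hΩ) y
    have d1 : dB Ω y ≤ dist y P := Metric.infDist_le_dist_of_mem hP
    have d2 : dB Ω y = dist y Q := hQd
    have hQP : dist Q P < min R R' := by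
      have := dist_triangle_left Q P y
      linarith
    have e := (key Q hQP).1 hQ
    have b1 : |(f y) 2 - (f Q) 2| ≤ dist y Q := by
      have := PiLp.norm_apply_le (f y - f Q) 2
      rw [← dist_eq_norm, f.dist_eq] at this
      exact this
    have b2 : |a (proj12 (f Q)) - a (proj12 (f y))| ≤ dist y Q := by
      have h1 := hlip.dist_le_mul (proj12 (f Q)) (proj12 (f y))
      rw [Real.coe_toNNReal _ hr.le, Real.dist_eq] at h1
      have h2 := proj12_dist (f Q) (f y)
      rw [f.dist_eq, dist_comm Q y] at h2
      have h3 : 0 ≤ dist y Q := dist_nonneg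
      have h4 : 0 ≤ dist (proj12 (f Q)) (proj12 (f y)) := dist_nonneg
      nlinarith
    rw [d2]
    have : (f y) 2 - a (proj12 (f y)) = ((f y) 2 - (f Q) 2) + (a (proj12 (f Q)) - a (proj12 (f y))) := by
      rw [e]; ring
    rw [this]
    refine (abs_add_le _ _).trans ?_
    linarith

/-- The weighted kernel estimate. -/
lemma kern_dom {Ω : Set E3} (hΩ : IsLipschitzDomain Ω) {σ : ℝ} (h0 : 0 < σ) (h1 : σ < 1) :
    ∃ C, 0 ≤ C ∧ ∀ (h : ℝ), 0 < h → ∀ (x : E3),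
    ∫⁻ y in Ω, ENNReal.ofReal (dB Ω y ^ (-σ) * (‖y - x‖ + h) ^ (-3 : ℝ)) ≤
      ENNReal.ofReal (C * h ^ (-σ)) := by
  obtain ⟨C, hC, hk⟩ := kern_iso h0 h1
  choose! η f a hη ha hb using chart_bound hΩ
  obtain ⟨t, ht, hcov⟩ := (frontier_cpt hΩ).elim_nhds_subcover (fun P => Metric.ball P (η P))
    (fun P hP => Metric.ball_mem_nhds _ (hη P hP))
  obtain ⟨δ, hδ, hthick⟩ := (frontier_cpt hΩ).exists_thickening_subset_open
    (isOpen_biUnion (fun P _ => Metric.isOpen_ball)) hcov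
  obtain ⟨D0, hD0⟩ := hΩ.isBounded.subset_ball 0
  set D := max D0 0 with hD
  have hD' : 0 ≤ D := le_max_right _ _
  have hΩD : ∀ y ∈ Ω, ‖y‖ ≤ D := fun y hy => by
    have := hD0 hy
    rw [Metric.mem_ball, dist_zero_right] at this
    exact this.le.trans (le_max_left _ _)
  set C' := δ ^ (-σ) * (2 * D + 1) ^ σ with hC'
  have hC'0 : 0 ≤ C' := by positivity
  refine ⟨(∑ P ∈ t, 2 ^ σ * C) + C' * C, by positivity, fun h hh x => ?_⟩
  have pt : ∀ y ∈ Ω, ENNReal.ofReal (dB Ω y ^ (-σ) * (‖y - x‖ + h) ^ (-3 : ℝ)) ≤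
      (∑ P ∈ t, ENNReal.ofReal (2 ^ σ) * ENNReal.ofReal (|(f P y) 2 - a P (proj12 (f P y))| ^ (-σ) * (‖y - x‖ + h) ^ (-3 : ℝ)))
      + ENNReal.ofReal C' * ENNReal.ofReal (|((IsometryEquiv.refl E3) y) 2 - (fun _ => -(D+1)) (proj12 ((IsometryEquiv.refl E3) y))| ^ (-σ) * (‖y - x‖ + h) ^ (-3 : ℝ)) := by
    intro y hy
    have hK : 0 ≤ (‖y - x‖ + h) ^ (-3 : ℝ) := by positivity
    by_cases hd : dB Ω y < δ
    · have : y ∈ Metric.thickening δ (frontier Ω) :=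
        (Metric.mem_thickening_iff_infDist_lt (frontier_ne hΩ)).2 hd
      have := hthick this
      simp only [Set.mem_iUnion] at this
      obtain ⟨P, hP, hyP⟩ := this
      refine le_trans ?_ le_self_add
      refine le_trans ?_ (Finset.single_le_sum (f := fun P => ENNReal.ofReal (2 ^ σ) * ENNReal.ofReal (|(f P y) 2 - a P (proj12 (f P y))| ^ (-σ) * (‖y - x‖ + h) ^ (-3 : ℝ))) (fun _ _ => zero_le) hP)
      obtain ⟨q1, q2⟩ := hb P (ht P hP) y hy hyP
      beta_reduce
      rw [← ENNReal.ofReal_mul (by positivity), ← mul_assoc]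
      apply ENNReal.ofReal_le_ofReal
      refine mul_le_mul_of_nonneg_right ?_ hK
      set w := |(f P y) 2 - a P (proj12 (f P y))|
      have : dB Ω y ^ (-σ) ≤ (w / 2) ^ (-σ) :=
        Real.rpow_le_rpow_of_nonpos (by positivity) (by linarith) (by linarith)
      refine this.trans (le_of_eq ?_)
      rw [Real.div_rpow q1.le (by norm_num), Real.rpow_neg (show (0:ℝ) ≤ 2 by norm_num), div_inv_eq_mul, mul_comm]
    · refine le_trans ?_ le_add_self
      rw [← ENNReal.ofReal_mul (by positivity), ← mul_assoc]
      apply ENNReal.ofReal_le_ofReal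
      refine mul_le_mul_of_nonneg_right ?_ hK
      have n2 : |y 2| ≤ D := (PiLp.norm_apply_le y 2).trans (hΩD y hy)
      have n3 := abs_le.1 n2
      show _ ≤ C' * |y 2 - -(D+1)| ^ (-σ)
      rw [abs_of_pos (by linarith)]
      have e1 : dB Ω y ^ (-σ) ≤ δ ^ (-σ) :=
        Real.rpow_le_rpow_of_nonpos hδ (not_lt.1 hd) (by linarith)
      have e2 : (2 * D + 1) ^ (-σ) ≤ (y 2 - -(D+1)) ^ (-σ) :=
        Real.rpow_le_rpow_of_nonpos (by linarith) (by linarith) (by linarith)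
      refine e1.trans ?_
      calc δ ^ (-σ) = C' * (2 * D + 1) ^ (-σ) := by
            rw [hC', mul_assoc, ← Real.rpow_add (by positivity)]; simp
        _ ≤ _ := mul_le_mul_of_nonneg_left e2 hC'0
  have mm : ∀ (f : E3 ≃ᵢ E3) (a : E2 → ℝ), Continuous a → Measurable (fun y => ENNReal.ofReal (|(f y) 2 - a (proj12 (f y))| ^ (-σ) * (‖y - x‖ + h) ^ (-3 : ℝ))) := by
    intro f a ha
    have h3 := f.continuous
    have : Measurable fun y : E3 => (f y) 2 := ((EuclideanSpace.proj (2 : Fin 3) : E3 →L[ℝ] ℝ).continuous.comp h3).measurable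
    have h2 : Measurable fun y : E3 => a (proj12 (f y)) := ((ha.comp measurable_proj12).comp h3).measurable
    have h5 := measurable_proj12
    fun_prop
  calc _ ≤ ∫⁻ y in Ω, _ := setLIntegral_mono' hΩ.isOpen.measurableSet pt
    _ ≤ _ := setLIntegral_le_lintegral _ _
    _ = _ := lintegral_add_right _ ((mm _ _ continuous_const).const_mul _)
    _ ≤ (∑ P ∈ t, ENNReal.ofReal (2 ^ σ) * ENNReal.ofReal (C * h ^ (-σ))) + ENNReal.ofReal C' * ENNReal.ofReal (C * h ^ (-σ)) := by
      rw [lintegral_finsetSum' _ (fun P hP => ((mm _ _ (ha P (ht P hP))).const_mul _).aemeasurable)]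
      refine add_le_add (Finset.sum_le_sum fun P hP => ?_) ?_
      · rw [lintegral_const_mul' _ _ ENNReal.ofReal_ne_top]
        exact mul_le_mul_right (hk h hh x _ _ (ha P (ht P hP))) _
      · rw [lintegral_const_mul' _ _ ENNReal.ofReal_ne_top]
        exact mul_le_mul_right (hk h hh x _ _ continuous_const) _
    _ ≤ _ := by
      rw [← ENNReal.ofReal_mul (by positivity), ← ENNReal.ofReal_mul (by positivity),
        ← ENNReal.ofReal_sum_of_nonneg (fun _ _ => by positivity), ← ENNReal.ofReal_add (by positivity) (by positivity)]
      apply ENNReal.ofReal_le_ofReal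
      rw [add_mul, Finset.sum_mul]
      apply le_of_eq; congr 1
      · refine Finset.sum_congr rfl fun _ _ => by ring
      · ring

/-! ### Weighted estimates -/

lemma dB_bdd {Ω : Set E3} (hΩ : IsLipschitzDomain Ω) : ∃ D, 0 < D ∧ ∀ y ∈ Ω, dB Ω y ≤ D := by
  obtain ⟨P, hP⟩ := frontier_ne hΩ
  obtain ⟨D0, hD0⟩ := hΩ.isBounded.subset_ball P
  refine ⟨max D0 1, by positivity, fun y hy => ?_⟩
  have := Metric.mem_ball.1 (hD0 hy)
  exact ((Metric.infDist_le_dist_of_mem hP).trans this.le).trans (le_max_left _ _)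

/-- Nice functions supported in `Ω` away from the boundary. -/
structure Good (Ω : Set E3) (δ : ℝ) (f : E3 → ℝ) : Prop where
  nice : Nice f
  supp : ∀ x, f x ≠ 0 → x ∈ Ω ∧ δ ≤ dB Ω x

lemma Good.weight {Ω : Set E3} (hΩ : IsLipschitzDomain Ω) {δ : ℝ} (hδ : 0 < δ) {f : E3 → ℝ} (hf : Good Ω δ f)
    (β : ℝ) {r : ℝ} (hr : 0 < r) : Nice (fun x => dB Ω x ^ β * |f x| ^ r) := by
  obtain ⟨D, hD, hDb⟩ := dB_bdd hΩ
  refine ((hf.nice.rpow hr).smul (δ ^ β + D ^ β)).of_le ?_ fun x => ?_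
  · have := (dB_cont Ω).measurable
    have := hf.nice.meas
    fun_prop
  · have hd := dB_nonneg Ω x
    have hc : 0 ≤ δ ^ β + D ^ β := by positivity
    have hff : 0 ≤ |f x| ^ r := by positivity
    rw [abs_of_nonneg (mul_nonneg (Real.rpow_nonneg hd _) hff), abs_of_nonneg (mul_nonneg hc hff)]
    by_cases h : f x = 0
    · rw [h, abs_zero, Real.zero_rpow hr.ne', mul_zero, mul_zero]
    · refine mul_le_mul_of_nonneg_right ?_ (by positivity)
      obtain ⟨h1, h2⟩ := hf.supp x h
      have h3 := hDb x h1
      rcases le_total 0 β with hb | hb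
      · have := Real.rpow_le_rpow hd h3 hb
        have : 0 ≤ δ ^ β := by positivity
        linarith
      · have := Real.rpow_le_rpow_of_nonpos hδ h2 hb
        have : 0 ≤ D ^ β := by positivity
        linarith

/-- weighted power integral -/
def WW (Ω : Set E3) (β r : ℝ) (f : E3 → ℝ) : ℝ := ∫ x, dB Ω x ^ β * |f x| ^ r

lemma WW_nonneg (Ω : Set E3) (β r : ℝ) (f : E3 → ℝ) : 0 ≤ WW Ω β r f :=
  integral_nonneg fun x => mul_nonneg (Real.rpow_nonneg (dB_nonneg _ _) _) (by positivity)

lemma half_bound {Ω : Set E3} (hΩ : IsLipschitzDomain Ω) {σ : ℝ} (h0 : 0 < σ) (h1 : σ < 1) :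
    ∃ C, 0 ≤ C ∧ ∀ u : E3 → ℝ, Measurable u → (∀ x, 0 ≤ u x) → (∀ x, u x ≠ 0 → x ∈ Ω) →
      ∫⁻ z : E3 × E3, ENNReal.ofReal (u z.1) *
        (Ω.indicator (fun x => ENNReal.ofReal (dB Ω x ^ (-σ) * (‖x - z.1‖ + dB Ω z.1) ^ (-3 : ℝ))) z.2) ∂(volume.prod volume)
        ≤ ∫⁻ y, ENNReal.ofReal (C * (u y * dB Ω y ^ (-σ))) := by
  obtain ⟨C, hC, hk⟩ := kern_dom hΩ h0 h1
  refine ⟨C, hC, fun u hu hu0 hsupp => ?_⟩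
  have hd := (dB_cont Ω).measurable
  rw [lintegral_prod]
  · refine lintegral_mono fun y => ?_
    dsimp only
    rw [lintegral_const_mul' _ _ ENNReal.ofReal_ne_top, lintegral_indicator hΩ.isOpen.measurableSet]
    by_cases h : u y = 0
    · simp [h]
    · refine (mul_le_mul_right (hk _ (dB_pos hΩ (hsupp y h)) y) _).trans ?_
      rw [← ENNReal.ofReal_mul (hu0 y)]
      apply ENNReal.ofReal_le_ofReal
      apply le_of_eq; ring
  · apply Measurable.aemeasurable
    have e : (fun z : E3 × E3 => ENNReal.ofReal (u z.1) *
        (Ω.indicator (fun x => ENNReal.ofReal (dB Ω x ^ (-σ) * (‖x - z.1‖ + dB Ω z.1) ^ (-3 : ℝ))) z.2)) =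
        fun z => ENNReal.ofReal (u z.1) * ((Prod.snd ⁻¹' Ω).indicator (fun z : E3 × E3 => ENNReal.ofReal (dB Ω z.2 ^ (-σ) * (‖z.2 - z.1‖ + dB Ω z.1) ^ (-3 : ℝ))) z) := by
      ext z; rfl
    rw [e]
    refine Measurable.mul (by fun_prop) (Measurable.indicator (by fun_prop) ?_)
    exact measurable_snd hΩ.isOpen.measurableSet

/-- the truncated kernel -/
def ek (Ω : Set E3) (δ : ℝ) (z : E3 × E3) : ℝ := 1 / (max δ (‖z.2 - z.1‖ + dB Ω z.1 + dB Ω z.2)) ^ 3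

lemma ek_meas (Ω : Set E3) (δ : ℝ) : Measurable (ek Ω δ) := by
  have hd := (dB_cont Ω).measurable
  unfold ek; fun_prop

lemma ek_nonneg (Ω : Set E3) {δ : ℝ} (hδ : 0 < δ) (z : E3 × E3) : 0 ≤ ek Ω δ z := by
  unfold ek
  have : 0 < max δ (‖z.2 - z.1‖ + dB Ω z.1 + dB Ω z.2) := lt_max_of_lt_left hδ
  positivity

lemma ek_bdd (Ω : Set E3) {δ : ℝ} (hδ : 0 < δ) (z : E3 × E3) : |ek Ω δ z| ≤ 1 / δ ^ 3 := by
  rw [abs_of_nonneg (ek_nonneg Ω hδ z)]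
  unfold ek
  have : δ ≤ max δ (‖z.2 - z.1‖ + dB Ω z.1 + dB Ω z.2) := le_max_left _ _
  gcongr

lemma ek_le (Ω : Set E3) {δ : ℝ} (z : E3 × E3) {w : ℝ} (hw : 0 < w) (h : w ≤ ‖z.2 - z.1‖ + dB Ω z.1 + dB Ω z.2) :
    ek Ω δ z ≤ w ^ (-3 : ℝ) := by
  unfold ek
  have h2 : w ≤ max δ (‖z.2 - z.1‖ + dB Ω z.1 + dB Ω z.2) := h.trans (le_max_right _ _)
  rw [Real.rpow_neg hw.le, one_div, show (3:ℝ) = ((3:ℕ):ℝ) by norm_num, Real.rpow_natCast]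
  gcongr

lemma off_weight {Ω : Set E3} (hΩ : IsLipschitzDomain Ω) {p q α : ℝ} (hpq : p.HolderConjugate q)
    (hα1 : -1 < α) (hα2 : α < p - 1) : ∃ C, 0 ≤ C ∧ ∀ f g δ, 0 < δ → Good Ω δ f → Good Ω δ g →
    ∫ z : E3 × E3, (|f z.1| * |g z.2|) * ek Ω δ z ∂(volume.prod volume) ≤
      C * (WW Ω α p f + WW Ω (-(α * q / p)) q g) := by
  have hp := hpq.lt
  have hp0 := hpq.pos
  have hq0 := hpq.symm.pos
  have hpq1 : 1 / p + 1 / q = 1 := by have := hpq.inv_add_inv_eq_one; simpa using this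
  obtain ⟨a, ha1, ha2⟩ : ∃ a, max 0 (-α / p) < a ∧ a < min (1 / p) (1 / q - α / p) := by
    apply exists_between
    have e1 : 1 / q = 1 - 1 / p := by linarith
    rw [max_lt_iff, lt_min_iff, lt_min_iff]
    refine ⟨⟨by positivity, ?_⟩, ?_, ?_⟩
    · rw [e1, show 1 - 1 / p - α / p = (p - 1 - α) / p by field_simp]
      apply div_pos <;> linarith
    · gcongr; linarith
    · have : 0 < 1 / q := by positivity
      rw [neg_div]; linarith
  rw [max_lt_iff] at ha1
  rw [lt_min_iff] at ha2
  set b := a + α / p with hb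
  have hb0 : 0 < b := by rw [hb]; have := ha1.2; rw [neg_div] at this; linarith
  have hbq : b * q < 1 := by
    have : b < 1 / q := by rw [hb]; linarith [ha2.2]
    rwa [lt_div_iff₀ hq0] at this
  have hap : a * p < 1 := by
    have := ha2.1
    rwa [lt_div_iff₀ hp0] at this
  obtain ⟨C1, hC1, hk1⟩ := half_bound hΩ (mul_pos ha1.1 hp0) hap
  obtain ⟨C2, hC2, hk2⟩ := half_bound hΩ (mul_pos hb0 hq0) hbq
  refine ⟨C1 + C2, by positivity, fun f g δ hδ hf hg => ?_⟩
  have hd := (dB_cont Ω).measurable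
  have i0 := ww_integrable hf.nice hg.nice (ek_meas Ω δ) (ek_bdd Ω hδ)
  have nn : ∀ z : E3 × E3, 0 ≤ (|f z.1| * |g z.2|) * ek Ω δ z := fun z =>
    mul_nonneg (by positivity) (ek_nonneg Ω hδ z)
  set u1 : E3 → ℝ := fun y => dB Ω y ^ (b * p) * |f y| ^ p with hu1
  set u2 : E3 → ℝ := fun y => dB Ω y ^ (a * q) * |g y| ^ q with hu2
  have m1 : Measurable u1 := by have := hf.nice.meas; rw [hu1]; fun_prop
  have m2 : Measurable u2 := by have := hg.nice.meas; rw [hu2]; fun_prop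
  have n1 : ∀ x, 0 ≤ u1 x := fun x => mul_nonneg (Real.rpow_nonneg (dB_nonneg _ _) _) (by positivity)
  have n2 : ∀ x, 0 ≤ u2 x := fun x => mul_nonneg (Real.rpow_nonneg (dB_nonneg _ _) _) (by positivity)
  have s1 : ∀ x, u1 x ≠ 0 → x ∈ Ω := fun x hx => (hf.supp x (by
    intro h; apply hx; simp [hu1, h, Real.zero_rpow hp0.ne'])).1
  have s2 : ∀ x, u2 x ≠ 0 → x ∈ Ω := fun x hx => (hg.supp x (by
    intro h; apply hx; simp [hu2, h, Real.zero_rpow hq0.ne'])).1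
  set T1 : E3 × E3 → ℝ≥0∞ := fun z => ENNReal.ofReal (u1 z.1) *
        (Ω.indicator (fun x => ENNReal.ofReal (dB Ω x ^ (-(a*p)) * (‖x - z.1‖ + dB Ω z.1) ^ (-3 : ℝ))) z.2) with hT1
  set T2 : E3 × E3 → ℝ≥0∞ := fun z => ENNReal.ofReal (u2 z.1) *
        (Ω.indicator (fun x => ENNReal.ofReal (dB Ω x ^ (-(b*q)) * (‖x - z.1‖ + dB Ω z.1) ^ (-3 : ℝ))) z.2) with hT2
  have pt : ∀ z : E3 × E3, ENNReal.ofReal ((|f z.1| * |g z.2|) * ek Ω δ z) ≤ T1 z + T2 z.swap := by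
    intro z
    by_cases hfz : f z.1 = 0
    · simp [hfz]
    by_cases hgz : g z.2 = 0
    · simp [hgz]
    obtain ⟨hy, hyδ⟩ := hf.supp _ hfz
    obtain ⟨hx, hxδ⟩ := hg.supp _ hgz
    have dy : 0 < dB Ω z.1 := by linarith
    have dx : 0 < dB Ω z.2 := by linarith
    simp only [hT1, hT2, Prod.fst_swap, Prod.snd_swap, Set.indicator_of_mem hx, Set.indicator_of_mem hy]
    rw [← ENNReal.ofReal_mul (n1 _), ← ENNReal.ofReal_mul (n2 _), ← ENNReal.ofReal_add
      (mul_nonneg (n1 _) (by positivity)) (mul_nonneg (n2 _) (by positivity))]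
    apply ENNReal.ofReal_le_ofReal
    have k1 : ek Ω δ z ≤ (‖z.2 - z.1‖ + dB Ω z.1) ^ (-3 : ℝ) := ek_le Ω z (by positivity) (by linarith)
    have k2 : ek Ω δ z ≤ (‖z.1 - z.2‖ + dB Ω z.2) ^ (-3 : ℝ) := ek_le Ω z (by positivity) (by
      rw [norm_sub_rev]; linarith)
    set A := dB Ω z.2 ^ (-a) * dB Ω z.1 ^ b with hA
    have A0 : 0 < A := by positivity
    have yg := Real.young_inequality_of_nonneg (a := A * |f z.1|) (b := A⁻¹ * |g z.2|) (by positivity) (by positivity) hpq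
    have e0 : A * |f z.1| * (A⁻¹ * |g z.2|) = |f z.1| * |g z.2| := by field_simp
    have e1 : (A * |f z.1|) ^ p = u1 z.1 * dB Ω z.2 ^ (-(a*p)) := by
      rw [Real.mul_rpow A0.le (by positivity), hA, Real.mul_rpow (by positivity) (by positivity),
        ← Real.rpow_mul dx.le, ← Real.rpow_mul dy.le, hu1]
      simp only [neg_mul]; ring
    have e2 : (A⁻¹ * |g z.2|) ^ q = u2 z.2 * dB Ω z.1 ^ (-(b*q)) := by
      rw [Real.mul_rpow (by positivity) (by positivity), hA, mul_inv, ← Real.rpow_neg dx.le, ← Real.rpow_neg dy.le,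
        Real.mul_rpow (by positivity) (by positivity),
        ← Real.rpow_mul dx.le, ← Real.rpow_mul dy.le, hu2]
      simp only [neg_mul, neg_neg]; ring
    rw [e0, e1, e2] at yg
    have p1 : 0 ≤ u1 z.1 * dB Ω z.2 ^ (-(a*p)) := mul_nonneg (n1 _) (by positivity)
    have p2 : 0 ≤ u2 z.2 * dB Ω z.1 ^ (-(b*q)) := mul_nonneg (n2 _) (by positivity)
    have hq := hpq.symm.lt
    have yg2 : |f z.1| * |g z.2| ≤ u1 z.1 * dB Ω z.2 ^ (-(a*p)) + u2 z.2 * dB Ω z.1 ^ (-(b*q)) :=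
      yg.trans (add_le_add (div_le_self p1 hp.le) (div_le_self p2 hq.le))
    have ek0 := ek_nonneg Ω hδ z
    calc _ ≤ (u1 z.1 * dB Ω z.2 ^ (-(a*p)) + u2 z.2 * dB Ω z.1 ^ (-(b*q))) * ek Ω δ z :=
          mul_le_mul_of_nonneg_right yg2 ek0
      _ = u1 z.1 * dB Ω z.2 ^ (-(a*p)) * ek Ω δ z + u2 z.2 * dB Ω z.1 ^ (-(b*q)) * ek Ω δ z := by ring
      _ ≤ u1 z.1 * dB Ω z.2 ^ (-(a*p)) * (‖z.2 - z.1‖ + dB Ω z.1) ^ (-3 : ℝ) + u2 z.2 * dB Ω z.1 ^ (-(b*q)) * (‖z.1 - z.2‖ + dB Ω z.2) ^ (-3 : ℝ) :=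
          add_le_add (mul_le_mul_of_nonneg_left k1 p1) (mul_le_mul_of_nonneg_left k2 p2)
      _ = _ := by ring
  have w1 : ∫⁻ y, ENNReal.ofReal (C1 * (u1 y * dB Ω y ^ (-(a*p)))) = ENNReal.ofReal (C1 * WW Ω α p f) := by
    have hw := (hf.weight hΩ hδ α hp0).integrable.const_mul C1
    unfold WW
    rw [← integral_const_mul, ofReal_integral_eq_lintegral_ofReal hw (Eventually.of_forall fun x =>
      mul_nonneg hC1 (mul_nonneg (Real.rpow_nonneg (dB_nonneg _ _) _) (by positivity)))]
    congr 1; ext y; congr 2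
    by_cases h : f y = 0
    · simp [hu1, h, Real.zero_rpow hp0.ne']
    · have := dB_pos hΩ (hf.supp y h).1
      simp only [hu1]
      rw [mul_right_comm, ← Real.rpow_add this]
      congr 2; rw [hb]; field_simp; ring
  have w2 : ∫⁻ y, ENNReal.ofReal (C2 * (u2 y * dB Ω y ^ (-(b*q)))) = ENNReal.ofReal (C2 * WW Ω (-(α*q/p)) q g) := by
    have hw := (hg.weight hΩ hδ (-(α*q/p)) hq0).integrable.const_mul C2
    unfold WW
    rw [← integral_const_mul, ofReal_integral_eq_lintegral_ofReal hw (Eventually.of_forall fun x =>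
      mul_nonneg hC2 (mul_nonneg (Real.rpow_nonneg (dB_nonneg _ _) _) (by positivity)))]
    congr 1; ext y; congr 2
    by_cases h : g y = 0
    · simp [hu2, h, Real.zero_rpow hq0.ne']
    · have := dB_pos hΩ (hg.supp y h).1
      simp only [hu2]
      rw [mul_right_comm, ← Real.rpow_add this]
      congr 2; rw [hb]; field_simp; ring
  have W1 := WW_nonneg Ω α p f
  have W2 := WW_nonneg Ω (-(α*q/p)) q g
  have fin : ENNReal.ofReal (∫ z : E3 × E3, (|f z.1| * |g z.2|) * ek Ω δ z ∂(volume.prod volume)) ≤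
      ENNReal.ofReal (C1 * WW Ω α p f + C2 * WW Ω (-(α*q/p)) q g) := by
    rw [ofReal_integral_eq_lintegral_ofReal i0 (Eventually.of_forall nn)]
    refine (lintegral_mono pt).trans ?_
    rw [ENNReal.ofReal_add (by positivity) (by positivity), ← w1, ← w2]
    have mT : Measurable T1 := by
      have e : T1 = fun z => ENNReal.ofReal (u1 z.1) * ((Prod.snd ⁻¹' Ω).indicator (fun z : E3 × E3 => ENNReal.ofReal (dB Ω z.2 ^ (-(a*p)) * (‖z.2 - z.1‖ + dB Ω z.1) ^ (-3 : ℝ))) z) := by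
        ext z; rfl
      rw [e]
      refine Measurable.mul (by fun_prop) (Measurable.indicator (by fun_prop) ?_)
      exact measurable_snd hΩ.isOpen.measurableSet
    rw [lintegral_add_left mT, lintegral_prod_swap T2]
    exact add_le_add (hk1 u1 m1 n1 s1) (hk2 u2 m2 n2 s2)
  have fin2 := (ENNReal.ofReal_le_ofReal_iff (by positivity)).1 fin
  refine fin2.trans ?_
  nlinarith

/-! ### Dyadic layers -/

def lay (Ω : Set E3) (n : ℤ) : Set E3 := {x | (2:ℝ) ^ n ≤ dB Ω x ∧ dB Ω x < (2:ℝ) ^ (n+1)}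
def lay3 (Ω : Set E3) (n : ℤ) : Set E3 := {x | (2:ℝ) ^ (n-1) ≤ dB Ω x ∧ dB Ω x < (2:ℝ) ^ (n+2)}

lemma lay_meas (Ω : Set E3) (n : ℤ) : MeasurableSet (lay Ω n) :=
  (measurableSet_le measurable_const (dB_cont Ω).measurable).inter
    (measurableSet_lt (dB_cont Ω).measurable measurable_const)

lemma lay3_meas (Ω : Set E3) (n : ℤ) : MeasurableSet (lay3 Ω n) :=
  (measurableSet_le measurable_const (dB_cont Ω).measurable).inter
    (measurableSet_lt (dB_cont Ω).measurable measurable_const)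

lemma two_zpow_facts (n : ℤ) : (0:ℝ) < 2 ^ n ∧ (2:ℝ) ^ (n-1) = 2 ^ n / 2 ∧ (2:ℝ) ^ (n+1) = 2 * 2 ^ n ∧ (2:ℝ) ^ (n+2) = 4 * 2 ^ n := by
  refine ⟨by positivity, ?_, ?_, ?_⟩
  · rw [zpow_sub₀ (by norm_num)]; simp
  · rw [zpow_add₀ (by norm_num)]; simp; ring
  · rw [zpow_add₀ (by norm_num)]; norm_num; ring

lemma lay_sub (Ω : Set E3) (n : ℤ) : lay Ω n ⊆ lay3 Ω n := by
  rintro x ⟨h1, h2⟩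
  obtain ⟨a, b, c, d⟩ := two_zpow_facts n
  rw [c] at h2
  exact ⟨by rw [b]; linarith, by rw [d]; linarith⟩

lemma two_le_iff {d : ℝ} (hd : 0 < d) (n : ℤ) : (2:ℝ) ^ n ≤ d ↔ n ≤ Int.log 2 d := by
  have := Int.zpow_le_iff_le_log (b := 2) (by norm_num) (x := n) hd
  simpa using this

lemma mem_lay_iff {Ω : Set E3} {x : E3} (hd : 0 < dB Ω x) (n : ℤ) : x ∈ lay Ω n ↔ n = Int.log 2 (dB Ω x) := by
  show (_ ∧ _) ↔ _
  rw [← not_le, two_le_iff hd, two_le_iff hd]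
  omega

lemma mem_lay3 {Ω : Set E3} {x : E3} (hd : 0 < dB Ω x) (n : ℤ) (h : x ∈ lay3 Ω n) :
    n ∈ Finset.Icc (Int.log 2 (dB Ω x) - 1) (Int.log 2 (dB Ω x) + 1) := by
  have h' : _ ∧ _ := h
  rw [← not_le, two_le_iff hd, two_le_iff hd] at h'
  rw [Finset.mem_Icc]
  omega

lemma lay_sum {Ω : Set E3} {δ D : ℝ} (hδ : 0 < δ) (hD : ∀ y ∈ Ω, dB Ω y ≤ D) {h : E3 → ℝ}
    (hs : ∀ x, h x ≠ 0 → x ∈ Ω ∧ δ ≤ dB Ω x) (x : E3) :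
    ∑ n ∈ Finset.Icc (Int.log 2 δ) (Int.log 2 D), (lay Ω n).indicator h x = h x := by
  by_cases hx : h x = 0
  · rw [hx]; apply Finset.sum_eq_zero; intro n _
    simp [Set.indicator, hx]
  obtain ⟨h1, h2⟩ := hs x hx
  have hd : 0 < dB Ω x := by linarith
  rw [Finset.sum_eq_single (Int.log 2 (dB Ω x))]
  · rw [Set.indicator_of_mem ((mem_lay_iff hd _).2 rfl)]
  · intro n _ hn
    rw [Set.indicator_of_notMem]
    rwa [mem_lay_iff hd]
  · intro hn
    exfalso; apply hn
    rw [Finset.mem_Icc]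
    exact ⟨Int.log_mono_right hδ h2, Int.log_mono_right hd (hD x h1)⟩

lemma Good.ind {Ω : Set E3} {δ : ℝ} {f : E3 → ℝ} (hf : Good Ω δ f) {E : Set E3} (hE : MeasurableSet E) :
    Good Ω δ (E.indicator f) where
  nice := hf.nice.of_le (hf.nice.meas.indicator hE) fun x => by
    by_cases h : x ∈ E <;> simp [h]
  supp x hx := hf.supp x fun h => hx (by by_cases h' : x ∈ E <;> simp [h', h])

lemma layer_sum {Ω : Set E3} (hΩ : IsLipschitzDomain Ω) {δ : ℝ} (hδ : 0 < δ) {h : E3 → ℝ} (hh : Good Ω δ h)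
    (β : ℝ) {r : ℝ} (hr : 0 < r) (S : Finset ℤ) (E : ℤ → Set E3) (hE : ∀ n, MeasurableSet (E n))
    (hE3 : ∀ n, E n ⊆ lay3 Ω n) :
    ∑ n ∈ S, WW Ω β r ((E n).indicator h) ≤ 3 * WW Ω β r h := by
  classical
  unfold WW
  rw [← integral_finsetSum _ (fun n _ => ((hh.ind (hE n)).weight hΩ hδ β hr).integrable), ← integral_const_mul]
  refine integral_mono (integrable_finsetSum _ (fun n _ => ((hh.ind (hE n)).weight hΩ hδ β hr).integrable))
    ((hh.weight hΩ hδ β hr).integrable.const_mul 3) fun x => ?_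
  show ∑ n ∈ S, dB Ω x ^ β * |(E n).indicator h x| ^ r ≤ 3 * (dB Ω x ^ β * |h x| ^ r)
  have nn : 0 ≤ dB Ω x ^ β * |h x| ^ r := mul_nonneg (Real.rpow_nonneg (dB_nonneg _ _) _) (by positivity)
  by_cases hx : h x = 0
  · have : ∀ n ∈ S, dB Ω x ^ β * |(E n).indicator h x| ^ r = 0 := fun n _ => by
      by_cases h' : x ∈ E n <;> simp [h', hx, Real.zero_rpow hr.ne']
    rw [Finset.sum_eq_zero this]; positivity
  have hd : 0 < dB Ω x := lt_of_lt_of_le hδ (hh.supp x hx).2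
  set I := Finset.Icc (Int.log 2 (dB Ω x) - 1) (Int.log 2 (dB Ω x) + 1) with hI
  have hle : ∀ n ∈ S, dB Ω x ^ β * |(E n).indicator h x| ^ r ≤ if n ∈ I then dB Ω x ^ β * |h x| ^ r else 0 := by
    intro n _
    by_cases h' : x ∈ E n
    · rw [if_pos (mem_lay3 hd n (hE3 n h')), Set.indicator_of_mem h']
    · rw [Set.indicator_of_notMem h', abs_zero, Real.zero_rpow hr.ne', mul_zero]
      split_ifs
      · exact nn
      · exact le_rfl
  refine (Finset.sum_le_sum hle).trans ?_
  rw [← Finset.sum_filter, Finset.sum_const, nsmul_eq_mul]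
  refine mul_le_mul_of_nonneg_right ?_ nn
  have c1 : (S.filter (fun n => n ∈ I)).card ≤ I.card := Finset.card_le_card (fun n hn => (Finset.mem_filter.1 hn).2)
  have c2 : I.card = 3 := by rw [hI, Int.card_Icc]; omega
  rw [c2] at c1
  exact_mod_cast c1

lemma pow_comp {d r : ℝ} (hd : 0 < d) (hr : 0 < r) (h1 : r ≤ 4 * d) (h2 : d ≤ 4 * r) (β : ℝ) :
    r ^ β ≤ 4 ^ |β| * d ^ β := by
  rcases le_total 0 β with hb | hb
  · rw [abs_of_nonneg hb, ← Real.mul_rpow (by norm_num) hd.le]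
    exact Real.rpow_le_rpow hr.le h1 hb
  · rw [abs_of_nonpos hb]
    have := Real.rpow_le_rpow_of_nonpos (x := d / 4) (y := r) (z := β) (by positivity) (by linarith) hb
    refine this.trans (le_of_eq ?_)
    rw [Real.div_rpow hd.le (by norm_num), Real.rpow_neg (by norm_num)]
    field_simp

lemma diag_scale {Ω : Set E3} (hΩ : IsLipschitzDomain Ω) {δ : ℝ} (hδ : 0 < δ) {h : E3 → ℝ} (hh : Good Ω δ h)
    {β e c r : ℝ} (he : 0 < e) (hc : 0 < c) (hr : 0 < r) (hce : c ^ e = r ^ β)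
    (hd : ∀ x, h x ≠ 0 → r ≤ 4 * dB Ω x ∧ dB Ω x ≤ 4 * r) :
    ∫ x, |c * h x| ^ e ≤ 4 ^ |β| * WW Ω β e h := by
  unfold WW
  rw [← integral_const_mul]
  refine integral_mono ((hh.nice.smul c).rpow he).integrable ((hh.weight hΩ hδ β he).integrable.const_mul _) fun x => ?_
  show |c * h x| ^ e ≤ 4 ^ |β| * (dB Ω x ^ β * |h x| ^ e)
  rw [abs_mul, Real.mul_rpow (abs_nonneg _) (abs_nonneg _), abs_of_pos hc, hce, ← mul_assoc]
  by_cases hx : h x = 0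
  · rw [hx, abs_zero, Real.zero_rpow he.ne', mul_zero, mul_zero]
  · refine mul_le_mul_of_nonneg_right ?_ (by positivity)
    obtain ⟨a, b⟩ := hd x hx
    exact pow_comp (lt_of_lt_of_le hδ (hh.supp x hx).2) hr a b β

lemma Psi_sum_right {ι : Type*} (S : Finset ι) {f : E3 → ℝ} {g : ι → E3 → ℝ} (hf : Nice f) (hg : ∀ n, Nice (g n))
    {s : ℝ} (hs : 0 < s) (i m : Fin 3) :
    Nice (fun x => ∑ n ∈ S, g n x) ∧ Psi i m f (fun x => ∑ n ∈ S, g n x) s = ∑ n ∈ S, Psi i m f (g n) s := by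
  classical
  induction S using Finset.induction_on with
  | empty =>
    simp only [Finset.sum_empty]
    have hn : Nice (fun _ : E3 => (0:ℝ)) := ⟨measurable_const, 1, one_pos, by simp, by simp⟩
    refine ⟨hn, ?_⟩
    have := Psi_smul_right i m f (fun _ => 0) 0 s
    simpa using this
  | insert a S ha ih =>
    simp only [Finset.sum_insert ha]
    exact ⟨(hg a).add ih.1, by rw [Psi_add_right (hg a) ih.1 hf hs, ih.2]⟩

lemma off_layer {Ω : Set E3} {D : ℝ} (hD : 0 ≤ D) {δ : ℝ} (hδ : 0 < δ) {f g : E3 → ℝ}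
    (hf : Good Ω δ f) (hg : Good Ω δ g) (n : ℤ) {s : ℝ} (hs : 0 < s) :
    ∫ z : E3 × E3, (|(lay3 Ω n)ᶜ.indicator f z.1| * |(lay Ω n).indicator g z.2|) * (D / (‖z.2-z.1‖+s)^3) ∂(volume.prod volume)
      ≤ (216 * D) * ∫ z : E3 × E3, (|f z.1| * |(lay Ω n).indicator g z.2|) * ek Ω δ z ∂(volume.prod volume) := by
  rw [← integral_const_mul]
  have hfr := hf.ind (lay3_meas Ω n).compl
  have hgn := hg.ind (lay_meas Ω n)
  refine integral_mono (ww_integrable hfr.nice hgn.nice (K := D / s ^ 3) (by fun_prop) fun z => ?_)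
    ((ww_integrable hf.nice hgn.nice (ek_meas Ω δ) (ek_bdd Ω hδ)).const_mul _) fun z => ?_
  · rw [abs_of_nonneg (by positivity)]
    gcongr
    linarith [norm_nonneg (z.2 - z.1)]
  · show (|(lay3 Ω n)ᶜ.indicator f z.1| * |(lay Ω n).indicator g z.2|) * (D / (‖z.2-z.1‖+s)^3) ≤
      216 * D * ((|f z.1| * |(lay Ω n).indicator g z.2|) * ek Ω δ z)
    have ek0 := ek_nonneg Ω hδ z
    by_cases h1 : z.1 ∈ (lay3 Ω n)ᶜ
    swap
    · rw [Set.indicator_of_notMem h1]; simp; positivity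
    by_cases h2 : z.2 ∈ lay Ω n
    swap
    · rw [Set.indicator_of_notMem h2]; simp
    rw [Set.indicator_of_mem h1, Set.indicator_of_mem h2]
    by_cases hfz : f z.1 = 0
    · simp [hfz]
    obtain ⟨-, hyδ⟩ := hf.supp _ hfz
    have dx := dB_nonneg Ω z.2
    have hN := norm_nonneg (z.2 - z.1)
    have l1 := dB_lip Ω z.2 z.1
    have l2 := dB_lip Ω z.1 z.2
    rw [norm_sub_rev] at l2
    set N := ‖z.2 - z.1‖ with hNd
    have key : N + dB Ω z.1 + dB Ω z.2 ≤ 6 * N := by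
      obtain ⟨a, b, c, d⟩ := two_zpow_facts n
      have h2' : _ ∧ _ := h2
      have h1' : ¬ (_ ∧ _) := h1
      rw [c] at h2'
      rw [b, d, not_and_or, not_le, not_lt] at h1'
      obtain ⟨q1, q2⟩ := h2'
      rcases h1' with h | h <;> linarith
    have eqk : ek Ω δ z = 1 / (N + dB Ω z.1 + dB Ω z.2) ^ 3 := by
      unfold ek; rw [max_eq_right]; linarith
    have hpos : 0 < N + dB Ω z.1 + dB Ω z.2 := by linarith
    have : D / (N + s) ^ 3 ≤ 216 * D * ek Ω δ z := by
      rw [eqk]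
      have : (N + dB Ω z.1 + dB Ω z.2) ^ 3 ≤ 216 * (N + s) ^ 3 := by
        calc _ ≤ (6 * (N + s)) ^ 3 := by gcongr; linarith
          _ = _ := by ring
      calc D / (N + s) ^ 3 = 216 * D * (1 / (216 * (N + s) ^ 3)) := by field_simp
        _ ≤ _ := by gcongr
    calc _ ≤ (|f z.1| * |g z.2|) * (216 * D * ek Ω δ z) := mul_le_mul_of_nonneg_left this (by positivity)
      _ = _ := by ring

/-- Weighted control. -/
lemma wctrl {Ω : Set E3} (hΩ : IsLipschitzDomain Ω) {p q α : ℝ} (hpq : p.HolderConjugate q)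
    (hα1 : -1 < α) (hα2 : α < p - 1) : ∃ C, 0 ≤ C ∧ ∀ f g δ, 0 < δ → Good Ω δ f → Good Ω δ g →
    ∀ i m, Ctrl (fun s => s * Psi i m f g s) (C * (WW Ω α p f + WW Ω (-(α * q / p)) q g)) := by
  obtain ⟨K, hK, hbell⟩ := bell hpq
  obtain ⟨D, hD, hoff⟩ := off_ctrl
  obtain ⟨C1, hC1, hw⟩ := off_weight hΩ hpq hα1 hα2
  obtain ⟨B, hB0, hB⟩ := dB_bdd hΩ
  have hp0 := hpq.pos
  have hq0 := hpq.symm.pos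
  set β := -(α * q / p) with hβ
  refine ⟨K * (3 * (4 ^ |α| + 4 ^ |β|)) + 216 * D * C1, by positivity, fun f g δ hδ hf hg i m => ?_⟩
  set S := Finset.Icc (Int.log 2 δ) (Int.log 2 B) with hS
  set gn : ℤ → E3 → ℝ := fun n => (lay Ω n).indicator g with hgn
  have hgG : ∀ n, Good Ω δ (gn n) := fun n => hg.ind (lay_meas Ω n)
  set fn : ℤ → E3 → ℝ := fun n => (lay3 Ω n).indicator f with hfn
  have hfG : ∀ n, Good Ω δ (fn n) := fun n => hf.ind (lay3_meas Ω n)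
  set fr : ℤ → E3 → ℝ := fun n => (lay3 Ω n)ᶜ.indicator f with hfrd
  have hfrG : ∀ n, Good Ω δ (fr n) := fun n => hf.ind (lay3_meas Ω n).compl
  have diag : ∀ n, Ctrl (fun s => s * Psi i m (fn n) (gn n) s)
      (K * (4 ^ |α| * WW Ω α p (fn n) + 4 ^ |β| * WW Ω β q (gn n))) := by
    intro n
    obtain ⟨a, b, c, d⟩ := two_zpow_facts n
    set l := ((2:ℝ) ^ n) ^ (α / p) with hl
    have hl0 : 0 < l := by positivity
    have h1 := hbell (fun x => l * fn n x) (fun x => l⁻¹ * gn n x) ((hfG n).nice.smul l) ((hgG n).nice.smul _) i m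
    refine (h1.mono (fun s hs => le_of_eq ?_) (mul_le_mul_of_nonneg_left (add_le_add
      (diag_scale hΩ hδ (hfG n) hp0 hl0 a ?_ fun x hx => ?_)
      (diag_scale hΩ hδ (hgG n) hq0 (by positivity) a ?_ fun x hx => ?_)) hK))
    · rw [Psi_smul_left, Psi_smul_right]
      congr 1; field_simp
    · rw [hl, ← Real.rpow_mul a.le]; congr 1; field_simp
    · have hx' : x ∈ lay3 Ω n := by
        by_contra h; exact hx (Set.indicator_of_notMem h f)
      have h' : _ ∧ _ := hx'
      rw [b, d] at h'
      constructor <;> linarith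
    · rw [hl, ← Real.rpow_neg a.le, ← Real.rpow_mul a.le, hβ]; congr 1; ring
    · have hx' : x ∈ lay Ω n := by
        by_contra h; exact hx (Set.indicator_of_notMem h g)
      have h' : _ ∧ _ := hx'
      rw [c] at h'
      constructor <;> linarith
  have off : ∀ n, Ctrl (fun s => s * Psi i m (fr n) (gn n) s)
      ((216 * D) * ∫ z : E3 × E3, (|f z.1| * |gn n z.2|) * ek Ω δ z ∂(volume.prod volume)) := fun n =>
    hoff _ _ (hfrG n).nice (hgG n).nice i m _ fun s hs => off_layer hD hδ hf hg n hs
  have tot := Ctrl.sum S (fun n _ => (diag n).add (off n))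
  refine (tot.mono (fun s hs => le_of_eq ?_) ?_)
  · congr 1
    have e1 : g = fun x => ∑ n ∈ S, gn n x := by
      ext x; exact (lay_sum hδ hB hg.supp x).symm
    conv_lhs => rw [e1]
    rw [(Psi_sum_right S hf.nice (fun n => (hgG n).nice) hs i m).2, Finset.mul_sum]
    refine Finset.sum_congr rfl fun n _ => ?_
    have e2 : f = fun x => fn n x + fr n x := by
      ext x; by_cases h : x ∈ lay3 Ω n <;> simp [hfn, hfrd, h]
    conv_lhs => rw [e2]
    rw [Psi_add_left (hfG n).nice (hfrG n).nice (hgG n).nice hs]; ring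
  · have W1 := WW_nonneg Ω α p f
    have W2 := WW_nonneg Ω β q g
    rw [Finset.sum_add_distrib, ← Finset.mul_sum, ← Finset.mul_sum, Finset.sum_add_distrib, ← Finset.mul_sum, ← Finset.mul_sum]
    have s1 := layer_sum hΩ hδ hf α hp0 S (lay3 Ω) (lay3_meas Ω) (fun n => le_rfl)
    have s2 := layer_sum hΩ hδ hg β hq0 S (lay Ω) (lay_meas Ω) (lay_sub Ω)
    have s3 : ∑ n ∈ S, ∫ z : E3 × E3, (|f z.1| * |gn n z.2|) * ek Ω δ z ∂(volume.prod volume) =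
        ∫ z : E3 × E3, (|f z.1| * |g z.2|) * ek Ω δ z ∂(volume.prod volume) := by
      rw [← integral_finsetSum _ (fun n _ => ww_integrable hf.nice (hgG n).nice (ek_meas Ω δ) (ek_bdd Ω hδ))]
      congr 1; ext z
      rw [← Finset.sum_mul, ← Finset.mul_sum]
      congr 2
      have := lay_sum hδ hB (h := fun x => |g x|) (fun x hx => hg.supp x (by simpa using hx)) z.2
      rw [← this]
      refine Finset.sum_congr rfl fun n _ => ?_
      by_cases h : z.2 ∈ lay Ω n <;> simp [hgn, h]
    rw [s3]
    have s4 := hw f g δ hδ hf hg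
    have t1 : (4:ℝ) ^ |α| * ∑ n ∈ S, WW Ω α p (fn n) ≤ 4 ^ |α| * (3 * WW Ω α p f) := mul_le_mul_of_nonneg_left s1 (by positivity)
    have t2 : (4:ℝ) ^ |β| * ∑ n ∈ S, WW Ω β q (gn n) ≤ 4 ^ |β| * (3 * WW Ω β q g) := mul_le_mul_of_nonneg_left s2 (by positivity)
    have t3 : 216 * D * ∫ z : E3 × E3, (|f z.1| * |g z.2|) * ek Ω δ z ∂(volume.prod volume) ≤ 216 * D * (C1 * (WW Ω α p f + WW Ω β q g)) :=
      mul_le_mul_of_nonneg_left s4 (by positivity)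
    have t4 : 4 ^ |α| * (3 * WW Ω α p f) + 4 ^ |β| * (3 * WW Ω β q g) ≤ (3 * (4 ^ |α| + 4 ^ |β|)) * (WW Ω α p f + WW Ω β q g) := by
      have p1 : (0:ℝ) ≤ 4 ^ |α| * WW Ω β q g := by positivity
      have p2 : (0:ℝ) ≤ 4 ^ |β| * WW Ω α p f := by positivity
      nlinarith
    have t5 := mul_le_mul_of_nonneg_left ((add_le_add t1 t2).trans t4) hK
    refine (add_le_add t5 t3).trans (le_of_eq ?_)
    ring

/-! ### Conclusion -/

lemma test_delta {Ω : Set E3} (hΩ : IsLipschitzDomain Ω) {v : E3 → E3} (hv : IsTestSol Ω v) :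
    ∃ δ, 0 < δ ∧ ∀ i j, Good Ω δ (pd v i j) := by
  have hc : IsCompact (tsupport v) := hv.compsupp
  obtain ⟨δ, hδ, hd⟩ : ∃ δ, 0 < δ ∧ ∀ x ∈ tsupport v, δ ≤ dB Ω x := by
    rcases (tsupport v).eq_empty_or_nonempty with h | h
    · exact ⟨1, one_pos, by simp [h]⟩
    · obtain ⟨x0, hx0, hm⟩ := hc.exists_isMinOn h (dB_cont Ω).continuousOn
      exact ⟨dB Ω x0, dB_pos hΩ (hv.suppin hx0), fun x hx => hm hx⟩
  refine ⟨δ, hδ, fun i j => ⟨pd_nice hv i j, fun x hx => ?_⟩⟩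
  have hx' : x ∈ tsupport v := by
    by_contra h
    apply hx
    unfold pd
    rw [fderiv_of_notMem_tsupport ℝ h]; simp
  exact ⟨hv.suppin hx', hd x hx'⟩

lemma Good.sub {Ω : Set E3} {δ : ℝ} {f g : E3 → ℝ} (hf : Good Ω δ f) (hg : Good Ω δ g) :
    Good Ω δ (fun x => f x - g x) where
  nice := hf.nice.sub hg.nice
  supp x hx := by
    by_cases h : f x = 0
    · exact hg.supp x fun h' => hx (by simp [h, h'])
    · exact hf.supp x h

lemma Good.add_abs {Ω : Set E3} {δ : ℝ} {f g h : E3 → ℝ} (hf : Good Ω δ f) (hg : Good Ω δ g) (hm : Measurable h)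
    (hle : ∀ x, |h x| ≤ |f x| + |g x|) : Good Ω δ h where
  nice := by
    obtain ⟨R, hR, h1, h2⟩ := hf.nice.bdd
    obtain ⟨R', hR', h1', h2'⟩ := hg.nice.bdd
    refine ⟨hm, R + R', by linarith, fun x => (hle x).trans (add_le_add (h1 x) (h1' x)), fun x hx => ?_⟩
    have := hle x
    rw [h2 x (by linarith), h2' x (by linarith)] at this
    simpa using this
  supp x hx := by
    by_cases h : f x = 0
    · refine hg.supp x fun h' => hx ?_
      have := hle x
      rw [h, h'] at this
      simpa using this
    · exact hf.supp x h

/-- The weighted a priori bound for a single derivative. -/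
lemma single_bound {Ω : Set E3} (hΩ : IsLipschitzDomain Ω) {p α : ℝ} (hp : 1 < p)
    (hα1 : -1 < α) (hα2 : α < p - 1) : ∃ C, 0 ≤ C ∧ ∀ v, IsTestSol Ω v → ∀ i j,
      WW Ω α p (pd v i j) ≤ C * ∑ m, WW Ω α p (om v m j) := by
  obtain ⟨q, hpq⟩ : ∃ q, p.HolderConjugate q := ⟨_, Real.HolderConjugate.conjExponent hp⟩
  obtain ⟨C, hC, hw⟩ := wctrl hΩ hpq hα1 hα2
  have hp0 := hpq.pos
  have hq0 := hpq.symm.pos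
  have hq1 := hpq.symm.lt
  set k := (1 / (24 * C + 1)) ^ (1 / (q - 1)) with hk
  have hk0 : 0 < k := by positivity
  have hkq : k ^ q * (24 * C) ≤ k := by
    have h1 : k ^ (q - 1) = 1 / (24 * C + 1) := by
      rw [hk, ← Real.rpow_mul (by positivity), one_div_mul_cancel (by linarith), Real.rpow_one]
    have h2 : k ^ q = k ^ (q - 1) * k := by
      nth_rewrite 3 [← Real.rpow_one k]
      rw [← Real.rpow_add hk0]; congr 1; ring
    rw [h2, h1]
    have : 1 / (24 * C + 1) * (24 * C) ≤ 1 := by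
      rw [one_div_mul_eq_div, div_le_one (by positivity)]; linarith
    nlinarith
  refine ⟨8 * C / k, by positivity, fun v hv i j => ?_⟩
  obtain ⟨δ, hδ, hgood⟩ := test_delta hΩ hv
  set F := pd v i j with hF
  have hFG : Good Ω δ F := hgood i j
  have hom : ∀ m, Good Ω δ (om v m j) := fun m => (hgood m j).sub (hgood j m)
  set g : E3 → ℝ := fun x => k * (dB Ω x ^ α * |F x| ^ (p - 1) * SignType.sign (F x)) with hg
  have hdm := (dB_cont Ω).measurable
  have hFm := hFG.nice.meas
  have hsm : Measurable (fun x => ((SignType.sign (F x) : SignType) : ℝ)) := by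
    have : (fun x => ((SignType.sign (F x) : SignType) : ℝ)) = fun x => if 0 < F x then 1 else if F x < 0 then -1 else 0 := by
      ext x; simp only [sign_apply]; split_ifs <;> simp
    rw [this]
    exact Measurable.ite (measurableSet_lt measurable_const hFm) measurable_const
      (Measurable.ite (measurableSet_lt hFm measurable_const) measurable_const measurable_const)
  have hgG : Good Ω δ g := by
    refine ⟨((hFG.weight hΩ hδ α (by linarith : 0 < p - 1)).smul k).of_le (by rw [hg]; fun_prop) fun x => ?_, fun x hx => hFG.supp x fun h => hx (by simp [hg, h])⟩
    simp only [hg]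
    rw [abs_mul, abs_mul k, abs_mul (dB Ω x ^ α * |F x| ^ (p - 1))]
    refine mul_le_mul_of_nonneg_left (mul_le_of_le_one_right (abs_nonneg _) ?_) (abs_nonneg _)
    rcases lt_trichotomy (F x) 0 with h | h | h <;> simp [h]
  set I := WW Ω α p F with hI
  have hI0 : 0 ≤ I := WW_nonneg _ _ _ _
  have e1 : ∫ x, F x * g x = k * I := by
    rw [hI, WW, ← integral_const_mul]
    congr 1; ext x
    simp only [hg]
    have : F x * SignType.sign (F x) = |F x| := self_mul_sign (F x)
    by_cases h : F x = 0
    · simp [h, Real.zero_rpow hp0.ne']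
    have h2 : |F x| ^ p = |F x| ^ (p - 1) * |F x| := by
      nth_rewrite 3 [← Real.rpow_one |F x|]
      rw [← Real.rpow_add (by positivity)]; congr 1; ring
    calc _ = k * (dB Ω x ^ α * (|F x| ^ (p - 1) * (F x * SignType.sign (F x)))) := by ring
      _ = _ := by rw [this, h2]
  have e2 : WW Ω (-(α * q / p)) q g = k ^ q * I := by
    rw [hI, WW, WW, ← integral_const_mul]
    congr 1; ext x
    by_cases h : F x = 0
    · simp [hg, h, Real.zero_rpow hp0.ne', Real.zero_rpow hq0.ne']
    have hd := dB_pos hΩ (hFG.supp x h).1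
    have hs : |((SignType.sign (F x) : SignType) : ℝ)| = 1 := by
      rcases lt_or_gt_of_ne h with h | h <;> simp [h]
    have hFa : 0 < |F x| := abs_pos.2 h
    have hga : |g x| = k * (dB Ω x ^ α * |F x| ^ (p - 1)) := by
      simp only [hg]
      rw [abs_mul, abs_mul (dB Ω x ^ α * |F x| ^ (p - 1)), hs, mul_one, abs_of_pos hk0, abs_of_pos (by positivity)]
    rw [hga, Real.mul_rpow hk0.le (by positivity), Real.mul_rpow (by positivity) (by positivity),
      ← Real.rpow_mul hd.le, ← Real.rpow_mul hFa.le, hpq.sub_one_mul_conj]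
    have : dB Ω x ^ (-(α * q / p)) * dB Ω x ^ (α * q) = dB Ω x ^ α := by
      rw [← Real.rpow_add hd]; congr 1
      have h3 := hpq.mul_eq_add
      field_simp
      linear_combination α * h3
    rw [← this]; ring
  have md := main_dual hv hgG.nice i j (fun m => hw (om v m j) g δ hδ (hom m) hgG i m)
  rw [← hF, e1, e2, abs_of_nonneg (by positivity)] at md
  rw [← Finset.mul_sum, Finset.sum_add_distrib] at md
  simp only [Finset.sum_const, Finset.card_univ, Fintype.card_fin, nsmul_eq_mul] at md
  set J := ∑ m, WW Ω α p (om v m j) with hJ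
  have h12 := mul_le_mul_of_nonneg_right hkq hI0
  rw [div_mul_eq_mul_div, le_div_iff₀ hk0]
  push_cast at md
  nlinarith

lemma om_le (v : E3 → E3) (m j : Fin 3) (x : E3) : |om v m j x| ≤ ‖vcurl v x‖ := by
  have h0 := PiLp.norm_apply_le (vcurl v x) 0
  have h1 := PiLp.norm_apply_le (vcurl v x) 1
  have h2 := PiLp.norm_apply_le (vcurl v x) 2
  simp only [vcurl, mk3_0, mk3_1, mk3_2, Real.norm_eq_abs] at h0 h1 h2
  unfold om
  have hn := norm_nonneg (vcurl v x)
  fin_cases m <;> fin_cases j <;> simp only [Fin.zero_eta, Fin.mk_one, Fin.reduceFinMk, sub_self, abs_zero, vcurl] <;>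
    first | assumption | (rw [abs_sub_comm]; assumption) | positivity

lemma curl_good {Ω : Set E3} {δ : ℝ} {v : E3 → E3} (h : ∀ i j, Good Ω δ (pd v i j)) :
    Good Ω δ (fun x => ‖vcurl v x‖) := by
  have e : ∀ x, ‖vcurl v x‖ = √((pd v 1 2 x - pd v 2 1 x)^2 + (pd v 2 0 x - pd v 0 2 x)^2 + (pd v 0 1 x - pd v 1 0 x)^2) := by
    intro x
    rw [EuclideanSpace.norm_eq]
    simp only [Fin.sum_univ_three, vcurl, mk3_0, mk3_1, mk3_2, Real.norm_eq_abs, sq_abs]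
  have hm := fun i j => (h i j).nice.meas
  have a1 := (h 1 2).sub (h 2 1)
  have a2 := (h 2 0).sub (h 0 2)
  have a3 := (h 0 1).sub (h 1 0)
  have b : Good Ω δ (fun x => |pd v 1 2 x - pd v 2 1 x| + |pd v 2 0 x - pd v 0 2 x|) :=
    a1.add_abs a2 (a1.nice.meas.abs.add a2.nice.meas.abs) fun x => by
      rw [abs_of_nonneg (by positivity)]
  refine b.add_abs a3 ?_ fun x => ?_
  · simp_rw [e]
    exact (((a1.nice.meas.pow_const 2).add (a2.nice.meas.pow_const 2)).add (a3.nice.meas.pow_const 2)).sqrt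
  · rw [abs_of_nonneg (norm_nonneg _), e, abs_of_nonneg (by positivity)]
    apply Real.sqrt_le_iff.2
    refine ⟨by positivity, ?_⟩
    rw [← sq_abs (pd v 1 2 x - pd v 2 1 x), ← sq_abs (pd v 2 0 x - pd v 0 2 x), ← sq_abs (pd v 0 1 x - pd v 1 0 x)]
    nlinarith [mul_nonneg (abs_nonneg (pd v 1 2 x - pd v 2 1 x)) (abs_nonneg (pd v 2 0 x - pd v 0 2 x)),
      mul_nonneg (abs_nonneg (pd v 1 2 x - pd v 2 1 x)) (abs_nonneg (pd v 0 1 x - pd v 1 0 x)),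
      mul_nonneg (abs_nonneg (pd v 2 0 x - pd v 0 2 x)) (abs_nonneg (pd v 0 1 x - pd v 1 0 x))]

lemma frob_pow_le (M : Fin 3 → Fin 3 → ℝ) {p : ℝ} (hp : 0 < p) :
    frob M ^ p ≤ 3 ^ p * ∑ i, ∑ j, |M i j| ^ p := by
  obtain ⟨⟨a, b⟩, hab⟩ := Finite.exists_max (fun z : Fin 3 × Fin 3 => |M z.1 z.2|)
  have h1 : frob M ≤ 3 * |M a b| := by
    unfold frob
    apply Real.sqrt_le_iff.2
    refine ⟨by positivity, ?_⟩
    calc ∑ i, ∑ j, (M i j) ^ 2 ≤ ∑ i : Fin 3, ∑ j : Fin 3, |M a b| ^ 2 := by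
          refine Finset.sum_le_sum fun i _ => Finset.sum_le_sum fun j _ => ?_
          rw [← sq_abs (M i j)]
          have := hab (i, j)
          simp only at this
          gcongr
      _ = _ := by rw [mul_pow, sq_abs]; simp; ring
  have h2 : frob M ^ p ≤ (3 * |M a b|) ^ p := Real.rpow_le_rpow (Real.sqrt_nonneg _) h1 hp.le
  rw [Real.mul_rpow (by norm_num) (abs_nonneg _)] at h2
  refine h2.trans (mul_le_mul_of_nonneg_left ?_ (by positivity))
  refine le_trans ?_ (Finset.single_le_sum (f := fun i => ∑ j, |M i j| ^ p) (fun i _ => by positivity) (Finset.mem_univ a))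
  exact Finset.single_le_sum (f := fun j => |M a j| ^ p) (fun i _ => by positivity) (Finset.mem_univ b)

theorem final_bound (Ω : Set E3) (hΩ : IsLipschitzDomain Ω) (p α : ℝ) (hp : 1 < p)
    (hα1 : -1 < α) (hα2 : α < p - 1) : ∃ C : ℝ, ∀ v, IsTestSol Ω v →
      ∫ x in Ω, dB Ω x ^ α * frob (gradv v x) ^ p ≤ C * ∫ x in Ω, dB Ω x ^ α * ‖vcurl v x‖ ^ p := by
  obtain ⟨C, hC, hs⟩ := single_bound hΩ hp hα1 hα2
  have hp0 : 0 < p := by linarith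
  refine ⟨3 ^ p * (27 * C), fun v hv => ?_⟩
  obtain ⟨δ, hδ, hgood⟩ := test_delta hΩ hv
  have hcg := curl_good hgood
  have hW : ∫ x in Ω, dB Ω x ^ α * ‖vcurl v x‖ ^ p = WW Ω α p (fun x => ‖vcurl v x‖) := by
    unfold WW
    simp only [abs_norm]
    apply setIntegral_eq_integral_of_forall_compl_eq_zero
    intro x hx
    have : ‖vcurl v x‖ = 0 := by
      by_contra h; exact hx (hcg.supp x h).1
    rw [this, Real.zero_rpow hp0.ne', mul_zero]
  have hJ : ∀ m j, WW Ω α p (om v m j) ≤ WW Ω α p (fun x => ‖vcurl v x‖) := by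
    intro m j
    unfold WW
    refine integral_mono ((((hgood m j).sub (hgood j m)).weight hΩ hδ α hp0).integrable) (hcg.weight hΩ hδ α hp0).integrable fun x => ?_
    show dB Ω x ^ α * |om v m j x| ^ p ≤ dB Ω x ^ α * |‖vcurl v x‖| ^ p
    rw [abs_norm]
    exact mul_le_mul_of_nonneg_left (Real.rpow_le_rpow (abs_nonneg _) (om_le v m j x) hp0.le) (Real.rpow_nonneg (dB_nonneg _ _) _)
  rw [hW]
  set J := WW Ω α p (fun x => ‖vcurl v x‖)
  have hI : ∀ i j, WW Ω α p (pd v i j) ≤ C * (3 * J) := by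
    intro i j
    refine (hs v hv i j).trans (mul_le_mul_of_nonneg_left ?_ hC)
    refine (Finset.sum_le_sum fun m _ => hJ m j).trans (le_of_eq ?_)
    simp
  have hintg : ∀ i j, Integrable (fun x => dB Ω x ^ α * |pd v i j x| ^ p) := fun i j =>
    ((hgood i j).weight hΩ hδ α hp0).integrable
  have hsum : Integrable (fun x => ∑ i, ∑ j, dB Ω x ^ α * |pd v i j x| ^ p) :=
    integrable_finsetSum _ fun i _ => integrable_finsetSum _ fun j _ => hintg i j
  have nnd : ∀ x, 0 ≤ dB Ω x ^ α := fun x => Real.rpow_nonneg (dB_nonneg _ _) _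
  have pt : ∀ x, dB Ω x ^ α * frob (gradv v x) ^ p ≤ 3 ^ p * ∑ i, ∑ j, dB Ω x ^ α * |pd v i j x| ^ p := by
    intro x
    refine (mul_le_mul_of_nonneg_left (frob_pow_le (gradv v x) hp0) (nnd x)).trans (le_of_eq ?_)
    rw [mul_left_comm, Finset.mul_sum]
    congr 1
    refine Finset.sum_congr rfl fun i _ => ?_
    rw [Finset.mul_sum]; rfl
  calc _ ≤ ∫ x in Ω, 3 ^ p * ∑ i, ∑ j, dB Ω x ^ α * |pd v i j x| ^ p :=
        integral_mono_of_nonneg (Eventually.of_forall fun x => mul_nonneg (nnd x) (Real.rpow_nonneg (Real.sqrt_nonneg _) _))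
          ((hsum.const_mul _).integrableOn) (Eventually.of_forall pt)
    _ ≤ ∫ x, 3 ^ p * ∑ i, ∑ j, dB Ω x ^ α * |pd v i j x| ^ p := by
        refine setIntegral_le_integral (hsum.const_mul _) (Eventually.of_forall fun x => ?_)
        exact mul_nonneg (by positivity) (Finset.sum_nonneg fun i _ => Finset.sum_nonneg fun j _ => mul_nonneg (nnd x) (by positivity))
    _ = 3 ^ p * ∑ i, ∑ j, WW Ω α p (pd v i j) := by
        rw [integral_const_mul, integral_finsetSum _ (fun i _ => integrable_finsetSum _ fun j _ => hintg i j)]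
        congr 1
        refine Finset.sum_congr rfl fun i _ => ?_
        rw [integral_finsetSum _ (fun j _ => hintg i j)]; rfl
    _ ≤ 3 ^ p * ∑ i : Fin 3, ∑ j : Fin 3, C * (3 * J) := by
        refine mul_le_mul_of_nonneg_left ?_ (by positivity)
        exact Finset.sum_le_sum fun i _ => Finset.sum_le_sum fun j _ => hI i j
    _ = _ := by simp; ring

/-- Weighted control of the gradient by the curl for solenoidal test
fields: `∫_Ω d^α |∇v|^p ≤ C ∫_Ω d^α |curl v|^p` for `-1 < α < p - 1`. -/
theorem weighted_curl_controls_gradient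
    (Ω : Set E3) (hΩ : IsLipschitzDomain Ω) (p α : ℝ) (hp : 1 < p)
    (hα1 : -1 < α) (hα2 : α < p - 1) :
    ∃ C : ℝ, ∀ v : E3 → E3, IsTestSol Ω v →
      ∫ x in Ω, dB Ω x ^ α * frob (gradv v x) ^ p
        ≤ C * ∫ x in Ω, dB Ω x ^ α * ‖vcurl v x‖ ^ p := by
  exact final_bound Ω hΩ p α hp hα1 hα2
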